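/- arXiv:2401.15405 — 3 statements merged into one kernel-verified Lean document; each statement's English description precedes it below -/
import Mathlib

section
/- Define h : ℝ^n → ℝ by h(x) = ‖x‖₁/‖x‖₂ for x ≠ 0 and h(0) = 1. Let ρ > 0, q ∈ ℝ^n, and suppose x* ≠ 0 is a global minimizer over ℝ^n of x ↦ h(x) + (ρ/2)‖x − q‖₂². Set a = ‖x*‖₁ and r = ‖x*‖₂. Then there exists s ∈ ℝ^n with |sᵢ| ≤ 1 for all i and sᵢ = sign(x*ᵢ) whenever x*ᵢ ≠ 0, such that s/r − (a/r³)·x* + ρ·(x* − q) = 0. -/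
noncomputable section
open Classical

/-- The ℓ¹ norm on ℝ^n. -/
def l1 {n : ℕ} (x : EuclideanSpace ℝ (Fin n)) : ℝ := ∑ i, |x i|

/-- The ratio ‖x‖₁/‖x‖₂ with the convention that it equals 1 at the origin. -/
def ratio {n : ℕ} (x : EuclideanSpace ℝ (Fin n)) : ℝ :=
  if x = 0 then 1 else l1 x / ‖x‖

theorem dir_nonneg (a r2 b d D ρ c e : ℝ) (hr : 0 < r2)
    (h : ∀ᶠ t in nhdsWithin (0:ℝ) (Set.Ioi 0),
      a / √r2 + ρ / 2 * D ≤ (a + c * t) / √(r2 + 2 * (e * b) * t + e ^ 2 * t ^ 2)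
        + ρ / 2 * (D + 2 * (e * d) * t + e ^ 2 * t ^ 2)) :
    0 ≤ c / √r2 - a * (e * b) / (√r2) ^ 3 + ρ * (e * d) := by
  have hs : 0 < √r2 := Real.sqrt_pos.2 hr
  have hsq : √r2 ^ 2 = r2 := Real.sq_sqrt hr.le
  have h1 : HasDerivAt (fun t : ℝ => a + c * t) c 0 := by
    simpa using ((hasDerivAt_id (0:ℝ)).const_mul c).const_add a
  have h2 : ∀ R u : ℝ, HasDerivAt (fun t : ℝ => R + 2 * u * t + e ^ 2 * t ^ 2) (2 * u) 0 := by
    intro R u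
    have := (((hasDerivAt_id (0:ℝ)).const_mul (2 * u)).const_add R).add
      (((hasDerivAt_id (0:ℝ)).pow 2).const_mul (e ^ 2))
    exact this.congr_deriv (by simp)
  have h3 := (h2 r2 (e * b)).sqrt (by simpa using hr.ne')
  have h4 := (h1.div h3 (by simpa using hs.ne')).add ((h2 D (e * d)).const_mul (ρ / 2))
  have h5 := (hasDerivWithinAt_iff_tendsto_slope' (by simp)).1 (h4.hasDerivWithinAt (s := Set.Ioi 0))
  have h6 := ge_of_tendsto (b := 0) h5 (by
    filter_upwards [h, self_mem_nhdsWithin] with t ht htp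
    have htp' : (0:ℝ) < t := htp
    rw [slope_def_field]
    apply div_nonneg _ (by linarith)
    simp
    linarith)
  refine h6.trans_eq ?_
  simp only [mul_zero, add_zero, ne_eq, OfNat.ofNat_ne_zero, not_false_eq_true, zero_pow]
  field_simp

theorem coord_nonneg {n : ℕ} (ρ : ℝ)
    (q xs : EuclideanSpace ℝ (Fin n)) (hxs : xs ≠ 0)
    (hmin : ∀ x : EuclideanSpace ℝ (Fin n),
      ratio xs + ρ / 2 * ‖xs - q‖ ^ 2 ≤ ratio x + ρ / 2 * ‖x - q‖ ^ 2)
    (i : Fin n) (c e : ℝ)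
    (hc : ∀ᶠ t in nhdsWithin (0:ℝ) (Set.Ioi 0), |xs i + t * e| = |xs i| + c * t) :
    0 ≤ c / ‖xs‖ - l1 xs * (e * xs i) / ‖xs‖ ^ 3 + ρ * (e * (xs i - q i)) := by
  have hpos : 0 < ‖xs‖ := norm_pos_iff.2 hxs
  have key := dir_nonneg (l1 xs) (‖xs‖ ^ 2) (xs i) (xs i - q i) (‖xs - q‖ ^ 2) ρ c e (by positivity)
  rw [Real.sqrt_sq hpos.le] at key
  apply key
  have hsm : ∀ t : ℝ, EuclideanSpace.single i (t * e) = t • EuclideanSpace.single i e := by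
    intro t
    ext j
    by_cases hj : j = i <;> simp [hj]
  have hne : ∀ᶠ t in nhdsWithin (0:ℝ) (Set.Ioi 0),
      xs + EuclideanSpace.single i (t * e) ≠ 0 := by
    have hcont : Filter.Tendsto (fun t : ℝ => ‖xs + EuclideanSpace.single i (t * e)‖)
        (nhdsWithin (0:ℝ) (Set.Ioi 0)) (nhds ‖xs‖) := by
      have hk : Continuous (fun t : ℝ => ‖xs + t • EuclideanSpace.single i e‖) := by fun_prop
      have := (hk.tendsto 0).mono_left (nhdsWithin_le_nhds (s := Set.Ioi 0))
      simpa [hsm] using this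
    filter_upwards [hcont.eventually (lt_mem_nhds hpos)] with t ht
    exact norm_pos_iff.1 ht
  have hn : ∀ (y : EuclideanSpace ℝ (Fin n)) (t : ℝ),
      ‖y + EuclideanSpace.single i (t * e)‖ ^ 2 = ‖y‖ ^ 2 + 2 * (e * y i) * t + e ^ 2 * t ^ 2 := by
    intro y t
    rw [norm_add_sq_real, EuclideanSpace.inner_single_right, PiLp.norm_single, Real.norm_eq_abs, sq_abs]
    simp
    ring
  filter_upwards [hc, hne] with t ht hnet
  have hm := hmin (xs + EuclideanSpace.single i (t * e))
  have hl : l1 (xs + EuclideanSpace.single i (t * e)) = l1 xs + c * t := by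
    unfold l1
    rw [← Finset.add_sum_erase _ _ (Finset.mem_univ i),
      ← Finset.add_sum_erase (a := i) _ (fun j => |xs j|) (Finset.mem_univ i)]
    have : ∑ j ∈ Finset.univ.erase i, |(xs + EuclideanSpace.single i (t * e)) j|
        = ∑ j ∈ Finset.univ.erase i, |xs j| := by
      apply Finset.sum_congr rfl
      intro j hj
      simp [Finset.ne_of_mem_erase hj]
    rw [this]
    simp [ht]
    ring
  have hd := hn (xs - q) t
  rw [sub_add_eq_add_sub] at hd
  rw [← hn xs t, Real.sqrt_sq (norm_nonneg _)]
  unfold ratio at hm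
  rw [if_neg hxs, if_neg hnet, hl, hd] at hm
  simpa using hm

theorem stmt5 {n : ℕ} (ρ : ℝ) (hρ : 0 < ρ)
    (q xs : EuclideanSpace ℝ (Fin n)) (hxs : xs ≠ 0)
    (hmin : ∀ x : EuclideanSpace ℝ (Fin n),
      ratio xs + ρ / 2 * ‖xs - q‖ ^ 2 ≤ ratio x + ρ / 2 * ‖x - q‖ ^ 2) :
    ∃ s : EuclideanSpace ℝ (Fin n),
      (∀ i, |s i| ≤ 1) ∧
      (∀ i, xs i ≠ 0 → s i = if 0 < xs i then 1 else -1) ∧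
      ‖xs‖⁻¹ • s - (l1 xs / ‖xs‖ ^ 3) • xs + ρ • (xs - q) = 0 := by
  have hpos : 0 < ‖xs‖ := norm_pos_iff.2 hxs
  have key := coord_nonneg ρ q xs hxs hmin
  have hs : ∀ (i : Fin n) (c e : ℝ),
      (∀ᶠ t in nhdsWithin (0:ℝ) (Set.Ioi 0), |xs i + t * e| = |xs i| + c * t) →
      e * (l1 xs / ‖xs‖ ^ 2 * xs i - ‖xs‖ * ρ * (xs i - q i)) ≤ c := by
    intro i c e h
    have h1 := mul_nonneg hpos.le (key i c e h)
    have h2 : ‖xs‖ * (c / ‖xs‖ - l1 xs * (e * xs i) / ‖xs‖ ^ 3 + ρ * (e * (xs i - q i)))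
      = c - e * (l1 xs / ‖xs‖ ^ 2 * xs i - ‖xs‖ * ρ * (xs i - q i)) := by
      field_simp
      ring
    linarith
  have hsmall : ∀ δ : ℝ, 0 < δ → ∀ᶠ t in nhdsWithin (0:ℝ) (Set.Ioi 0), 0 < t ∧ t < δ := by
    intro δ hδ
    exact Ioo_mem_nhdsGT hδ
  have hP : ∀ i, 0 < xs i → l1 xs / ‖xs‖ ^ 2 * xs i - ‖xs‖ * ρ * (xs i - q i) = 1 := by
    intro i hi
    have h1 := hs i 1 1 (by
      filter_upwards [hsmall _ hi] with t ht
      rw [abs_of_pos hi, abs_of_pos (by linarith)]; ring)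
    have h2 := hs i (-1) (-1) (by
      filter_upwards [hsmall _ hi] with t ht
      rw [abs_of_pos hi, abs_of_pos (by linarith)]; ring)
    linarith
  have hN : ∀ i, xs i < 0 → l1 xs / ‖xs‖ ^ 2 * xs i - ‖xs‖ * ρ * (xs i - q i) = -1 := by
    intro i hi
    have h1 := hs i (-1) 1 (by
      filter_upwards [hsmall _ (neg_pos.2 hi)] with t ht
      rw [abs_of_neg hi, abs_of_neg (by linarith)]; ring)
    have h2 := hs i 1 (-1) (by
      filter_upwards [hsmall _ (neg_pos.2 hi)] with t ht
      rw [abs_of_neg hi, abs_of_neg (by linarith)]; ring)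
    linarith
  refine ⟨WithLp.toLp 2 fun i => l1 xs / ‖xs‖ ^ 2 * xs i - ‖xs‖ * ρ * (xs i - q i), ?_, ?_, ?_⟩
  · intro i
    simp only
    rcases lt_trichotomy (xs i) 0 with hi | hi | hi
    · rw [hN i hi]; simp
    · have h1 := hs i 1 1 (by
        filter_upwards [hsmall 1 one_pos] with t ht
        rw [hi]; simp [abs_of_pos ht.1])
      have h2 := hs i 1 (-1) (by
        filter_upwards [hsmall 1 one_pos] with t ht
        rw [hi]; simp [abs_of_pos ht.1])
      rw [abs_le]
      constructor <;> linarith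
    · rw [hP i hi]; simp
  · intro i hi
    simp only
    rcases lt_or_gt_of_ne hi with h | h
    · rw [hN i h, if_neg (by linarith)]
    · rw [hP i h, if_pos h]
  · ext i
    simp
    field_simp
    ring
end
end

section
/- Let n ≥ 2, let u ∈ ℝ^n with uᵢ ≠ 0 for every i, let s ∈ ℝ^n with sᵢ = sign(uᵢ), a = ‖u‖₁, r = ‖u‖₂, and M = u sᵀ + s uᵀ − (3a/r²)·u uᵀ + a·I_n. Let V be an n×n real symmetric positive definite matrix with smallest eigenvalue λ_min(V). If 0 < γ < 2 r² λ_min(V) / (3√n), then the matrix V − (γ/r³)·M is positive definite. -/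
noncomputable section

theorem aux_scalar (p t c k X N : ℝ) (hk : 0 < k) (hN : N = k ^ 2)
    (hY : 0 ≤ X - p ^ 2) (ht : t ^ 2 ≤ (N - c ^ 2) * (X - p ^ 2)) :
    2 * p * t + c * (X - p ^ 2) ≤ 3 / 2 * k * X := by
  subst hN
  have h1 : 0 ≤ (3 / 2 * k * p - t) ^ 2 := sq_nonneg _
  have h2 : 0 ≤ (X - p ^ 2) * ((c - 3 / 4 * k) ^ 2 + 11 / 16 * k ^ 2) := by positivity
  have h3 : 0 ≤ (3 / 2 * k) * (3 / 2 * k * X - (2 * p * t + c * (X - p ^ 2))) := by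
    nlinarith
  have := nonneg_of_mul_nonneg_right h3 (by positivity)
  linarith

theorem aux_eig {n : ℕ} (V : Matrix (Fin n) (Fin n) ℝ) (hV : V.IsHermitian)
    (l : ℝ) (hl : l ∈ lowerBounds (Set.range hV.eigenvalues)) (x : Fin n → ℝ) :
    l * (x ⬝ᵥ x) ≤ x ⬝ᵥ (V.mulVec x) := by
  have hB : (V - algebraMap ℝ (Matrix (Fin n) (Fin n) ℝ) l).IsHermitian := by
    refine hV.sub ?_
    rw [Matrix.algebraMap_eq_diagonal]
    exact Matrix.isHermitian_diagonal _
  have hp : (V - algebraMap ℝ (Matrix (Fin n) (Fin n) ℝ) l).PosSemidef := by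
    rw [hB.posSemidef_iff_eigenvalues_nonneg]
    intro i
    have h := hB.eigenvalues_mem_spectrum_real i
    have h2 : hB.eigenvalues i + l ∈ spectrum ℝ V := by
      rw [spectrum.mem_iff] at h ⊢
      convert h using 2
      rw [map_add]; abel
    rw [hV.spectrum_real_eq_range_eigenvalues] at h2
    have := hl h2
    simp only [Pi.zero_apply]; linarith
  have := hp.dotProduct_mulVec_nonneg x
  rw [Matrix.sub_mulVec, dotProduct_sub, Algebra.algebraMap_eq_smul_one, Matrix.smul_mulVec,
    Matrix.one_mulVec, dotProduct_smul] at this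
  simp only [star_trivial, smul_eq_mul] at this
  linarith

theorem aux_M {n : ℕ} (u s x : Fin n → ℝ) (a r : ℝ) (hr : 0 < r) (hn : 0 < n)
    (huu : u ⬝ᵥ u = r ^ 2) (hus : u ⬝ᵥ s = a) (hss : s ⬝ᵥ s = n) :
    2 * (u ⬝ᵥ x) * (s ⬝ᵥ x) - 3 * a / r ^ 2 * (u ⬝ᵥ x) ^ 2 + a * (x ⬝ᵥ x)
      ≤ 3 / 2 * Real.sqrt n * r * (x ⬝ᵥ x) := by
  have hsu : s ⬝ᵥ u = a := by rw [dotProduct_comm, hus]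
  have hxu : x ⬝ᵥ u = u ⬝ᵥ x := dotProduct_comm _ _
  have hxs : x ⬝ᵥ s = s ⬝ᵥ x := dotProduct_comm _ _
  set P := u ⬝ᵥ x
  set Q := s ⬝ᵥ x
  set X := x ⬝ᵥ x with hX
  set z := x - (P / r ^ 2) • u with hz
  set w := s - (a / r ^ 2) • u with hw
  have hzz : z ⬝ᵥ z = X - (P / r) ^ 2 := by
    simp only [hz, sub_dotProduct, dotProduct_sub, smul_dotProduct, dotProduct_smul, huu, hxu,
      smul_eq_mul]
    change X - P / r ^ 2 * P - P / r ^ 2 * (P - _) = _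
    field_simp
    ring
  have hww : w ⬝ᵥ w = n - (a / r) ^ 2 := by
    simp only [hw, sub_dotProduct, dotProduct_sub, smul_dotProduct, dotProduct_smul, huu, hsu,
      hus, hss, smul_eq_mul]
    field_simp
    ring
  have hwz : w ⬝ᵥ z = Q - a / r * (P / r) := by
    simp only [hw, hz, sub_dotProduct, dotProduct_sub, smul_dotProduct, dotProduct_smul, huu, hsu,
      smul_eq_mul]
    change Q - a / r ^ 2 * P - P / r ^ 2 * (a - _) = _
    field_simp
    ring
  have hcs : (w ⬝ᵥ z) ^ 2 ≤ (w ⬝ᵥ w) * (z ⬝ᵥ z) := by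
    have := Finset.sum_mul_sq_le_sq_mul_sq Finset.univ w z
    simpa only [dotProduct, ← sq] using this
  have hz0 : 0 ≤ z ⬝ᵥ z := Finset.sum_nonneg fun i _ => mul_self_nonneg _
  rw [hwz, hww, hzz] at hcs
  rw [hzz] at hz0
  have hk : 0 < Real.sqrt n := Real.sqrt_pos.2 (by exact_mod_cast hn)
  have key := aux_scalar (P / r) (Q - a / r * (P / r)) (a / r) (Real.sqrt n) X n hk
    (Real.sq_sqrt (Nat.cast_nonneg n)).symm hz0 hcs
  have := mul_le_mul_of_nonneg_left key hr.le
  calc _ = r * (2 * (P / r) * (Q - a / r * (P / r)) + a / r * (X - (P / r) ^ 2)) := by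
        field_simp
        ring
    _ ≤ _ := this
    _ = _ := by ring

theorem stmt11 {n : ℕ} (hn : 2 ≤ n)
    (u : EuclideanSpace ℝ (Fin n)) (hu : ∀ i, u i ≠ 0)
    (s : Fin n → ℝ) (hs : ∀ i, s i = if 0 < u i then 1 else -1)
    (a r : ℝ) (ha : a = l1 u) (hr : r = ‖u‖)
    (M : Matrix (Fin n) (Fin n) ℝ)
    (hM : M = Matrix.vecMulVec (fun i => u i) s + Matrix.vecMulVec s (fun i => u i)
      - (3 * a / r ^ 2) • Matrix.vecMulVec (fun i => u i) (fun i => u i)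
      + a • (1 : Matrix (Fin n) (Fin n) ℝ))
    (V : Matrix (Fin n) (Fin n) ℝ) (hVpd : V.PosDef) (hVherm : V.IsHermitian)
    (lmin : ℝ) (hlmin : IsLeast (Set.range hVherm.eigenvalues) lmin)
    (γ : ℝ) (hγ : 0 < γ) (hγ' : γ < 2 * r ^ 2 * lmin / (3 * Real.sqrt n)) :
    (V - (γ / r ^ 3) • M).PosDef := by
  have hn0 : 0 < n := by omega
  have hu0 : u ≠ 0 := fun h => hu ⟨0, hn0⟩ (by simp [h])
  have hr0 : 0 < r := hr ▸ norm_pos_iff.2 hu0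
  have huu : (fun i => u i) ⬝ᵥ (fun i => u i) = r ^ 2 := by
    rw [hr, EuclideanSpace.norm_sq_eq]
    simp [dotProduct, sq]
  have hus : (fun i => u i) ⬝ᵥ s = a := by
    rw [ha, l1]
    refine Finset.sum_congr rfl fun i _ => ?_
    rw [hs i]
    split_ifs with h
    · rw [abs_of_pos h, mul_one]
    · rw [abs_of_nonpos (not_lt.1 h)]; ring
  have hss : s ⬝ᵥ s = n := by
    have : ∀ i, s i * s i = 1 := fun i => by rw [hs i]; split_ifs <;> norm_num
    simp [dotProduct, this]
  have hMh : M.IsHermitian := by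
    rw [hM]
    ext i j
    by_cases hij : i = j
    · subst hij; simp
    · simp [Matrix.vecMulVec_apply, Matrix.one_apply, hij, Ne.symm hij]
      ring
  refine Matrix.PosDef.of_dotProduct_mulVec_pos ?_ ?_
  · refine hVherm.sub ?_
    unfold Matrix.IsHermitian
    rw [Matrix.conjTranspose_smul, hMh.eq, star_trivial]
  intro x hx
  have hX : 0 < x ⬝ᵥ x := by
    have := Matrix.dotProduct_star_self_pos_iff (v := x)
    simpa using this.2 hx
  have h1 := aux_eig V hVherm lmin hlmin.2 x
  have h2 := aux_M (fun i => u i) s x a r hr0 hn0 huu hus hss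
  have hMx : x ⬝ᵥ (M.mulVec x) = 2 * ((fun i => u i) ⬝ᵥ x) * (s ⬝ᵥ x)
      - 3 * a / r ^ 2 * ((fun i => u i) ⬝ᵥ x) ^ 2 + a * (x ⬝ᵥ x) := by
    rw [hM]
    simp only [Matrix.add_mulVec, Matrix.sub_mulVec, Matrix.smul_mulVec, Matrix.one_mulVec,
      Matrix.vecMulVec_mulVec, dotProduct_add, dotProduct_sub, dotProduct_smul, smul_eq_mul,
      MulOpposite.smul_eq_mul_unop, MulOpposite.unop_op]
    rw [dotProduct_comm x s, dotProduct_comm x (fun i => u i)]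
    ring
  rw [star_trivial, Matrix.sub_mulVec, dotProduct_sub, Matrix.smul_mulVec, dotProduct_smul,
    smul_eq_mul, hMx]
  have hk : 0 < Real.sqrt n := Real.sqrt_pos.2 (by exact_mod_cast hn0)
  have h3 := mul_le_mul_of_nonneg_left h2 (show 0 ≤ γ / r ^ 3 by positivity)
  rw [lt_div_iff₀ (by positivity)] at hγ'
  have h4 : γ / r ^ 3 * (3 / 2 * Real.sqrt n * r) < lmin := by
    have : γ / r ^ 3 * (3 / 2 * Real.sqrt n * r) = γ * (3 * Real.sqrt n) / (2 * r ^ 2) := by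
      field_simp
    rw [this, div_lt_iff₀ (by positivity)]
    linarith
  have h5 := mul_lt_mul_of_pos_right h4 hX
  linarith
end
end

section
/- Let A be an m×n real matrix, b ∈ ℝ^m, Φ(x) = (1/2)‖Ax − b‖₂², and let L be a Lipschitz constant of ∇Φ (e.g. the operator norm of AᵀA). Let γ > 0 and β > 2L, suppose Aᵀb ≠ 0, and let (x^k, y^k, z^k) be an ADMM_p sequence with X = ℝ^n such that {x^k} is bounded. Then x^k converges to some x^∞ ∈ ℝ^n with x^∞ ≠ 0, and, setting a = ‖x^∞‖₁ and r = ‖x^∞‖₂, there exists s ∈ ℝ^n with |sᵢ| ≤ 1 for all i and sᵢ = sign(x^∞ᵢ) whenever x^∞ᵢ ≠ 0, such that γ·(s/r − (a/r³)·x^∞) + Aᵀ(Ax^∞ − b) = 0. -/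
noncomputable section
open Classical

/-- `(x, y, z)` is an ADMM_p sequence for data `(β, γ, X, Φ)`:
at every step, `x^{k+1}` globally minimizes the proximal subproblem of the ratio `‖·‖₁/‖·‖₂`
over `X`, `y^{k+1}` globally minimizes the `Φ`-subproblem, and `z` is updated by the
multiplier rule. -/
def ADMMpSeq {n : ℕ} (β γ : ℝ) (X : Set (EuclideanSpace ℝ (Fin n)))
    (Φ : EuclideanSpace ℝ (Fin n) → ℝ)
    (x y z : ℕ → EuclideanSpace ℝ (Fin n)) : Prop :=
  ∀ k : ℕ,
    (x (k + 1) ∈ X ∧ ∀ u ∈ X,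
      ratio (x (k + 1)) + β / (2 * γ) * ‖x (k + 1) - (y k - β⁻¹ • z k)‖ ^ 2 ≤
        ratio u + β / (2 * γ) * ‖u - (y k - β⁻¹ • z k)‖ ^ 2) ∧
    (∀ u : EuclideanSpace ℝ (Fin n),
      Φ (y (k + 1)) + β / 2 * ‖y (k + 1) - x (k + 1) - β⁻¹ • z k‖ ^ 2 ≤
        Φ u + β / 2 * ‖u - x (k + 1) - β⁻¹ • z k‖ ^ 2) ∧
    z (k + 1) = z k + β • (x (k + 1) - y (k + 1))


/-- Matrix–vector multiplication as a map between Euclidean spaces. -/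
def mv {m n : ℕ} (A : Matrix (Fin m) (Fin n) ℝ) (x : EuclideanSpace ℝ (Fin n)) :
    EuclideanSpace ℝ (Fin m) :=
  (WithLp.equiv 2 (Fin m → ℝ)).symm (A.mulVec (WithLp.equiv 2 (Fin n → ℝ) x))

/-! ### Order isomorphisms of the line moving finitely many points -/

lemma exists_lt_gap (Z : Finset ℝ) (u : ℝ) : ∃ c < u, ∀ z ∈ Z, z < u → z < c := by
  have h : ∀ᶠ c in nhdsWithin u (Set.Iio u), ∀ z ∈ Z, z < u → z < c := by
    rw [Filter.eventually_all_finset]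
    intro z _
    by_cases hz : z < u
    · have : ∀ᶠ c in nhdsWithin u (Set.Iio u), z < c :=
        nhdsWithin_le_nhds (lt_mem_nhds hz)
      filter_upwards [this] with c hc _ using hc
    · exact Filter.Eventually.of_forall fun c h => absurd h hz
  obtain ⟨c, hc, hcu⟩ := (h.and self_mem_nhdsWithin).exists
  exact ⟨c, hcu, hc⟩

lemma exists_gt_gap (Z : Finset ℝ) (u : ℝ) : ∃ c, u < c ∧ ∀ z ∈ Z, u < z → c < z := by
  have h : ∀ᶠ c in nhdsWithin u (Set.Ioi u), ∀ z ∈ Z, u < z → c < z := by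
    rw [Filter.eventually_all_finset]
    intro z _
    by_cases hz : u < z
    · have : ∀ᶠ c in nhdsWithin u (Set.Ioi u), c < z :=
        nhdsWithin_le_nhds (gt_mem_nhds hz)
      filter_upwards [this] with c hc _ using hc
    · exact Filter.Eventually.of_forall fun c h => absurd h hz
  obtain ⟨c, hc, hcu⟩ := (h.and self_mem_nhdsWithin).exists
  exact ⟨c, hcu, hc⟩

/-- `a` and `b` lie strictly on the same side of `z`. -/
def SameSide (z a b : ℝ) : Prop := (z < a ∧ z < b) ∨ (a < z ∧ b < z)

lemma bump_pos (Z : Finset ℝ) (u v : ℝ) (huv : u < v) (h : ∀ z ∈ Z, SameSide z u v) :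
    ∃ ψ : ℝ ≃o ℝ, ψ u = v ∧ ∀ z ∈ Z, ψ z = z := by
  obtain ⟨c, hcu, hc⟩ := exists_lt_gap Z u
  obtain ⟨d, hvd, hd⟩ := exists_gt_gap Z v
  have h1 : 0 < u - c := by linarith
  have h2 : 0 < d - u := by linarith
  have hs1 : 1 < (v - c) / (u - c) := by rw [lt_div_iff₀ h1]; linarith
  have hs2 : (d - v) / (d - u) < 1 := by rw [div_lt_iff₀ h2]; linarith
  have hs3 : 0 < (d - v) / (d - u) := div_pos (by linarith) h2
  set α := (v - c) / (u - c) with hα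
  set δ := (d - v) / (d - u) with hδ
  have hαv : α * (u - c) = v - c := by rw [hα]; field_simp
  have hδv : δ * (d - u) = d - v := by rw [hδ]; field_simp
  let f : ℝ → ℝ := fun x => max x (min (c + α * (x - c)) (d + δ * (x - d)))
  have hmono : StrictMono f := by
    intro x y hxy
    apply max_lt_max hxy
    apply min_lt_min
    · nlinarith
    · nlinarith
  have hcont : Continuous f := by fun_prop
  have hle : ∀ x ≤ c, f x = x := by
    intro x hx
    apply max_eq_left
    apply (min_le_left _ _).trans
    nlinarith
  have hge : ∀ x, d ≤ x → f x = x := by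
    intro x hx
    apply max_eq_left
    apply (min_le_right _ _).trans
    nlinarith
  have hsurj : Function.Surjective f := by
    intro y
    rcases le_total y c with hy | hy
    · exact ⟨y, hle y hy⟩
    rcases le_total d y with hy' | hy'
    · exact ⟨y, hge y hy'⟩
    have := intermediate_value_Icc (show c ≤ d by linarith) hcont.continuousOn
    rw [hle c le_rfl, hge d le_rfl] at this
    obtain ⟨x, _, hx⟩ := this ⟨hy, hy'⟩
    exact ⟨x, hx⟩
  refine ⟨StrictMono.orderIsoOfSurjective f hmono hsurj, ?_, ?_⟩
  · change f u = v
    have e1 : c + α * (u - c) = v := by linarith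
    have e2 : d + δ * (u - d) = v := by linarith
    simp only [f, e1, e2, min_self]
    exact max_eq_right huv.le
  · intro z hz
    change f z = z
    rcases h z hz with h | h
    · exact hle z (hc z hz h.1).le
    · exact hge z (hd z hz h.2).le

lemma bump (Z : Finset ℝ) (u v : ℝ) (h : ∀ z ∈ Z, SameSide z u v) :
    ∃ ψ : ℝ ≃o ℝ, ψ u = v ∧ ∀ z ∈ Z, ψ z = z := by
  rcases lt_trichotomy u v with huv | huv | huv
  · exact bump_pos Z u v huv h
  · exact ⟨OrderIso.refl ℝ, huv, fun _ _ => rfl⟩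
  · obtain ⟨ψ, h1, h2⟩ := bump_pos Z v u huv (fun z hz => by
      rcases h z hz with h | h
      · exact Or.inl ⟨h.2, h.1⟩
      · exact Or.inr ⟨h.2, h.1⟩)
    refine ⟨ψ.symm, ?_, fun z hz => ?_⟩
    · rw [← h1]; simp
    · conv_lhs => rw [← h2 z hz]
      simp

lemma multi_bump (Z : Finset ℝ) (v : ℝ → ℝ) (M : Finset ℝ)
    (h : ∀ m ∈ M, ∀ z ∈ Z, SameSide z m (v m))
    (hsep : ∀ m ∈ M, ∀ m' ∈ M, m < m' → ∃ z ∈ Z, m < z ∧ z < m') :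
    ∃ ψ : ℝ ≃o ℝ, (∀ z ∈ Z, ψ z = z) ∧ ∀ m ∈ M, ψ m = v m := by
  induction M using Finset.induction_on with
  | empty => exact ⟨OrderIso.refl ℝ, fun _ _ => rfl, by simp⟩
  | insert m0 M hm0 ih =>
    obtain ⟨ψ, h1, h2⟩ := ih (fun m hm => h m (Finset.mem_insert_of_mem hm))
      (fun m hm m' hm' => hsep m (Finset.mem_insert_of_mem hm) m' (Finset.mem_insert_of_mem hm'))
    have hz0 : ∀ z ∈ Z, SameSide z (ψ m0) (v m0) := by
      intro z hz
      rcases h m0 (Finset.mem_insert_self _ _) z hz with h | h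
      · left
        refine ⟨?_, h.2⟩
        rw [← h1 z hz]; exact ψ.strictMono h.1
      · right
        refine ⟨?_, h.2⟩
        conv_rhs => rw [← h1 z hz]
        exact ψ.strictMono h.1
    obtain ⟨χ, h3, h4⟩ := bump (Z ∪ M.image v) (ψ m0) (v m0) (by
      intro z hz
      rcases Finset.mem_union.1 hz with hz | hz
      · exact hz0 z hz
      · obtain ⟨m, hm, rfl⟩ := Finset.mem_image.1 hz
        have hne : m ≠ m0 := fun e => hm0 (e ▸ hm)
        rcases lt_or_gt_of_ne hne with hlt | hlt
        · obtain ⟨z, hz, ha, hb⟩ := hsep m (Finset.mem_insert_of_mem hm) m0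
            (Finset.mem_insert_self _ _) hlt
          have e1 := h m (Finset.mem_insert_of_mem hm) z hz
          have e2 := hz0 z hz
          have e3 := h m0 (Finset.mem_insert_self _ _) z hz
          unfold SameSide at *
          grind
        · obtain ⟨z, hz, ha, hb⟩ := hsep m0 (Finset.mem_insert_self _ _) m
            (Finset.mem_insert_of_mem hm) hlt
          have e1 := h m (Finset.mem_insert_of_mem hm) z hz
          have e2 := hz0 z hz
          have e3 := h m0 (Finset.mem_insert_self _ _) z hz
          unfold SameSide at *
          grind)
    refine ⟨ψ.trans χ, ?_, ?_⟩
    · intro z hz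
      simp only [OrderIso.trans_apply]
      rw [h1 z hz, h4 z (Finset.mem_union_left _ hz)]
    · intro m hm
      simp only [OrderIso.trans_apply]
      rcases Finset.mem_insert.1 hm with rfl | hm
      · exact h3
      · rw [h2 m hm, h4 _ (Finset.mem_union_right _ (Finset.mem_image_of_mem _ hm))]

/-! ### Transporting sign patterns of real polynomials -/

open Polynomial in
lemma sign_const_of_no_root (q : ℝ[X]) (u v : ℝ) (h : ∀ y ∈ Set.uIcc u v, q.eval y ≠ 0) :
    SignType.sign (q.eval u) = SignType.sign (q.eval v) := by
  have hu := h u Set.left_mem_uIcc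
  have hv := h v Set.right_mem_uIcc
  have hI := intermediate_value_uIcc (f := fun y => q.eval y) (a := u) (b := v)
    q.continuous.continuousOn
  have h0 : (0 : ℝ) ∉ Set.uIcc (q.eval u) (q.eval v) := by
    intro h0
    obtain ⟨y, hy, hy0⟩ := hI h0
    exact h y hy hy0
  rw [Set.mem_uIcc] at h0
  rcases lt_or_gt_of_ne hu with h1 | h1 <;> rcases lt_or_gt_of_ne hv with h2 | h2
  · simp [h1, h2]
  · exact absurd (Or.inl ⟨h1.le, h2.le⟩) h0
  · exact absurd (Or.inr ⟨h2.le, h1.le⟩) h0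
  · simp [h1, h2]

lemma pos_of_sign_eq {a b : ℝ} (h : SignType.sign a = SignType.sign b) (ha : 0 < a) : 0 < b := by
  rw [← sign_eq_one_iff, ← h, sign_eq_one_iff]; exact ha

lemma neg_of_sign_eq {a b : ℝ} (h : SignType.sign a = SignType.sign b) (ha : a < 0) : b < 0 := by
  rw [← sign_eq_neg_one_iff, ← h, sign_eq_neg_one_iff]; exact ha

lemma zero_of_sign_eq {a b : ℝ} (h : SignType.sign a = SignType.sign b) (ha : a = 0) : b = 0 := by
  rw [← sign_eq_zero_iff, ← h, sign_eq_zero_iff]; exact ha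

open Polynomial in
lemma sign_match_of_agree (q q' : ℝ[X]) (Z : Finset ℝ) (θ θ' : ℝ ≃o ℝ)
    (hroot : ∀ x, q.eval x = 0 → x ∈ Z)
    (hm : ∀ x, SignType.sign (q.eval x) = SignType.sign (q'.eval (θ x)))
    (hag : ∀ z ∈ Z, θ' z = θ z) (x : ℝ) :
    SignType.sign (q.eval x) = SignType.sign (q'.eval (θ' x)) := by
  by_cases hx : x ∈ Z
  · rw [hag x hx]; exact hm x
  rw [hm x]
  apply sign_const_of_no_root
  intro y hy hy0
  obtain ⟨w, rfl⟩ := θ.surjective y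
  have hw : w ∈ Z := hroot w (zero_of_sign_eq (hm w).symm hy0)
  have hwx : w = x := by
    rcases Set.mem_uIcc.1 hy with h | h
    · have h2 := h.2
      rw [← hag w hw] at h2
      exact le_antisymm (θ'.le_iff_le.1 h2) (θ.le_iff_le.1 h.1)
    · have h1 := h.1
      rw [← hag w hw] at h1
      exact le_antisymm (θ.le_iff_le.1 h.2) (θ'.le_iff_le.1 h1)
  exact hx (hwx ▸ hw)

open Polynomial in
lemma strictMonoOn_of_derivative_pos (p : ℝ[X]) (D : Set ℝ) (hD : Convex ℝ D)
    (h : ∀ y ∈ interior D, 0 < p.derivative.eval y) : StrictMonoOn (fun y => p.eval y) D := by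
  apply strictMonoOn_of_deriv_pos hD p.continuous.continuousOn
  intro y hy
  rw [Polynomial.deriv]
  exact h y hy

open Polynomial in
lemma left_end (p : ℝ[X]) (Z : Finset ℝ) (hZ : ∀ x, p.derivative.eval x = 0 → x ∈ Z)
    (x : ℝ) (hx : x ∉ Z) (hpos : 0 < p.derivative.eval x) :
    (∃ a ∈ Z, a < x ∧ (∀ z ∈ Z, ¬ (a < z ∧ z < x)) ∧
        StrictMonoOn (fun y => p.eval y) (Set.Icc a x)) ∨
      ((∀ z ∈ Z, x < z) ∧ StrictMonoOn (fun y => p.eval y) (Set.Iic x)) := by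
  have key : ∀ y ≤ x, (∀ z ∈ Z, ¬ (y ≤ z ∧ z < x)) → 0 < p.derivative.eval y := by
    intro y hy hz
    refine pos_of_sign_eq (sign_const_of_no_root _ x y ?_) hpos
    intro w hw hw0
    rw [Set.uIcc_of_ge hy] at hw
    have hwZ := hZ w hw0
    rcases hw.2.lt_or_eq with h | h
    · exact hz w hwZ ⟨hw.1, h⟩
    · exact hx (h ▸ hwZ)
  by_cases hne : (Z.filter (· < x)).Nonempty
  · left
    obtain ⟨a, ha, hmax⟩ := Finset.exists_max_image _ id hne
    rw [Finset.mem_filter] at ha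
    have hgap : ∀ z ∈ Z, ¬ (a < z ∧ z < x) := fun z hz h =>
      absurd (hmax z (Finset.mem_filter.2 ⟨hz, h.2⟩)) (not_le.2 h.1)
    refine ⟨a, ha.1, ha.2, hgap, ?_⟩
    apply strictMonoOn_of_derivative_pos _ _ (convex_Icc a x)
    intro y hy
    rw [interior_Icc] at hy
    exact key y hy.2.le fun z hz h => hgap z hz ⟨hy.1.trans_le h.1, h.2⟩
  · right
    have hall : ∀ z ∈ Z, x < z := by
      intro z hz
      by_contra hcon
      rcases (not_lt.1 hcon).lt_or_eq with h | h
      · exact hne ⟨z, Finset.mem_filter.2 ⟨hz, h⟩⟩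
      · exact hx (h ▸ hz)
    refine ⟨hall, ?_⟩
    apply strictMonoOn_of_derivative_pos _ _ (convex_Iic x)
    intro y hy
    rw [interior_Iic] at hy
    exact key y (le_of_lt hy) fun z hz h => absurd (hall z hz) (not_lt.2 h.2.le)

open Polynomial in
lemma exists_neg_of_strictMonoOn_Iic (p : ℝ[X]) (x : ℝ) (hd : p.derivative.eval x ≠ 0)
    (h : StrictMonoOn (fun y => p.eval y) (Set.Iic x)) : ∃ y < x, p.eval y < 0 := by
  have hdeg : 0 < p.degree := by
    by_contra hcon
    rw [Polynomial.eq_C_of_degree_le_zero (not_lt.1 hcon)] at hd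
    simp at hd
  have ht := (p.comp (-X)).abs_tendsto_atTop (by
    rw [← Polynomial.natDegree_pos_iff_degree_pos] at hdeg ⊢
    rw [Polynomial.natDegree_comp]; simpa using hdeg)
  have ht2 := (ht.eventually_gt_atTop |p.eval x|).and (Filter.eventually_gt_atTop (-x))
  obtain ⟨w, hw, hwx⟩ := ht2.exists
  simp only [eval_comp, eval_neg, eval_X] at hw
  refine ⟨-w, by linarith, ?_⟩
  have hlt : p.eval (-w) < p.eval x :=
    h (show -w ≤ x by linarith) (show x ≤ x from le_rfl) (by linarith)
  by_contra hcon
  rw [abs_of_nonneg (not_lt.1 hcon), abs_of_nonneg ((not_lt.1 hcon).trans hlt.le)] at hw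
  linarith

/-- The data: the derivative has its roots in `Z` and `θ` transports the signs of the
derivative, as well as those of the polynomial on `Z`. -/
structure Pkg (p p' : Polynomial ℝ) (Z : Finset ℝ) (θ : ℝ ≃o ℝ) : Prop where
  root : ∀ x, p.derivative.eval x = 0 → x ∈ Z
  der : ∀ x, SignType.sign (p.derivative.eval x) = SignType.sign (p'.derivative.eval (θ x))
  val : ∀ z ∈ Z, SignType.sign (p.eval z) = SignType.sign (p'.eval (θ z))

open Polynomial in
lemma Pkg.neg {p p' : ℝ[X]} {Z : Finset ℝ} {θ : ℝ ≃o ℝ} (h : Pkg p p' Z θ) :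
    Pkg (-p) (-p') Z θ where
  root x hx := h.root x (by simpa using hx)
  der x := by simp [Left.sign_neg, h.der x]
  val z hz := by simp [Left.sign_neg, h.val z hz]

/-- Conjugation of an order isomorphism by negation. -/
def mirrorIso (θ : ℝ ≃o ℝ) : ℝ ≃o ℝ :=
  StrictMono.orderIsoOfSurjective (fun x => -θ (-x))
    (fun a b hab => by simpa using hab)
    (fun y => ⟨-θ.symm (-y), by simp⟩)

lemma mirrorIso_apply (θ : ℝ ≃o ℝ) (x : ℝ) : mirrorIso θ x = -θ (-x) := rfl

open Polynomial in
/-- Conjugation of a polynomial by negation. -/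
def mirrorPoly (p : ℝ[X]) : ℝ[X] := -(p.comp (-X))

open Polynomial in
lemma mirrorPoly_eval (p : ℝ[X]) (x : ℝ) : (mirrorPoly p).eval x = - p.eval (-x) := by
  simp [mirrorPoly]

open Polynomial in
lemma mirrorPoly_derivative_eval (p : ℝ[X]) (x : ℝ) :
    (mirrorPoly p).derivative.eval x = p.derivative.eval (-x) := by
  simp [mirrorPoly, Polynomial.derivative_comp]

open Polynomial in
lemma Pkg.mirror {p p' : ℝ[X]} {Z : Finset ℝ} {θ : ℝ ≃o ℝ} (h : Pkg p p' Z θ) :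
    Pkg (mirrorPoly p) (mirrorPoly p') (Z.image (fun z => -z)) (mirrorIso θ) where
  root x hx := by
    rw [mirrorPoly_derivative_eval] at hx
    exact Finset.mem_image.2 ⟨-x, h.root _ hx, by simp⟩
  der x := by
    rw [mirrorPoly_derivative_eval, mirrorPoly_derivative_eval, mirrorIso_apply, neg_neg, h.der]
  val z hz := by
    obtain ⟨w, hw, rfl⟩ := Finset.mem_image.1 hz
    rw [mirrorPoly_eval, mirrorPoly_eval, mirrorIso_apply, neg_neg, neg_neg, Left.sign_neg,
      Left.sign_neg, h.val w hw]

open Polynomial in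
lemma Pkg.symm {p p' : ℝ[X]} {Z : Finset ℝ} {θ : ℝ ≃o ℝ} (h : Pkg p p' Z θ) :
    Pkg p' p (Z.image θ) θ.symm where
  root x hx := by
    refine Finset.mem_image.2 ⟨θ.symm x, h.root _ ?_, by simp⟩
    have := h.der (θ.symm x)
    rw [OrderIso.apply_symm_apply] at this
    exact zero_of_sign_eq this.symm hx
  der x := by
    have := h.der (θ.symm x)
    rw [OrderIso.apply_symm_apply] at this
    exact this.symm
  val z hz := by
    obtain ⟨w, hw, rfl⟩ := Finset.mem_image.1 hz
    rw [OrderIso.symm_apply_apply]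
    exact (h.val w hw).symm

open Polynomial in
lemma Pkg.left {p p' : ℝ[X]} {Z : Finset ℝ} {θ : ℝ ≃o ℝ} (h : Pkg p p' Z θ)
    (x : ℝ) (hx : x ∉ Z) (hpos : 0 < p.derivative.eval x) (h0 : p.eval x = 0) :
    ∃ y < θ x, p'.eval y < 0 ∧ ∀ z ∈ Z, ¬ (y < θ z ∧ θ z < θ x) := by
  rcases left_end p Z h.root x hx hpos with ⟨a, ha, hax, hgap, hmono⟩ | ⟨hall, -⟩
  · refine ⟨θ a, θ.strictMono hax, ?_, ?_⟩
    · have : p.eval a < p.eval x := hmono ⟨le_rfl, hax.le⟩ ⟨hax.le, le_rfl⟩ hax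
      exact neg_of_sign_eq (h.val a ha) (by linarith)
    · intro z hz
      rw [θ.lt_iff_lt, θ.lt_iff_lt]
      exact hgap z hz
  · have hpos' := pos_of_sign_eq (h.der x) hpos
    have hx' : θ x ∉ Z.image θ := by
      intro hc
      obtain ⟨w, hw, e⟩ := Finset.mem_image.1 hc
      exact hx (θ.injective e ▸ hw)
    rcases left_end p' (Z.image θ) h.symm.root (θ x) hx' hpos' with
      ⟨a, ha, hax, -, -⟩ | ⟨-, hmono⟩
    · obtain ⟨w, hw, rfl⟩ := Finset.mem_image.1 ha
      exact absurd (hall w hw) (not_lt.2 (θ.lt_iff_lt.1 hax).le)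
    · obtain ⟨y, hy, hy0⟩ := exists_neg_of_strictMonoOn_Iic p' (θ x) hpos'.ne' hmono
      refine ⟨y, hy, hy0, fun z hz hc => ?_⟩
      exact absurd (hall z hz) (not_lt.2 (θ.lt_iff_lt.1 hc.2).le)

open Polynomial in
lemma Pkg.exists_root_pos {p p' : ℝ[X]} {Z : Finset ℝ} {θ : ℝ ≃o ℝ} (h : Pkg p p' Z θ)
    (x : ℝ) (hx : x ∉ Z) (hpos : 0 < p.derivative.eval x) (h0 : p.eval x = 0) :
    ∃ v, p'.eval v = 0 ∧ ∀ z ∈ Z, SameSide (θ z) (θ x) v := by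
  obtain ⟨y1, hy1, hy1n, hg1⟩ := h.left x hx hpos h0
  obtain ⟨y2, hy2, hy2n, hg2⟩ := h.mirror.left (-x)
    (by
      intro hc
      obtain ⟨w, hw, e⟩ := Finset.mem_image.1 hc
      exact hx (neg_injective e ▸ hw))
    (by rw [mirrorPoly_derivative_eval, neg_neg]; exact hpos)
    (by rw [mirrorPoly_eval, neg_neg, h0, neg_zero])
  rw [mirrorIso_apply, neg_neg] at hy2
  rw [mirrorPoly_eval] at hy2n
  have hg2' : ∀ z ∈ Z, ¬ (θ x < θ z ∧ θ z < -y2) := by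
    intro z hz hc
    refine hg2 (-z) (Finset.mem_image_of_mem _ hz) ?_
    rw [mirrorIso_apply, mirrorIso_apply, neg_neg, neg_neg]
    exact ⟨by linarith [hc.2], by linarith [hc.1]⟩
  have hI := intermediate_value_Ioo (f := fun y => p'.eval y) (show y1 ≤ -y2 by linarith)
    p'.continuous.continuousOn
  obtain ⟨v, hv, hv0⟩ := hI (show (0 : ℝ) ∈ _ from ⟨hy1n, by linarith⟩)
  refine ⟨v, hv0, fun z hz => ?_⟩
  have e1 := hg1 z hz
  have e2 := hg2' z hz
  have e3 : θ z ≠ θ x := fun e => hx (θ.injective e ▸ hz)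
  rcases lt_or_gt_of_ne e3 with h' | h'
  · left
    refine ⟨h', ?_⟩
    have : θ z ≤ y1 := by
      by_contra hc
      exact e1 ⟨not_le.1 hc, h'⟩
    exact this.trans_lt hv.1
  · right
    refine ⟨h', ?_⟩
    have : -y2 ≤ θ z := by
      by_contra hc
      exact e2 ⟨h', not_le.1 hc⟩
    exact hv.2.trans_le this

open Polynomial in
lemma Pkg.exists_root {p p' : ℝ[X]} {Z : Finset ℝ} {θ : ℝ ≃o ℝ} (h : Pkg p p' Z θ)
    (x : ℝ) (hx : x ∉ Z) (h0 : p.eval x = 0) :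
    ∃ v, p'.eval v = 0 ∧ ∀ z ∈ Z, SameSide (θ z) (θ x) v := by
  have hne : p.derivative.eval x ≠ 0 := fun e => hx (h.root x e)
  rcases lt_or_gt_of_ne hne with hlt | hgt
  · obtain ⟨v, hv, hv2⟩ := h.neg.exists_root_pos x hx (by simpa using hlt) (by simpa using h0)
    exact ⟨v, by simpa using hv, hv2⟩
  · exact h.exists_root_pos x hx hgt h0

open Polynomial in
lemma Pkg.pos_pos {p p' : ℝ[X]} {Z : Finset ℝ} {θ : ℝ ≃o ℝ} (h : Pkg p p' Z θ)
    (hr : ∀ x, p.eval x = 0 → p'.eval (θ x) = 0)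
    (x : ℝ) (hx : x ∉ Z) (hpos : 0 < p.derivative.eval x) (h0 : 0 < p.eval x) :
    0 < p'.eval (θ x) := by
  have key : ∃ a < x, 0 ≤ p'.eval (θ a) ∧ ∀ z ∈ Z, ¬ (a < z ∧ z < x) := by
    have ivt : ∀ y < x, p.eval y < 0 → ∃ a, y < a ∧ a < x ∧ p.eval a = 0 := by
      intro y hy hy0
      have hI := intermediate_value_Ioo (f := fun y => p.eval y) hy.le p.continuous.continuousOn
      obtain ⟨v, hv, hv0⟩ := hI (show (0 : ℝ) ∈ _ from ⟨hy0, h0⟩)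
      exact ⟨v, hv.1, hv.2, hv0⟩
    rcases left_end p Z h.root x hx hpos with ⟨a, ha, hax, hgap, hmono⟩ | ⟨hall, hmono⟩
    · rcases lt_or_ge (p.eval a) 0 with hn | hn
      · obtain ⟨v, h1, h2, h3⟩ := ivt a hax hn
        exact ⟨v, h2, (hr v h3).ge, fun z hz hc => hgap z hz ⟨h1.trans hc.1, hc.2⟩⟩
      · refine ⟨a, hax, ?_, hgap⟩
        rcases hn.lt_or_eq with h' | h'
        · exact (pos_of_sign_eq (h.val a ha) h').le
        · exact (hr a h'.symm).ge
    · obtain ⟨y, hy, hy0⟩ := exists_neg_of_strictMonoOn_Iic p x hpos.ne' hmono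
      obtain ⟨v, h1, h2, h3⟩ := ivt y hy hy0
      exact ⟨v, h2, (hr v h3).ge, fun z hz hc => absurd (hall z hz) (not_lt.2 hc.2.le)⟩
  obtain ⟨a, hax, ha0, hgap⟩ := key
  have hmono : StrictMonoOn (fun y => p'.eval y) (Set.Icc (θ a) (θ x)) := by
    apply strictMonoOn_of_derivative_pos _ _ (convex_Icc _ _)
    intro y hy
    rw [interior_Icc] at hy
    obtain ⟨w, rfl⟩ := θ.surjective y
    have h1 := θ.lt_iff_lt.1 hy.1
    have h2 := θ.lt_iff_lt.1 hy.2
    refine pos_of_sign_eq (h.der w) ?_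
    refine pos_of_sign_eq (sign_const_of_no_root _ x w ?_) hpos
    intro u hu hu0
    rw [Set.uIcc_of_ge h2.le] at hu
    have huZ := h.root u hu0
    rcases hu.2.lt_or_eq with h' | h'
    · exact hgap u huZ ⟨h1.trans_le hu.1, h'⟩
    · exact hx (h' ▸ huZ)
  have := hmono ⟨le_rfl, (θ.strictMono hax).le⟩ ⟨(θ.strictMono hax).le, le_rfl⟩
    (θ.strictMono hax)
  exact ha0.trans_lt this

open Polynomial in
lemma Pkg.pos {p p' : ℝ[X]} {Z : Finset ℝ} {θ : ℝ ≃o ℝ} (h : Pkg p p' Z θ)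
    (hr : ∀ x, p.eval x = 0 → p'.eval (θ x) = 0)
    (x : ℝ) (hx : x ∉ Z) (h0 : 0 < p.eval x) :
    0 < p'.eval (θ x) := by
  have hne : p.derivative.eval x ≠ 0 := fun e => hx (h.root x e)
  rcases lt_or_gt_of_ne hne with hlt | hgt
  · have := h.neg.mirror.pos_pos (fun y hy => by
      simp only [mirrorPoly_eval, mirrorIso_apply, neg_neg, eval_neg] at hy ⊢
      exact hr _ hy) (-x) (by
        intro hc
        obtain ⟨w, hw, e⟩ := Finset.mem_image.1 hc
        exact hx (neg_injective e ▸ hw)) (by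
          rw [mirrorPoly_derivative_eval]; simpa using hlt) (by
          rw [mirrorPoly_eval]; simpa using h0)
    simpa [mirrorPoly_eval, mirrorIso_apply] using this
  · exact h.pos_pos hr x hx hgt h0

open Polynomial in
lemma Pkg.sign_eq {p p' : ℝ[X]} {Z : Finset ℝ} {θ : ℝ ≃o ℝ} (h : Pkg p p' Z θ)
    (hr : ∀ x, p.eval x = 0 → p'.eval (θ x) = 0) (x : ℝ) :
    SignType.sign (p.eval x) = SignType.sign (p'.eval (θ x)) := by
  by_cases hx : x ∈ Z
  · exact h.val x hx
  rcases lt_trichotomy (p.eval x) 0 with h0 | h0 | h0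
  · have := h.neg.pos (fun y hy => by simpa using hr y (by simpa using hy)) x hx
      (by simpa using h0)
    rw [eval_neg, neg_pos] at this
    simp [h0, this]
  · simp [h0, hr x h0]
  · simp [h0, h.pos hr x hx h0]

open Polynomial in
lemma Pkg.fix {p p' : ℝ[X]} {Z : Finset ℝ} {θ : ℝ ≃o ℝ} (h : Pkg p p' Z θ) :
    ∃ θ' : ℝ ≃o ℝ, (∀ z ∈ Z, θ' z = θ z) ∧
      ∀ x, SignType.sign (p.eval x) = SignType.sign (p'.eval (θ' x)) := by
  have hp0 : p ≠ 0 := by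
    rintro rfl
    exact Infinite.exists_notMem_finset Z |>.elim fun x hx => hx (h.root x (by simp))
  let N : Finset ℝ := p.roots.toFinset.filter (fun x => x ∉ Z)
  have hN : ∀ x, x ∈ N ↔ p.eval x = 0 ∧ x ∉ Z := by
    intro x
    simp [N, hp0]
  have hex : ∀ x : ℝ, ∃ v, x ∈ N → p'.eval v = 0 ∧ ∀ z ∈ Z, SameSide (θ z) (θ x) v := by
    intro x
    by_cases hx : x ∈ N
    · obtain ⟨v, hv⟩ := h.exists_root x ((hN x).1 hx).2 ((hN x).1 hx).1
      exact ⟨v, fun _ => hv⟩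
    · exact ⟨0, fun h => absurd h hx⟩
  choose v hv using hex
  obtain ⟨ψ, hψ1, hψ2⟩ := multi_bump (Z.image θ) (fun y => v (θ.symm y)) (N.image θ)
    (by
      intro m hm z hz
      obtain ⟨x, hx, rfl⟩ := Finset.mem_image.1 hm
      obtain ⟨w, hw, rfl⟩ := Finset.mem_image.1 hz
      rw [OrderIso.symm_apply_apply]
      exact (hv x hx).2 w hw)
    (by
      intro m hm m' hm' hlt
      obtain ⟨x, hx, rfl⟩ := Finset.mem_image.1 hm
      obtain ⟨x', hx', rfl⟩ := Finset.mem_image.1 hm'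
      have hlt' := θ.lt_iff_lt.1 hlt
      obtain ⟨c, hc, hc0⟩ := exists_deriv_eq_zero (f := fun y => p.eval y) hlt'
        p.continuous.continuousOn (((hN x).1 hx).1.trans ((hN x').1 hx').1.symm)
      rw [Polynomial.deriv] at hc0
      exact ⟨θ c, Finset.mem_image_of_mem _ (h.root c hc0), θ.strictMono hc.1,
        θ.strictMono hc.2⟩)
  have hag : ∀ z ∈ Z, (θ.trans ψ) z = θ z := fun z hz =>
    hψ1 _ (Finset.mem_image_of_mem _ hz)
  refine ⟨θ.trans ψ, hag, ?_⟩
  have hP : Pkg p p' Z (θ.trans ψ) :=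
    { root := h.root
      der := sign_match_of_agree _ _ Z θ _ h.root h.der hag
      val := fun z hz => by rw [hag z hz]; exact h.val z hz }
  apply hP.sign_eq
  intro x hx
  by_cases hxZ : x ∈ Z
  · exact zero_of_sign_eq (hP.val x hxZ) hx
  · have hxN : x ∈ N := (hN x).2 ⟨hx, hxZ⟩
    have := hψ2 (θ x) (Finset.mem_image_of_mem _ hxN)
    rw [OrderIso.symm_apply_apply] at this
    rw [OrderIso.trans_apply, this]
    exact (hv x hxN).1

/-! ### Quantifier elimination in sign-invariance form -/

open Polynomial in
lemma pseudo_div {R : Type*} [CommRing R] [IsDomain R] (q : R[X]) (hq : q ≠ 0) :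
    ∀ (N : ℕ) (p : R[X]), p.natDegree < N → ∃ (e : ℕ) (u r : R[X]),
      C (q.leadingCoeff ^ (2 * e)) * p = q * u + r ∧ r.degree < q.degree := by
  intro N
  induction N with
  | zero => intro p hp; omega
  | succ N ih =>
    intro p hp
    by_cases hlt : p.degree < q.degree
    · exact ⟨0, 0, p, by simp, hlt⟩
    have hle : q.degree ≤ p.degree := not_lt.1 hlt
    by_cases hp0 : p = 0
    · exact ⟨0, 0, 0, by simp [hp0], by simpa [bot_lt_iff_ne_bot] using hq⟩
    have hnle : q.natDegree ≤ p.natDegree := Polynomial.natDegree_le_natDegree hle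
    by_cases hpd : p.natDegree = 0
    · -- both constants
      have hqd : q.natDegree = 0 := by omega
      refine ⟨1, C (q.leadingCoeff) * p, 0, ?_, by simpa [bot_lt_iff_ne_bot] using hq⟩
      have : q = C q.leadingCoeff := by
        rw [Polynomial.leadingCoeff, hqd]; exact Polynomial.eq_C_of_natDegree_eq_zero hqd
      conv_rhs => rw [this]
      simp [pow_two, mul_assoc]
    set p1 := C q.leadingCoeff * p - C p.leadingCoeff * X ^ (p.natDegree - q.natDegree) * q
      with hp1
    have hlc : q.leadingCoeff ≠ 0 := by simpa using hq
    have hlcp : p.leadingCoeff ≠ 0 := by simpa using hp0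
    have hdeg : p1.degree < p.degree := by
      have e1 : (C q.leadingCoeff * p).degree = p.degree := Polynomial.degree_C_mul hlc
      have hnd : (C q.leadingCoeff * p).degree =
          (C p.leadingCoeff * X ^ (p.natDegree - q.natDegree) * q).degree := by
        rw [e1, Polynomial.degree_mul, Polynomial.degree_C_mul_X_pow _ hlcp,
          Polynomial.degree_eq_natDegree hp0, Polynomial.degree_eq_natDegree hq]
        norm_cast
        omega
      rw [← e1]
      apply Polynomial.degree_sub_lt hnd
      · exact mul_ne_zero (by simpa using hlc) hp0
      · rw [Polynomial.leadingCoeff_mul, Polynomial.leadingCoeff_mul,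
          Polynomial.leadingCoeff_C_mul_X_pow, Polynomial.leadingCoeff_C, mul_comm]
    obtain ⟨e, u, r, he, hr⟩ := ih p1 (by
      by_cases h0 : p1 = 0
      · rw [h0]; simp; omega
      have := Polynomial.natDegree_lt_natDegree h0 hdeg
      omega)
    refine ⟨e + 1, C q.leadingCoeff * (u + C (q.leadingCoeff ^ (2 * e)) *
      (C p.leadingCoeff * X ^ (p.natDegree - q.natDegree))), C q.leadingCoeff * r, ?_, ?_⟩
    · have : C (q.leadingCoeff ^ (2 * (e + 1))) * p =
          C q.leadingCoeff * (C (q.leadingCoeff ^ (2 * e)) * (C q.leadingCoeff * p)) := by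
        rw [show 2 * (e + 1) = 2 * e + 1 + 1 by ring, pow_succ, pow_succ]
        simp only [map_mul]; ring
      rw [this, show C q.leadingCoeff * p = p1 +
        C p.leadingCoeff * X ^ (p.natDegree - q.natDegree) * q by rw [hp1]; ring, mul_add, he]
      ring
    · rw [Polynomial.degree_C_mul hlc]; exact hr

open Polynomial in
theorem sign_qe {R : Type*} [CommRing R] [IsDomain R] [CharZero R] (D : Multiset (WithBot ℕ)) :
    ∀ P : Multiset R[X], P.map degree = D → ∃ A : Set R, A.Finite ∧
      ∀ φ φ' : R →+* ℝ, (∀ a ∈ A, SignType.sign (φ a) = SignType.sign (φ' a)) →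
        ∃ θ : ℝ ≃o ℝ, ∀ p ∈ P, ∀ x,
          SignType.sign ((p.map φ).eval x) = SignType.sign ((p.map φ').eval (θ x)) := by
  induction D using (Multiset.wellFounded_isDershowitzMannaLT (α := WithBot ℕ)).induction with
  | _ D ih =>
  intro P hPD
  by_cases hconst : ∀ p ∈ P, p.degree ≤ 0
  · refine ⟨(fun p : R[X] => p.coeff 0) '' {p | p ∈ P},
      Set.Finite.image _ (by simpa using P.toFinset.finite_toSet), ?_⟩
    intro φ φ' h
    refine ⟨OrderIso.refl ℝ, fun p hp x => ?_⟩
    have := Polynomial.eq_C_of_degree_le_zero (hconst p hp)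
    rw [this]
    simpa using h _ ⟨p, hp, rfl⟩
  push Not at hconst
  obtain ⟨p0, hp0, hp0d⟩ := hconst
  obtain ⟨p, hpP, hmax⟩ := Finset.exists_max_image P.toFinset degree ⟨p0, by simpa using hp0⟩
  rw [Multiset.mem_toFinset] at hpP
  have hpd : 0 < p.degree := hp0d.trans_le (hmax p0 (by simpa using hp0))
  have hpne : p ≠ 0 := by rintro rfl; simp at hpd
  have hmax' : ∀ q ∈ P, q.degree ≤ p.degree := fun q hq => hmax q (by simpa using hq)
  obtain ⟨P0, rfl⟩ := Multiset.exists_cons_of_mem hpP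
  -- the families where a leading coefficient is erased
  have hA : ∀ q : R[X], ∃ A : Set R, A.Finite ∧ (q ∈ p ::ₘ P0 → q ≠ 0 →
      ∀ φ φ' : R →+* ℝ, (∀ a ∈ A, SignType.sign (φ a) = SignType.sign (φ' a)) →
        φ q.leadingCoeff = 0 → φ' q.leadingCoeff = 0 →
        ∃ θ : ℝ ≃o ℝ, ∀ p' ∈ p ::ₘ P0, ∀ x,
          SignType.sign ((p'.map φ).eval x) = SignType.sign ((p'.map φ').eval (θ x))) := by
    intro q
    by_cases hq : q ∈ p ::ₘ P0 ∧ q ≠ 0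
    · obtain ⟨Q, hQ⟩ := Multiset.exists_cons_of_mem hq.1
      obtain ⟨A, hA, hA2⟩ := ih ((q.eraseLead ::ₘ Q).map degree) (by
        rw [← hPD, hQ]
        refine ⟨Q.map degree, {q.eraseLead.degree}, {q.degree}, by simp, ?_, ?_, ?_⟩
        · rw [Multiset.map_cons, add_comm, Multiset.singleton_add]
        · rw [Multiset.map_cons, add_comm, Multiset.singleton_add]
        · simpa using Polynomial.degree_eraseLead_lt hq.2) _ rfl
      refine ⟨A, hA, fun _ _ φ φ' h h0 h0' => ?_⟩
      obtain ⟨θ, hθ⟩ := hA2 φ φ' h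
      refine ⟨θ, fun p' hp' x => ?_⟩
      rw [hQ, Multiset.mem_cons] at hp'
      rcases hp' with rfl | hp'
      · have e : ∀ χ : R →+* ℝ, χ p'.leadingCoeff = 0 → p'.map χ = p'.eraseLead.map χ := by
          intro χ hχ
          have h3 := congrArg (Polynomial.map χ) p'.eraseLead_add_C_mul_X_pow
          simp only [Polynomial.map_add, Polynomial.map_mul, Polynomial.map_C, hχ, map_zero,
            zero_mul, add_zero] at h3
          exact h3.symm
        rw [e φ h0, e φ' h0']
        exact hθ _ (Multiset.mem_cons_self _ _) x
      · exact hθ _ (Multiset.mem_cons_of_mem hp') x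
    · exact ⟨∅, Set.finite_empty, fun h1 h2 => absurd ⟨h1, h2⟩ hq⟩
  choose A hAfin hA using hA
  -- remainders
  have hr : ∀ q : R[X], ∃ r : R[X], (q.degree ≤ p.degree → r.degree < p.degree) ∧
      (q ≠ 0 → ∃ (e : ℕ) (u : R[X]), C (q.leadingCoeff ^ (2 * e)) * p = q * u + r) := by
    intro q
    by_cases hq : q = 0
    · exact ⟨0, fun _ => by rw [degree_zero]; exact bot_lt_iff_ne_bot.2 (by simpa using hpne),
        fun h => absurd hq h⟩
    · obtain ⟨e, u, r, h1, h2⟩ := pseudo_div q hq (p.natDegree + 1) p (by omega)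
      exact ⟨r, fun h => h2.trans_le h, fun _ => ⟨e, u, h1⟩⟩
  choose r hrd hr using hr
  have hder : p.derivative.degree < p.degree := Polynomial.degree_derivative_lt hpne
  have hder0 : p.derivative ≠ 0 := by
    intro h0
    have := Polynomial.natDegree_eq_zero_of_derivative_eq_zero h0
    rw [← Polynomial.natDegree_pos_iff_degree_pos] at hpd
    omega
  obtain ⟨B, hBfin, hB⟩ := ih
    ((P0 + (p.derivative ::ₘ r p.derivative ::ₘ P0.map r)).map degree) (by
      rw [← hPD]
      refine ⟨P0.map degree, (p.derivative ::ₘ r p.derivative ::ₘ P0.map r).map degree,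
        {p.degree}, by simp, by rw [Multiset.map_add],
        by rw [Multiset.map_cons, add_comm, Multiset.singleton_add], ?_⟩
      intro y hy
      refine ⟨p.degree, by simp, ?_⟩
      simp only [Multiset.map_cons, Multiset.mem_cons, Multiset.map_map, Multiset.mem_map] at hy
      rcases hy with rfl | rfl | ⟨q, hq, rfl⟩
      · exact hder
      · exact hrd _ hder.le
      · exact hrd _ (hmax' q (Multiset.mem_cons_of_mem hq))) _ rfl
  refine ⟨(⋃ q ∈ {q | q ∈ p ::ₘ P0}, A q) ∪ B ∪
    leadingCoeff '' {q | q ∈ p ::ₘ P0}, ?_, ?_⟩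
  · have hfin : {q | q ∈ p ::ₘ P0}.Finite := 
      ((p ::ₘ P0).toFinset.finite_toSet).subset (fun q hq => by
        simpa only [Finset.mem_coe, Multiset.mem_toFinset, Set.mem_setOf_eq] using hq)
    exact ((hfin.biUnion fun q _ => hAfin q).union hBfin).union (hfin.image _)
  intro φ φ' h
  have hlc : ∀ q ∈ p ::ₘ P0, SignType.sign (φ q.leadingCoeff) =
      SignType.sign (φ' q.leadingCoeff) := fun q hq => h _ (Or.inr ⟨q, hq, rfl⟩)
  by_cases hz : ∃ q ∈ p ::ₘ P0, q ≠ 0 ∧ φ q.leadingCoeff = 0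
  · obtain ⟨q, hq, hq0, hqz⟩ := hz
    refine hA q hq hq0 φ φ' (fun a ha => h a (Or.inl (Or.inl ?_))) hqz
      (zero_of_sign_eq (hlc q hq) hqz)
    exact Set.mem_biUnion (show q ∈ {q | q ∈ p ::ₘ P0} from hq) ha
  push Not at hz
  obtain ⟨θ, hθ⟩ := hB φ φ' (fun a ha => h a (Or.inl (Or.inr ha)))
  have hz' : ∀ q ∈ p ::ₘ P0, q ≠ 0 → φ' q.leadingCoeff ≠ 0 := fun q hq hq0 h0 =>
    hz q hq hq0 (zero_of_sign_eq (hlc q hq).symm h0)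
  have hlcder : p.derivative.leadingCoeff = p.leadingCoeff * p.natDegree := by
    rw [← Polynomial.natDegree_pos_iff_degree_pos] at hpd
    rw [Polynomial.leadingCoeff, Polynomial.natDegree_derivative, Polynomial.coeff_derivative,
      Polynomial.leadingCoeff]
    rw [show p.natDegree - 1 + 1 = p.natDegree by omega]
    congr 1
    exact_mod_cast (show p.natDegree - 1 + 1 = p.natDegree by omega)
  have hlcder0 : ∀ χ : R →+* ℝ, χ p.leadingCoeff ≠ 0 → χ p.derivative.leadingCoeff ≠ 0 := by
    intro χ hχ
    rw [hlcder, map_mul, map_natCast]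
    refine mul_ne_zero hχ ?_
    rw [← Polynomial.natDegree_pos_iff_degree_pos] at hpd
    exact_mod_cast hpd.ne'
  -- signs of `p` at roots
  have hroot : ∀ q : R[X], q ≠ 0 → ∀ χ : R →+* ℝ, χ q.leadingCoeff ≠ 0 → ∀ x,
      (q.map χ).eval x = 0 →
      SignType.sign ((p.map χ).eval x) = SignType.sign (((r q).map χ).eval x) := by
    intro q hq χ hχ x hx
    obtain ⟨e, u, hu⟩ := hr q hq
    have h1 := congrArg (fun s : R[X] => (s.map χ).eval x) hu
    simp only [Polynomial.map_mul, Polynomial.map_add, Polynomial.eval_mul, Polynomial.eval_add,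
      hx, zero_mul, zero_add, Polynomial.map_C, Polynomial.eval_C] at h1
    have h2 : 0 < χ (q.leadingCoeff ^ (2 * e)) := by
      rw [map_pow, pow_mul]
      exact pow_pos (by positivity) e
    rw [← h1, sign_mul, sign_pos h2, one_mul]
  let Q : Multiset R[X] := p.derivative ::ₘ P0.filter (· ≠ 0)
  have hQ : ∀ q ∈ Q, q ≠ 0 ∧ φ q.leadingCoeff ≠ 0 ∧ φ' q.leadingCoeff ≠ 0 ∧
      (∀ x, SignType.sign ((q.map φ).eval x) = SignType.sign ((q.map φ').eval (θ x))) ∧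
      (∀ x, SignType.sign (((r q).map φ).eval x) = SignType.sign (((r q).map φ').eval (θ x))) := by
    intro q hq
    rcases Multiset.mem_cons.1 hq with rfl | hq
    · exact ⟨hder0, hlcder0 φ (hz p (Multiset.mem_cons_self _ _) hpne),
        hlcder0 φ' (hz' p (Multiset.mem_cons_self _ _) hpne),
        hθ _ (by simp), hθ _ (by simp)⟩
    · rw [Multiset.mem_filter] at hq
      refine ⟨hq.2, hz q (Multiset.mem_cons_of_mem hq.1) hq.2,
        hz' q (Multiset.mem_cons_of_mem hq.1) hq.2, hθ _ (by simp [hq.1]), hθ _ ?_⟩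
      simp only [Multiset.mem_add, Multiset.mem_cons, Multiset.mem_map]
      exact Or.inr (Or.inr (Or.inr ⟨q, hq.1, rfl⟩))
  let Z : Finset ℝ := Q.toFinset.biUnion fun q => (q.map φ).roots.toFinset
  have hZ : ∀ x, x ∈ Z ↔ ∃ q ∈ Q, (q.map φ).eval x = 0 := by
    intro x
    simp only [Z, Finset.mem_biUnion, Multiset.mem_toFinset]
    constructor
    · rintro ⟨q, hq, hx⟩
      exact ⟨q, hq, (Polynomial.mem_roots'.1 hx).2⟩
    · rintro ⟨q, hq, hx⟩
      refine ⟨q, hq, Polynomial.mem_roots'.2 ⟨?_, hx⟩⟩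
      intro h0
      have := congrArg (fun s => s.coeff q.natDegree) h0
      simp only [Polynomial.coeff_map, Polynomial.coeff_zero] at this
      exact (hQ q hq).2.1 this
  have hpkg : Pkg (p.map φ) (p.map φ') Z θ :=
    { root := fun x hx => by
        rw [Polynomial.derivative_map] at hx
        exact (hZ x).2 ⟨_, Multiset.mem_cons_self _ _, hx⟩
      der := fun x => by
        rw [Polynomial.derivative_map, Polynomial.derivative_map]
        exact (hQ _ (Multiset.mem_cons_self _ _)).2.2.2.1 x
      val := fun z hz => by
        obtain ⟨q, hq, hqz⟩ := (hZ z).1 hz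
        obtain ⟨h1, h2, h3, h4, h5⟩ := hQ q hq
        rw [hroot q h1 φ h2 z hqz, hroot q h1 φ' h3 (θ z) (zero_of_sign_eq (h4 z) hqz)]
        exact h5 z }
  obtain ⟨θ', hag, hp'⟩ := hpkg.fix
  refine ⟨θ', fun q hq x => ?_⟩
  rcases Multiset.mem_cons.1 hq with rfl | hq
  · exact hp' x
  · by_cases hq0 : q = 0
    · simp [hq0]
    have hqQ : q ∈ Q := Multiset.mem_cons_of_mem (Multiset.mem_filter.2 ⟨hq, hq0⟩)
    exact sign_match_of_agree _ _ Z θ θ' (fun y hy => (hZ y).2 ⟨q, hqQ, hy⟩)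
      (hQ q hqQ).2.2.2.1 hag x

/-! ### Semialgebraic predicates -/

/-- A predicate on `ℝ^ι` is semialgebraic if its truth value only depends on the signs of finitely
many polynomials. -/
def SA {ι : Type*} (P : (ι → ℝ) → Prop) : Prop :=
  ∃ A : Set (MvPolynomial ι ℝ), A.Finite ∧ ∀ t t' : ι → ℝ,
    (∀ a ∈ A, SignType.sign (MvPolynomial.eval t a) = SignType.sign (MvPolynomial.eval t' a)) →
      (P t → P t')

lemma SA.not {ι : Type*} {P : (ι → ℝ) → Prop} (h : SA P) : SA (fun v => ¬ P v) := by
  obtain ⟨A, hA, h⟩ := h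
  exact ⟨A, hA, fun t t' hs hp hp' => hp (h t' t (fun a ha => (hs a ha).symm) hp')⟩

lemma SA.and {ι : Type*} {P Q : (ι → ℝ) → Prop} (h : SA P) (h' : SA Q) :
    SA (fun v => P v ∧ Q v) := by
  obtain ⟨A, hA, h⟩ := h
  obtain ⟨B, hB, h'⟩ := h'
  exact ⟨A ∪ B, hA.union hB, fun t t' hs hp =>
    ⟨h t t' (fun a ha => hs a (Or.inl ha)) hp.1, h' t t' (fun a ha => hs a (Or.inr ha)) hp.2⟩⟩

lemma SA.congr {ι : Type*} {P Q : (ι → ℝ) → Prop} (h : SA P) (h' : ∀ v, P v ↔ Q v) : SA Q := by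
  have : P = Q := funext fun v => propext (h' v)
  exact this ▸ h

lemma SA.or {ι : Type*} {P Q : (ι → ℝ) → Prop} (h : SA P) (h' : SA Q) :
    SA (fun v => P v ∨ Q v) :=
  (h.not.and h'.not).not.congr fun v => by tauto

lemma SA.imp {ι : Type*} {P Q : (ι → ℝ) → Prop} (h : SA P) (h' : SA Q) :
    SA (fun v => P v → Q v) :=
  (h.and h'.not).not.congr fun v => by tauto

lemma SA.const {ι : Type*} (p : Prop) : SA (fun _ : ι → ℝ => p) :=
  ⟨∅, Set.finite_empty, fun _ _ _ h => h⟩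

lemma SA.all_fin {ι κ : Type*} [Finite κ] {P : κ → (ι → ℝ) → Prop} (h : ∀ k, SA (P k)) :
    SA (fun v => ∀ k, P k v) := by
  choose A hA h using h
  refine ⟨⋃ k, A k, Set.finite_iUnion hA, fun t t' hs hp k => ?_⟩
  exact h k t t' (fun a ha => hs a (Set.mem_iUnion.2 ⟨k, ha⟩)) (hp k)

lemma SA.reindex {ι κ : Type*} {P : (ι → ℝ) → Prop} (h : SA P) (f : ι → κ) :
    SA (fun v : κ → ℝ => P (fun i => v (f i))) := by
  obtain ⟨A, hA, h⟩ := h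
  refine ⟨MvPolynomial.rename f '' A, hA.image _, fun t t' hs hp => ?_⟩
  refine h _ _ (fun a ha => ?_) hp
  have := hs _ ⟨a, ha, rfl⟩
  rw [MvPolynomial.eval_rename, MvPolynomial.eval_rename] at this
  exact this

lemma SA.ex {ι : Type*} {P : (ι → ℝ) → ℝ → Prop}
    (h : SA (fun w : Option ι → ℝ => P (fun i => w (some i)) (w none))) :
    SA (fun v => ∃ x, P v x) := by
  obtain ⟨A, hA, h⟩ := h
  obtain ⟨B, hB, hB2⟩ := sign_qe _ (hA.toFinset.val.map (MvPolynomial.optionEquivLeft ℝ ι)) rfl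
  refine ⟨B, hB, fun t t' hs ⟨x, hx⟩ => ?_⟩
  obtain ⟨θ, hθ⟩ := hB2 (MvPolynomial.eval t) (MvPolynomial.eval t') hs
  refine ⟨θ x, ?_⟩
  refine h (fun o => o.elim x t) (fun o => o.elim (θ x) t') (fun a ha => ?_) hx
  rw [MvPolynomial.optionEquivLeft_elim_eval, MvPolynomial.optionEquivLeft_elim_eval]
  exact hθ _ (Multiset.mem_map_of_mem _ (by simpa using ha)) x

lemma SA.all {ι : Type*} {P : (ι → ℝ) → ℝ → Prop}
    (h : SA (fun w : Option ι → ℝ => P (fun i => w (some i)) (w none))) :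
    SA (fun v => ∀ x, P v x) :=
  (SA.ex (P := fun v x => ¬ P v x) h.not).not.congr fun v => by push Not; rfl

/-- Quantification over a finite family of extra variables. -/
lemma SA.ex_fin {ι : Type*} : ∀ (n : ℕ) {P : (ι → ℝ) → (Fin n → ℝ) → Prop},
    SA (fun w : ι ⊕ Fin n → ℝ => P (fun i => w (Sum.inl i)) (fun i => w (Sum.inr i))) →
    SA (fun v => ∃ x, P v x) := by
  intro n
  induction n with
  | zero =>
    intro P h
    obtain ⟨A, hA, h⟩ := h
    refine ⟨MvPolynomial.rename (Sum.elim id Fin.elim0) '' A, hA.image _, fun t t' hs hp => ?_⟩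
    obtain ⟨x, hx⟩ := hp
    refine ⟨x, ?_⟩
    refine h (Sum.elim t x) (Sum.elim t' x) (fun a ha => ?_) hx
    have := hs _ ⟨a, ha, rfl⟩
    rw [MvPolynomial.eval_rename, MvPolynomial.eval_rename] at this
    have e : ∀ s : ι → ℝ, s ∘ Sum.elim id Fin.elim0 = Sum.elim s x := by
      intro s; funext i; rcases i with i | i
      · rfl
      · exact i.elim0
    rw [e, e] at this
    exact this
  | succ n ih =>
    intro P h
    have h2 : SA (fun w : ι ⊕ Fin n → ℝ => ∃ y : ℝ, P (fun i => w (Sum.inl i))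
        (Fin.cons y (fun i => w (Sum.inr i)))) := by
      apply SA.ex (P := fun (w : ι ⊕ Fin n → ℝ) y => P (fun i => w (Sum.inl i))
        (Fin.cons y (fun i => w (Sum.inr i))))
      refine (h.reindex (Sum.elim (fun i => some (Sum.inl i))
        (Fin.cons none (fun i => some (Sum.inr i))))).congr fun w => ?_
      have : (fun i : Fin (n + 1) => w (Sum.elim (fun i => some (Sum.inl i))
        (Fin.cons none (fun i => some (Sum.inr i)) : Fin (n + 1) → Option (ι ⊕ Fin n))
          (Sum.inr i : ι ⊕ Fin (n + 1)))) = 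
          (Fin.cons (w none) (fun i => w (some (Sum.inr i))) : Fin (n + 1) → ℝ) := by
        funext i
        refine Fin.cases ?_ (fun j => ?_) i
        · simp
        · simp
      rw [this]
      rfl
    refine (ih (P := fun v x => ∃ y : ℝ, P v (Fin.cons y x)) h2).congr fun v => ?_
    constructor
    · rintro ⟨x, y, h⟩; exact ⟨_, h⟩
    · rintro ⟨x, h⟩
      exact ⟨Fin.tail x, x 0, by rwa [Fin.cons_self_tail]⟩

lemma SA.ex_fintype {ι κ : Type*} [Fintype κ] {P : (ι → ℝ) → (κ → ℝ) → Prop}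
    (h : SA (fun w : ι ⊕ κ → ℝ => P (fun i => w (Sum.inl i)) (fun i => w (Sum.inr i)))) :
    SA (fun v => ∃ x, P v x) := by
  let e := Fintype.equivFin κ
  refine (SA.ex_fin (Fintype.card κ) (P := fun v x => P v (fun k => x (e k)))
    (h.reindex (Sum.map id e))).congr fun v => ?_
  constructor
  · rintro ⟨x, h⟩; exact ⟨_, h⟩
  · rintro ⟨x, h⟩
    exact ⟨fun i => x (e.symm i), by simpa using h⟩

lemma SA.all_fintype {ι κ : Type*} [Fintype κ] {P : (ι → ℝ) → (κ → ℝ) → Prop}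
    (h : SA (fun w : ι ⊕ κ → ℝ => P (fun i => w (Sum.inl i)) (fun i => w (Sum.inr i)))) :
    SA (fun v => ∀ x, P v x) :=
  (SA.ex_fintype (P := fun v x => ¬ P v x) h.not).not.congr fun v => by push Not; rfl

/-- Polynomial functions. -/
def PF {ι : Type*} (f : (ι → ℝ) → ℝ) : Prop :=
  ∃ p : MvPolynomial ι ℝ, ∀ v, MvPolynomial.eval v p = f v

lemma PF.const {ι : Type*} (c : ℝ) : PF (fun _ : ι → ℝ => c) := ⟨MvPolynomial.C c, by simp⟩
lemma PF.var {ι : Type*} (i : ι) : PF (fun v : ι → ℝ => v i) := ⟨MvPolynomial.X i, by simp⟩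
lemma PF.add {ι : Type*} {f g : (ι → ℝ) → ℝ} (hf : PF f) (hg : PF g) :
    PF (fun v => f v + g v) := by
  obtain ⟨p, hp⟩ := hf
  obtain ⟨q, hq⟩ := hg
  exact ⟨p + q, by simp [hp, hq]⟩
lemma PF.mul {ι : Type*} {f g : (ι → ℝ) → ℝ} (hf : PF f) (hg : PF g) :
    PF (fun v => f v * g v) := by
  obtain ⟨p, hp⟩ := hf
  obtain ⟨q, hq⟩ := hg
  exact ⟨p * q, by simp [hp, hq]⟩
lemma PF.sub {ι : Type*} {f g : (ι → ℝ) → ℝ} (hf : PF f) (hg : PF g) :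
    PF (fun v => f v - g v) := by
  obtain ⟨p, hp⟩ := hf
  obtain ⟨q, hq⟩ := hg
  exact ⟨p - q, by simp [hp, hq]⟩
lemma PF.pow {ι : Type*} {f : (ι → ℝ) → ℝ} (hf : PF f) (n : ℕ) :
    PF (fun v => f v ^ n) := by
  obtain ⟨p, hp⟩ := hf
  exact ⟨p ^ n, by simp [hp]⟩
lemma PF.sum {ι κ : Type*} [Fintype κ] {f : κ → (ι → ℝ) → ℝ} (hf : ∀ k, PF (f k)) :
    PF (fun v => ∑ k, f k v) := by
  choose p hp using hf
  exact ⟨∑ k, p k, fun v => by simp [hp]⟩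

lemma PF.pos {ι : Type*} {f : (ι → ℝ) → ℝ} (hf : PF f) : SA (fun v => 0 < f v) := by
  obtain ⟨p, hp⟩ := hf
  refine ⟨{p}, Set.finite_singleton p, fun t t' hs h => ?_⟩
  have := hs p rfl
  rw [hp, hp] at this
  exact pos_of_sign_eq this h

lemma PF.lt {ι : Type*} {f g : (ι → ℝ) → ℝ} (hf : PF f) (hg : PF g) :
    SA (fun v => f v < g v) :=
  (hg.sub hf).pos.congr fun v => sub_pos

lemma PF.le {ι : Type*} {f g : (ι → ℝ) → ℝ} (hf : PF f) (hg : PF g) :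
    SA (fun v => f v ≤ g v) :=
  (hg.lt hf).not.congr fun v => not_lt

lemma PF.eq {ι : Type*} {f g : (ι → ℝ) → ℝ} (hf : PF f) (hg : PF g) :
    SA (fun v => f v = g v) :=
  ((hf.le hg).and (hg.le hf)).congr fun v => le_antisymm_iff.symm

/-! ### One variable semialgebraic predicates and monotonicity -/

lemma poly_sign_right (q : Polynomial ℝ) (a : ℝ) :
    ∃ s : SignType, ∀ᶠ t in nhdsWithin a (Set.Ioi a), SignType.sign (q.eval t) = s := by
  by_cases hq : q = 0
  · exact ⟨0, by simp [hq]⟩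
  have hfin : (q.roots.toFinset : Set ℝ).Finite := Finset.finite_toSet _
  have hne : ∀ᶠ t in nhdsWithin a (Set.Ioi a), t ∉ (q.roots.toFinset : Set ℝ) \ {a} := by
    apply nhdsWithin_le_nhds
    exact (hfin.subset Set.diff_subset).isClosed.isOpen_compl.mem_nhds (by simp)
  obtain ⟨u, hu, hsub⟩ := (mem_nhdsGT_iff_exists_Ioo_subset).1 hne
  have hu : a < u := hu
  have hnr : ∀ t ∈ Set.Ioo a u, q.eval t ≠ 0 := by
    intro t ht h0
    have := hsub ht
    simp only [Set.mem_setOf_eq, Set.mem_diff, Finset.mem_coe, Multiset.mem_toFinset,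
      Polynomial.mem_roots hq, Polynomial.IsRoot, Set.mem_singleton_iff, not_and, not_not] at this
    exact ht.1.ne' (this h0)
  have hm : (a + u) / 2 ∈ Set.Ioo a u := ⟨by linarith, by linarith⟩
  refine ⟨SignType.sign (q.eval ((a + u) / 2)), ?_⟩
  filter_upwards [Ioo_mem_nhdsGT hu] with t ht
  by_contra hcon
  have hpc : IsPreconnected (Set.Ioo a u) := isPreconnected_Ioo
  have hz : ∃ z ∈ Set.Ioo a u, q.eval z = 0 := by
    have hc : ContinuousOn (fun t => q.eval t) (Set.Ioo a u) := q.continuous.continuousOn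
    rcases lt_or_gt_of_ne (hnr t ht) with h1 | h1 <;>
      rcases lt_or_gt_of_ne (hnr _ hm) with h2 | h2
    · rw [sign_neg h1, sign_neg h2] at hcon; exact absurd rfl hcon
    · have := hpc.intermediate_value ht hm hc
      obtain ⟨z, hz, hz2⟩ := this ⟨h1.le, h2.le⟩
      exact ⟨z, hz, hz2⟩
    · have := hpc.intermediate_value hm ht hc
      obtain ⟨z, hz, hz2⟩ := this ⟨h2.le, h1.le⟩
      exact ⟨z, hz, hz2⟩
    · rw [sign_pos h1, sign_pos h2] at hcon; exact absurd rfl hcon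
  obtain ⟨z, hz, hz2⟩ := hz
  exact hnr z hz hz2

lemma tendsto_neg_left (a : ℝ) :
    Filter.Tendsto (fun t : ℝ => -t) (nhdsWithin a (Set.Iio a))
      (nhdsWithin (-a) (Set.Ioi (-a))) := by
  apply tendsto_nhdsWithin_of_tendsto_nhds_of_eventually_within
  · exact (continuous_neg.tendsto a).mono_left nhdsWithin_le_nhds
  · filter_upwards [self_mem_nhdsWithin] with t ht
    simpa using ht

lemma poly_sign_left (q : Polynomial ℝ) (a : ℝ) :
    ∃ s : SignType, ∀ᶠ t in nhdsWithin a (Set.Iio a), SignType.sign (q.eval t) = s := by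
  obtain ⟨s, hs⟩ := poly_sign_right (q.comp (-Polynomial.X)) (-a)
  refine ⟨s, ((tendsto_neg_left a).eventually hs).mono fun t ht => ?_⟩
  simpa using ht

lemma SA.germ {S : ℝ → Prop} (h : SA (fun w : Unit → ℝ => S (w ()))) (l : Filter ℝ)
    (hl : ∀ q : Polynomial ℝ, ∃ s : SignType, ∀ᶠ t in l, SignType.sign (q.eval t) = s) :
    (∀ᶠ t in l, S t) ∨ (∀ᶠ t in l, ¬ S t) := by
  obtain ⟨A, hA, h⟩ := h
  have hl' : ∀ p : MvPolynomial Unit ℝ, ∃ s : SignType, ∀ᶠ t in l,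
      SignType.sign (MvPolynomial.eval (fun _ => t) p) = s := by
    intro p
    obtain ⟨s, hs⟩ := hl (MvPolynomial.eval₂ Polynomial.C (fun _ => Polynomial.X) p)
    refine ⟨s, hs.mono fun t ht => ?_⟩
    rw [← ht]
    congr 1
    have := MvPolynomial.hom_eval₂ p Polynomial.C (Polynomial.evalRingHom t)
      (fun _ : Unit => Polynomial.X)
    rw [Polynomial.coe_evalRingHom] at this
    rw [this]
    simp only [Polynomial.eval_X]
    have e : (Polynomial.evalRingHom t).comp Polynomial.C = RingHom.id ℝ := by
      ext c; simp
    rw [e]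
    rfl
  choose s hs using hl'
  have hall : ∀ᶠ t in l, ∀ p ∈ A, SignType.sign (MvPolynomial.eval (fun _ => t) p) = s p :=
    (Filter.eventually_all_finite hA).2 fun p _ => hs p
  by_cases hf : ∀ᶠ t in l, ¬ S t
  · exact Or.inr hf
  left
  have hf : ∃ᶠ t in l, S t := hf
  obtain ⟨t0, h0, h1⟩ := (hf.and_eventually hall).exists
  filter_upwards [hall] with t ht
  exact h (fun _ => t0) (fun _ => t) (fun a ha => by rw [h1 a ha, ht a ha]) h0

lemma SA.germ_right {S : ℝ → Prop} (h : SA (fun w : Unit → ℝ => S (w ()))) (a : ℝ) :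
    (∀ᶠ t in nhdsWithin a (Set.Ioi a), S t) ∨ (∀ᶠ t in nhdsWithin a (Set.Ioi a), ¬ S t) :=
  h.germ _ fun q => poly_sign_right q a

lemma SA.germ_left {S : ℝ → Prop} (h : SA (fun w : Unit → ℝ => S (w ()))) (a : ℝ) :
    (∀ᶠ t in nhdsWithin a (Set.Iio a), S t) ∨ (∀ᶠ t in nhdsWithin a (Set.Iio a), ¬ S t) :=
  h.germ _ fun q => poly_sign_left q a

/-- Semialgebraic functions. -/
def SAF {ι : Type*} (f : (ι → ℝ) → ℝ) : Prop :=
  SA (fun w : Option ι → ℝ => w none = f (fun i => w (some i)))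

lemma PF.saf {ι : Type*} {f : (ι → ℝ) → ℝ} (h : PF f) : SAF f := by
  refine (PF.var none).eq ?_
  obtain ⟨p, hp⟩ := h
  refine ⟨MvPolynomial.rename some p, fun v => ?_⟩
  rw [MvPolynomial.eval_rename]
  exact hp _

lemma SAF.rel {ι : Type*} {f g : (ι → ℝ) → ℝ} (hf : SAF f) (hg : SAF g) {r : ℝ → ℝ → Prop}
    (hr : SA (fun w : Bool → ℝ => r (w false) (w true))) :
    SA (fun v => r (f v) (g v)) := by
  have : SA (fun v => ∃ x y, x = f v ∧ y = g v ∧ r x y) := by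
    refine SA.ex (SA.ex ?_)
    refine SA.and ?_ (SA.and ?_ ?_)
    · exact hf.reindex (fun o : Option ι => o.elim (some none) (fun i => some (some i)))
    · exact hg.reindex (fun o : Option ι => o.elim none (fun i => some (some i)))
    · exact hr.reindex (fun b : Bool => if b then (none : Option (Option ι)) else some none)
  exact this.congr fun v => ⟨by rintro ⟨x, y, rfl, rfl, h⟩; exact h, fun h => ⟨_, _, rfl, rfl, h⟩⟩

lemma SAF.lt {ι : Type*} {f g : (ι → ℝ) → ℝ} (hf : SAF f) (hg : SAF g) :
    SA (fun v => f v < g v) := hf.rel hg ((PF.var false).lt (PF.var true))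

lemma SAF.eq {ι : Type*} {f g : (ι → ℝ) → ℝ} (hf : SAF f) (hg : SAF g) :
    SA (fun v => f v = g v) := hf.rel hg ((PF.var false).eq (PF.var true))

/-- one-variable semialgebraic function -/
def SAF1 (e : ℝ → ℝ) : Prop := SA (fun w : Bool → ℝ => w true = e (w false))

lemma SAF1.saf {e : ℝ → ℝ} (h : SAF1 e) {ι : Type*} (i : ι) :
    SAF (fun v : ι → ℝ => e (v i)) :=
  h.reindex (fun b : Bool => if b then none else some i)

lemma mono_of_local {e : ℝ → ℝ} {δ : ℝ}
    (hR : ∀ t ∈ Set.Ioo 0 δ, ∀ᶠ s in nhdsWithin t (Set.Ioi t), e t ≤ e s)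
    (hLf : ∀ t ∈ Set.Ioo 0 δ, ∀ᶠ s in nhdsWithin t (Set.Iio t), e s ≤ e t) :
    MonotoneOn e (Set.Ioo 0 δ) := by
  intro a ha b hb hab
  set T := {c | c ∈ Set.Icc a b ∧ ∀ s ∈ Set.Icc a c, e a ≤ e s} with hT
  have haT : a ∈ T := ⟨⟨le_rfl, hab⟩, fun s hs => by rw [le_antisymm hs.1 hs.2]⟩
  have hbd : BddAbove T := ⟨b, fun c hc => hc.1.2⟩
  set c := sSup T with hc
  have hac : a ≤ c := le_csSup hbd haT
  have hcb : c ≤ b := csSup_le ⟨a, haT⟩ fun c hc => hc.1.2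
  have hc0 : c ∈ Set.Ioo 0 δ := ⟨ha.1.trans_le hac, hcb.trans_lt hb.2⟩
  have hlt : ∀ s ∈ Set.Ico a c, e a ≤ e s := by
    intro s hs
    obtain ⟨c', hc', hs'⟩ := exists_lt_of_lt_csSup ⟨a, haT⟩ hs.2
    exact hc'.2 s ⟨hs.1, hs'.le⟩
  have hcc : e a ≤ e c := by
    rcases hac.eq_or_lt with h | h
    · rw [← h]
    · obtain ⟨s, hs, hs2⟩ := ((hLf c hc0).and (Ioo_mem_nhdsLT h)).exists
      exact (hlt s ⟨hs2.1.le, hs2.2⟩).trans hs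
  rcases hcb.eq_or_lt with h | h
  · rwa [← h]
  exfalso
  obtain ⟨u, hu, hu2⟩ := (mem_nhdsGT_iff_exists_Ioo_subset).1
    ((hR c hc0).and (Ioo_mem_nhdsGT h))
  have hu : c < u := hu
  have hm : (c + u) / 2 ∈ Set.Ioo c u := ⟨by linarith, by linarith⟩
  have : (c + u) / 2 ∈ T := by
    refine ⟨⟨hac.trans hm.1.le, (hu2 hm).2.2.le⟩, fun s hs => ?_⟩
    rcases lt_trichotomy s c with h1 | h1 | h1
    · exact hlt s ⟨hs.1, h1⟩
    · rw [h1]; exact hcc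
    · exact hcc.trans (hu2 ⟨h1, hs.2.trans_lt hm.2⟩).1
  exact absurd (le_csSup hbd this) (not_le.2 hm.1)

lemma no_strict_min {e : ℝ → ℝ} {δ : ℝ} (hδ : 0 < δ)
    (hR : ∀ t ∈ Set.Ioo 0 δ, ∀ᶠ s in nhdsWithin t (Set.Ioi t), e t < e s)
    (hLf : ∀ t ∈ Set.Ioo 0 δ, ∀ᶠ s in nhdsWithin t (Set.Iio t), e t < e s) : False := by
  have h : ∀ t : Set.Ioo (0 : ℝ) δ, ∃ p : ℚ × ℚ, (p.1 : ℝ) < t ∧ (t : ℝ) < p.2 ∧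
      ∀ s ∈ Set.Ioo (p.1 : ℝ) p.2, s ≠ t → e t < e s := by
    intro ⟨t, ht⟩
    obtain ⟨u, hu, hu2⟩ := (mem_nhdsGT_iff_exists_Ioo_subset).1 (hR t ht)
    obtain ⟨l, hl, hl2⟩ := (mem_nhdsLT_iff_exists_Ioo_subset).1 (hLf t ht)
    obtain ⟨p, hp, hp'⟩ := exists_rat_btwn (show l < t from hl)
    obtain ⟨q, hq, hq'⟩ := exists_rat_btwn (show t < u from hu)
    refine ⟨(p, q), hp', hq, fun s hs hst => ?_⟩
    rcases lt_or_gt_of_ne hst with h | h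
    · exact hl2 ⟨hp.trans hs.1, h⟩
    · exact hu2 ⟨h, hs.2.trans hq'⟩
  choose f h1 h2 h3 using h
  have hinj : Function.Injective f := by
    intro s t hst
    by_contra hne
    have hne' : (s : ℝ) ≠ t := fun h => hne (Subtype.ext h)
    have a1 := h3 t s ⟨by rw [← hst]; exact h1 s, by rw [← hst]; exact h2 s⟩ hne'
    have a2 := h3 s t ⟨by rw [hst]; exact h1 t, by rw [hst]; exact h2 t⟩ hne'.symm
    exact lt_asymm a1 a2
  have : Countable (Set.Ioo (0 : ℝ) δ) := hinj.countable
  have h2 : (Set.Ioo (0 : ℝ) δ).Countable := this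
  exact absurd h2 (Cardinal.Real.Ioo_countable_iff.not.2 (not_le.2 hδ))

lemma tri_germ {e : ℝ → ℝ} (he : SAF1 e) (l : Filter ℝ) (c : ℝ)
    (hl : ∀ q : Polynomial ℝ, ∃ s : SignType, ∀ᶠ t in l, SignType.sign (q.eval t) = s) :
    (∀ᶠ s in l, c < e s) ∨ (∀ᶠ s in l, e s = c) ∨ (∀ᶠ s in l, e s < c) := by
  have h1 := SA.germ (S := fun s => c < e s) ((PF.const c).saf.lt (he.saf ())) l hl
  have h2 := SA.germ (S := fun s => e s < c) ((he.saf ()).lt (PF.const c).saf) l hl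
  rcases h1 with h1 | h1
  · exact Or.inl h1
  rcases h2 with h2 | h2
  · exact Or.inr (Or.inr h2)
  · refine Or.inr (Or.inl ?_)
    filter_upwards [h1, h2] with s a b
    exact le_antisymm (not_lt.1 a) (not_lt.1 b)

lemma ev_right_iff (t : ℝ) (Q : ℝ → Prop) : (∀ᶠ s in nhdsWithin t (Set.Ioi t), Q s) ↔
    ∃ u, t < u ∧ ∀ s, t < s → s < u → Q s := by
  rw [Filter.Eventually, mem_nhdsGT_iff_exists_Ioo_subset]
  exact ⟨fun ⟨u, h1, h2⟩ => ⟨u, h1, fun s a b => h2 ⟨a, b⟩⟩,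
    fun ⟨u, h1, h2⟩ => ⟨u, h1, fun s a => h2 s a.1 a.2⟩⟩

lemma ev_left_iff (t : ℝ) (Q : ℝ → Prop) : (∀ᶠ s in nhdsWithin t (Set.Iio t), Q s) ↔
    ∃ u, u < t ∧ ∀ s, u < s → s < t → Q s := by
  rw [Filter.Eventually, mem_nhdsLT_iff_exists_Ioo_subset]
  exact ⟨fun ⟨u, h1, h2⟩ => ⟨u, h1, fun s a b => h2 ⟨a, b⟩⟩,
    fun ⟨u, h1, h2⟩ => ⟨u, h1, fun s a => h2 s a.1 a.2⟩⟩

lemma SA.ev_right {Q : ℝ → ℝ → Prop} (h : SA (fun w : Bool → ℝ => Q (w false) (w true))) :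
    SA (fun w : Unit → ℝ => ∀ᶠ s in nhdsWithin (w ()) (Set.Ioi (w ())), Q (w ()) s) := by
  have : SA (fun w : Unit → ℝ => ∃ u, w () < u ∧ ∀ s, w () < s → s < u → Q (w ()) s) := by
    refine SA.ex (SA.and ((PF.var (some ())).lt (PF.var none)) (SA.all (SA.imp ?_ (SA.imp ?_ ?_))))
    · exact (PF.var (some (some ()))).lt (PF.var none)
    · exact (PF.var none).lt (PF.var (some none))
    · exact h.reindex (fun b : Bool => if b then none else (some (some ())))
  exact this.congr fun w => (ev_right_iff _ _).symm

lemma SA.ev_left {Q : ℝ → ℝ → Prop} (h : SA (fun w : Bool → ℝ => Q (w false) (w true))) :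
    SA (fun w : Unit → ℝ => ∀ᶠ s in nhdsWithin (w ()) (Set.Iio (w ())), Q (w ()) s) := by
  have : SA (fun w : Unit → ℝ => ∃ u, u < w () ∧ ∀ s, u < s → s < w () → Q (w ()) s) := by
    refine SA.ex (SA.and ((PF.var none).lt (PF.var (some ()))) (SA.all (SA.imp ?_ (SA.imp ?_ ?_))))
    · exact (PF.var (some none)).lt (PF.var none)
    · exact (PF.var none).lt (PF.var (some (some ())))
    · exact h.reindex (fun b : Bool => if b then none else (some (some ())))
  exact this.congr fun w => (ev_left_iff _ _).symm

lemma ev_tri {P1 P2 P3 : ℝ → Prop} (h1 : SA (fun w : Unit → ℝ => P1 (w ())))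
    (h2 : SA (fun w : Unit → ℝ => P2 (w ()))) 
    (h : ∀ t, P1 t ∨ P2 t ∨ P3 t) :
    (∀ᶠ t in nhdsWithin (0 : ℝ) (Set.Ioi 0), P1 t) ∨
    (∀ᶠ t in nhdsWithin (0 : ℝ) (Set.Ioi 0), P2 t) ∨
    (∀ᶠ t in nhdsWithin (0 : ℝ) (Set.Ioi 0), P3 t) := by
  rcases h1.germ_right 0 with a | a
  · exact Or.inl a
  rcases h2.germ_right 0 with b | b
  · exact Or.inr (Or.inl b)
  refine Or.inr (Or.inr ?_)
  filter_upwards [a, b] with t a b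
  have := h t
  tauto

lemma ev_Ioo {Q : ℝ → Prop} (h : ∀ᶠ t in nhdsWithin (0 : ℝ) (Set.Ioi 0), Q t) :
    ∃ δ > 0, ∀ t ∈ Set.Ioo 0 δ, Q t := by
  obtain ⟨u, hu, h⟩ := (ev_right_iff _ _).1 h
  exact ⟨u, hu, fun t ht => h t ht.1 ht.2⟩

theorem SAF1.monotone {e : ℝ → ℝ} (he : SAF1 e) : ∃ δ > 0,
    MonotoneOn e (Set.Ioo 0 δ) ∨ AntitoneOn e (Set.Ioo 0 δ) := by
  have hgt : SA (fun w : Bool → ℝ => e (w false) < e (w true)) := (he.saf _).lt (he.saf _)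
  have hlt : SA (fun w : Bool → ℝ => e (w true) < e (w false)) := (he.saf _).lt (he.saf _)
  have heq : SA (fun w : Bool → ℝ => e (w true) = e (w false)) := (he.saf _).eq (he.saf _)
  have neg : ∀ {δ : ℝ}, MonotoneOn (fun t => -e t) (Set.Ioo 0 δ) → AntitoneOn e (Set.Ioo 0 δ) :=
    fun h a ha b hb hab => neg_le_neg_iff.1 (h ha hb hab)
  have hR := ev_tri (SA.ev_right (Q := fun t s => e t < e s) hgt)
    (SA.ev_right (Q := fun t s => e s = e t) heq)
    (P3 := fun t => ∀ᶠ s in nhdsWithin t (Set.Ioi t), e s < e t)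
    (fun t => tri_germ he _ (e t) fun q => poly_sign_right q t)
  have hLf := ev_tri (SA.ev_left (Q := fun t s => e t < e s) hgt)
    (SA.ev_left (Q := fun t s => e s = e t) heq)
    (P3 := fun t => ∀ᶠ s in nhdsWithin t (Set.Iio t), e s < e t)
    (fun t => tri_germ he _ (e t) fun q => poly_sign_left q t)
  rcases hR with r | r | r <;> rcases hLf with l | l | l <;>
    obtain ⟨δ, hδ, hh⟩ := ev_Ioo (r.and l)
  · exact (no_strict_min hδ (fun t ht => (hh t ht).1) (fun t ht => (hh t ht).2)).elim
  · exact ⟨δ, hδ, Or.inl (mono_of_local (fun t ht => (hh t ht).1.mono fun s hs => hs.le)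
      (fun t ht => (hh t ht).2.mono fun s hs => hs.le))⟩
  · exact ⟨δ, hδ, Or.inl (mono_of_local (fun t ht => (hh t ht).1.mono fun s hs => hs.le)
      (fun t ht => (hh t ht).2.mono fun s hs => hs.le))⟩
  · exact ⟨δ, hδ, Or.inr (neg (mono_of_local
      (fun t ht => (hh t ht).1.mono fun s hs => neg_le_neg hs.le)
      (fun t ht => (hh t ht).2.mono fun s hs => neg_le_neg hs.le)))⟩
  · exact ⟨δ, hδ, Or.inl (mono_of_local (fun t ht => (hh t ht).1.mono fun s hs => hs.ge)
      (fun t ht => (hh t ht).2.mono fun s hs => hs.le))⟩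
  · exact ⟨δ, hδ, Or.inl (mono_of_local (fun t ht => (hh t ht).1.mono fun s hs => hs.ge)
      (fun t ht => (hh t ht).2.mono fun s hs => hs.le))⟩
  · exact ⟨δ, hδ, Or.inr (neg (mono_of_local
      (fun t ht => (hh t ht).1.mono fun s hs => neg_le_neg hs.le)
      (fun t ht => (hh t ht).2.mono fun s hs => neg_le_neg hs.le)))⟩
  · exact ⟨δ, hδ, Or.inr (neg (mono_of_local
      (fun t ht => (hh t ht).1.mono fun s hs => neg_le_neg hs.le)
      (fun t ht => (hh t ht).2.mono fun s hs => neg_le_neg hs.ge)))⟩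
  · exact (no_strict_min (e := fun t => - e t) hδ
      (fun t ht => (hh t ht).1.mono fun s hs => neg_lt_neg hs)
      (fun t ht => (hh t ht).2.mono fun s hs => neg_lt_neg hs)).elim

lemma SAF1.sign {e : ℝ → ℝ} (he : SAF1 e) : ∃ δ > 0, ∃ σ : SignType, ∀ t ∈ Set.Ioo 0 δ,
    SignType.sign (e t) = σ := by
  rcases tri_germ he _ 0 fun q => poly_sign_right q 0 with h | h | h <;>
    obtain ⟨δ, hδ, hh⟩ := ev_Ioo h
  · exact ⟨δ, hδ, 1, fun t ht => sign_pos (hh t ht)⟩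
  · exact ⟨δ, hδ, 0, fun t ht => by rw [hh t ht, sign_zero]⟩
  · exact ⟨δ, hδ, -1, fun t ht => sign_neg (hh t ht)⟩

/-! ### A semialgebraic curve selection lemma -/

/-- Lexicographically minimal points of the levels of `K`. -/
def LexMin {ι : Type*} (K : Set (ι → ℝ)) (rk : ι → ℕ) (i0 : ι) (w : ι → ℝ) : Prop :=
  w ∈ K ∧ ∀ w', w' ∈ K → w' i0 = w i0 → ∀ k, (∀ j, rk j < rk k → w' j = w j) → w k ≤ w' k

lemma LexMin.exists {ι : Type*} {K : Set (ι → ℝ)} (hK : IsCompact K) {rk : ι → ℕ}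
    (hrk : Function.Injective rk) [Fintype ι] {i0 : ι} {t : ℝ} (hne : ∃ w ∈ K, w i0 = t) :
    ∃ w, LexMin K rk i0 w ∧ w i0 = t := by
  have key : ∀ N : ℕ, ∃ w ∈ K, w i0 = t ∧ ∀ w', w' ∈ K → w' i0 = t → ∀ k, rk k < N →
      (∀ j, rk j < rk k → w' j = w j) → w k ≤ w' k := by
    intro N
    induction N with
    | zero =>
      obtain ⟨w, hw, h⟩ := hne
      exact ⟨w, hw, h, fun _ _ _ k hk => absurd hk (Nat.not_lt_zero _)⟩
    | succ N ih =>
      obtain ⟨w, hw, hwt, h⟩ := ih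
      by_cases hN : ∃ k, rk k = N
      · obtain ⟨k0, hk0⟩ := hN
        have hcl : IsClosed {w' : ι → ℝ | w' i0 = t ∧ ∀ j, rk j < N → w' j = w j} := by
          apply IsClosed.inter
          · exact isClosed_eq (continuous_apply i0) continuous_const
          · have : {w' : ι → ℝ | ∀ j, rk j < N → w' j = w j} =
                ⋂ j, ⋂ (_ : rk j < N), {w' : ι → ℝ | w' j = w j} := by ext; simp
            change IsClosed {w' : ι → ℝ | ∀ j, rk j < N → w' j = w j}
            rw [this]
            exact isClosed_iInter fun j => isClosed_iInter fun _ =>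
              isClosed_eq (continuous_apply j) continuous_const
        obtain ⟨w1, hw1, hmin⟩ := (hK.inter_right hcl).exists_isMinOn ⟨w, hw, hwt, fun _ _ => rfl⟩
          ((continuous_apply k0).continuousOn)
        refine ⟨w1, hw1.1, hw1.2.1, fun w' hw' ht k hk hj => ?_⟩
        rcases Nat.lt_succ_iff_lt_or_eq.1 hk with h1 | h1
        · rw [hw1.2.2 k h1]
          exact h w' hw' ht k h1 fun j hjk => by rw [hj j hjk, hw1.2.2 j (hjk.trans h1)]
        · have : k = k0 := hrk (by rw [h1, hk0])
          subst this
          exact hmin ⟨hw', ht, fun j hjN => by rw [hj j (by omega), hw1.2.2 j hjN]⟩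
      · refine ⟨w, hw, hwt, fun w' hw' ht k hk => h w' hw' ht k ?_⟩
        rcases Nat.lt_succ_iff_lt_or_eq.1 hk with h1 | h1
        · exact h1
        · exact absurd ⟨k, h1⟩ hN
  obtain ⟨N, hN⟩ : ∃ N, ∀ k, rk k < N :=
    ⟨(Finset.univ.sup rk) + 1, fun k => Nat.lt_succ_of_le (Finset.le_sup (Finset.mem_univ k))⟩
  obtain ⟨w, hw, hwt, h⟩ := key N
  exact ⟨w, ⟨hw, fun w' hw' ht k => h w' hw' (ht.trans hwt) k (hN k)⟩, hwt⟩

lemma LexMin.unique {ι : Type*} {K : Set (ι → ℝ)} {rk : ι → ℕ} {i0 : ι} {w w' : ι → ℝ}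
    (h : LexMin K rk i0 w) (h' : LexMin K rk i0 w') (he : w i0 = w' i0) : w = w' := by
  have key : ∀ N : ℕ, ∀ k, rk k = N → w k = w' k := by
    intro N
    induction N using Nat.strong_induction_on with
    | _ N ih =>
      intro k hk
      apply le_antisymm
      · exact h.2 w' h'.1 he.symm k fun j hj => (ih (rk j) (hk ▸ hj) j rfl).symm
      · exact h'.2 w h.1 he k fun j hj => (ih (rk j) (hk ▸ hj) j rfl)
  exact funext fun k => key _ k rfl

lemma LexMin.sa {ι : Type*} [Fintype ι] {K : Set (ι → ℝ)} (hK : SA (fun w => w ∈ K))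
    (rk : ι → ℕ) (i0 : ι) : SA (LexMin K rk i0) := by
  refine SA.and hK (SA.all_fintype (SA.imp ?_ (SA.imp ?_ (SA.all_fin fun k => SA.imp
    (SA.all_fin fun j => SA.imp (SA.const _) ?_) ?_))))
  · exact hK.reindex Sum.inr
  · exact (PF.var (Sum.inr i0)).eq (PF.var (Sum.inl i0))
  · exact (PF.var (Sum.inr j)).eq (PF.var (Sum.inl j))
  · exact (PF.var (Sum.inl k)).le (PF.var (Sum.inr k))

lemma exists_rank {ι : Type*} [Fintype ι] (i1 : ι) : ∃ rk : ι → ℕ, Function.Injective rk ∧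
    rk i1 = 0 := by
  refine ⟨fun i => if i = i1 then 0 else (Fintype.equivFin ι i : ℕ) + 1, ?_, by simp⟩
  intro a b h
  by_cases ha : a = i1 <;> by_cases hb : b = i1 <;> simp [ha, hb] at h ⊢
  exact (Fintype.equivFin ι).injective (Fin.ext h)

lemma exists_common_delta {κ : Type*} [Finite κ] {Q : κ → ℝ → Prop}
    (h : ∀ k, ∃ δ > 0, ∀ d, 0 < d → d ≤ δ → Q k d) : ∃ δ > 0, ∀ k, Q k δ := by
  have : ∀ k, ∀ᶠ d in nhdsWithin (0 : ℝ) (Set.Ioi 0), Q k d := by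
    intro k
    obtain ⟨δ, hδ, h⟩ := h k
    filter_upwards [Ioc_mem_nhdsGT hδ] with d hd
    exact h d hd.1 hd.2
  obtain ⟨δ, h1, h2⟩ := ((Filter.eventually_all.2 this).and self_mem_nhdsWithin).exists
  exact ⟨δ, h2, h1⟩

theorem curve_lemma {ι : Type*} [Fintype ι] {K : Set (ι → ℝ)} (hKc : IsCompact K)
    (hK : SA (fun w => w ∈ K)) (i0 i1 : ι) :
    (∃ δ > 0, ∀ w ∈ K, ¬ (0 < w i0 ∧ w i0 < δ)) ∨
    (∃ δ > 0, ∃ c : ℝ → ι → ℝ, (∀ t ∈ Set.Ioo 0 δ, c t ∈ K ∧ c t i0 = t ∧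
        ∀ w ∈ K, w i0 = t → c t i1 ≤ w i1) ∧
      ∀ k, (MonotoneOn (fun t => c t k) (Set.Ioo 0 δ) ∨
          AntitoneOn (fun t => c t k) (Set.Ioo 0 δ)) ∧
        ∃ σ : SignType, ∀ t ∈ Set.Ioo 0 δ, SignType.sign (c t k) = σ) := by
  obtain ⟨rk, hrk, hrk1⟩ := exists_rank i1
  have hN : SA (fun v : Unit → ℝ => ∃ w : ι → ℝ, w ∈ K ∧ w i0 = v ()) := by
    refine SA.ex_fintype (SA.and ?_ ?_)
    · exact hK.reindex Sum.inr
    · exact (PF.var (Sum.inr i0)).eq (PF.var (Sum.inl ()))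
  rcases SA.germ_right (S := fun t => ∃ w : ι → ℝ, w ∈ K ∧ w i0 = t) hN 0 with h | h
  swap
  · left
    obtain ⟨δ, hδ, h⟩ := ev_Ioo h
    exact ⟨δ, hδ, fun w hw hw2 => h (w i0) hw2 ⟨w, hw, rfl⟩⟩
  right
  obtain ⟨δ0, hδ0, h⟩ := ev_Ioo h
  let c : ℝ → ι → ℝ := fun t =>
    if h : ∃ w, LexMin K rk i0 w ∧ w i0 = t then h.choose else 0
  have hc : ∀ t, (∃ w, LexMin K rk i0 w ∧ w i0 = t) → LexMin K rk i0 (c t) ∧ c t i0 = t := by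
    intro t ht
    simp only [c, dif_pos ht]
    exact ht.choose_spec
  have hc0 : ∀ t, ¬ (∃ w, LexMin K rk i0 w ∧ w i0 = t) → c t = 0 := by
    intro t ht
    simp only [c, dif_neg ht]
  have hsa : ∀ k, SAF1 (fun t => c t k) := by
    intro k
    have hL := LexMin.sa hK rk i0
    have h1 : SA (fun v : Bool → ℝ =>
        (∃ w : ι → ℝ, LexMin K rk i0 w ∧ w i0 = v false ∧ w k = v true) ∨
        (¬ (∃ w : ι → ℝ, LexMin K rk i0 w ∧ w i0 = v false)) ∧ v true = 0) := by
      refine SA.or (SA.ex_fintype (SA.and ?_ (SA.and ?_ ?_)))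
        (SA.and (SA.not (SA.ex_fintype (SA.and ?_ ?_))) ?_)
      · exact hL.reindex Sum.inr
      · exact (PF.var (Sum.inr i0)).eq (PF.var (Sum.inl false))
      · exact (PF.var (Sum.inr k)).eq (PF.var (Sum.inl true))
      · exact hL.reindex Sum.inr
      · exact (PF.var (Sum.inr i0)).eq (PF.var (Sum.inl false))
      · exact (PF.var true).eq (PF.const 0)
    refine h1.congr fun v => ?_
    by_cases hv : ∃ w, LexMin K rk i0 w ∧ w i0 = v false
    · obtain ⟨h2, h3⟩ := hc _ hv
      constructor
      · rintro (⟨w, hw, hw0, hwk⟩ | h)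
        · rw [← hwk, hw.unique h2 (hw0.trans h3.symm)]
        · exact absurd hv h.1
      · intro h
        exact Or.inl ⟨_, h2, h3, h.symm⟩
    · constructor
      · rintro (⟨w, hw, hw0, hwk⟩ | h)
        · exact absurd ⟨w, hw, hw0⟩ hv
        · change v true = c (v false) k
          rw [hc0 _ hv, h.2]; rfl
      · intro h
        change v true = c (v false) k at h
        rw [hc0 _ hv] at h
        exact Or.inr ⟨hv, h⟩
  have hkk : ∀ k, ∃ δ > 0, ∀ d, 0 < d → d ≤ δ → (d ≤ δ0 ∧
      (MonotoneOn (fun t => c t k) (Set.Ioo 0 d) ∨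
          AntitoneOn (fun t => c t k) (Set.Ioo 0 d)) ∧
        ∃ σ : SignType, ∀ t ∈ Set.Ioo 0 d, SignType.sign (c t k) = σ) := by
    intro k
    obtain ⟨δ1, hδ1, h1⟩ := (hsa k).monotone
    obtain ⟨δ2, hδ2, σ, h2⟩ := (hsa k).sign
    refine ⟨min δ0 (min δ1 δ2), by positivity, fun d _ hd => ?_⟩
    have hd0 := hd.trans (min_le_left _ _)
    have hd1 := hd.trans ((min_le_right _ _).trans (min_le_left _ _))
    have hd2 := hd.trans ((min_le_right _ _).trans (min_le_right _ _))
    refine ⟨hd0, ?_, σ, fun t ht => h2 t ⟨ht.1, ht.2.trans_le hd2⟩⟩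
    exact h1.imp (fun h => h.mono (Set.Ioo_subset_Ioo_right hd1))
      (fun h => h.mono (Set.Ioo_subset_Ioo_right hd1))
  obtain ⟨δ, hδ, hk⟩ := exists_common_delta hkk
  refine ⟨δ, hδ, c, fun t ht => ?_, fun k => (hk k).2⟩
  obtain ⟨h1, h2⟩ := hc t (LexMin.exists hKc hrk (h t ⟨ht.1, ht.2.trans_le (hk i0).1⟩))
  refine ⟨h1.1, h2, fun w hw hwt => h1.2 w hw (hwt.trans h2.symm) i1 fun j hj => ?_⟩
  rw [hrk1] at hj
  exact absurd hj (Nat.not_lt_zero _)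

/-! ### The objective function -/

abbrev EE (n : ℕ) := EuclideanSpace ℝ (Fin n)

lemma mv_apply {m n : ℕ} (A : Matrix (Fin m) (Fin n) ℝ) (x : EE n) (j : Fin m) :
    mv A x j = ∑ i, A j i * x i := rfl

lemma mv_add {m n : ℕ} (A : Matrix (Fin m) (Fin n) ℝ) (x y : EE n) :
    mv A (x + y) = mv A x + mv A y := by
  ext j; simp [mv_apply, mul_add, Finset.sum_add_distrib]

lemma mv_smul {m n : ℕ} (A : Matrix (Fin m) (Fin n) ℝ) (c : ℝ) (x : EE n) :
    mv A (c • x) = c • mv A x := by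
  ext j; simp [mv_apply, Finset.mul_sum, mul_left_comm]

lemma mv_sub {m n : ℕ} (A : Matrix (Fin m) (Fin n) ℝ) (x y : EE n) :
    mv A (x - y) = mv A x - mv A y := by
  ext j; simp [mv_apply, mul_sub, Finset.sum_sub_distrib]

lemma mv_inner {m n : ℕ} (A : Matrix (Fin m) (Fin n) ℝ) (x : EE n) (y : EE m) :
    inner ℝ (mv A x) y = inner ℝ x (mv A.transpose y) := by
  simp only [PiLp.inner_apply, mv_apply, RCLike.inner_apply, conj_trivial, Matrix.transpose_apply,
    Finset.mul_sum, Finset.sum_mul]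
  rw [Finset.sum_comm]
  refine Finset.sum_congr rfl fun i _ => Finset.sum_congr rfl fun j _ => ?_
  ring

lemma mv_continuous {m n : ℕ} (A : Matrix (Fin m) (Fin n) ℝ) : Continuous (mv A) := by
  have : mv A = (IsLinearMap.mk' (mv A) ⟨mv_add A, mv_smul A⟩ : EE n →ₗ[ℝ] EE m) := rfl
  rw [this]
  exact LinearMap.continuous_of_finiteDimensional _

/-- least squares term -/
def lsq {m n : ℕ} (A : Matrix (Fin m) (Fin n) ℝ) (b : EE m) (x : EE n) : ℝ :=
  1 / 2 * ‖mv A x - b‖ ^ 2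

/-- its gradient -/
def grd {m n : ℕ} (A : Matrix (Fin m) (Fin n) ℝ) (b : EE m) (x : EE n) : EE n :=
  mv A.transpose (mv A x - b)

lemma grd_continuous {m n : ℕ} (A : Matrix (Fin m) (Fin n) ℝ) (b : EE m) :
    Continuous (grd A b) :=
  (mv_continuous _).comp ((mv_continuous A).sub continuous_const)

lemma lsq_continuous {m n : ℕ} (A : Matrix (Fin m) (Fin n) ℝ) (b : EE m) :
    Continuous (lsq A b) :=
  continuous_const.mul ((((mv_continuous A).sub continuous_const).norm).pow 2)

lemma lsq_expand {m n : ℕ} (A : Matrix (Fin m) (Fin n) ℝ) (b : EE m) (x d : EE n) :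
    lsq A b (x + d) = lsq A b x + inner ℝ (grd A b x) d + 1 / 2 * ‖mv A d‖ ^ 2 := by
  unfold lsq grd
  rw [mv_add, show mv A x + mv A d - b = (mv A x - b) + mv A d by abel, norm_add_sq_real,
    real_inner_comm, mv_inner, real_inner_comm]
  ring

/-- objective -/
def obj {m n : ℕ} (A : Matrix (Fin m) (Fin n) ℝ) (b : EE m) (γ : ℝ) (x : EE n) : ℝ :=
  γ * (l1 x / ‖x‖) + lsq A b x

/-- subgradient elements -/
def sgr {m n : ℕ} (A : Matrix (Fin m) (Fin n) ℝ) (b : EE m) (γ : ℝ) (x s : EE n) : EE n :=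
  γ • (‖x‖⁻¹ • s - (l1 x / ‖x‖ ^ 3) • x) + grd A b x

lemma l1_continuous {n : ℕ} : Continuous (l1 : EE n → ℝ) := by
  unfold l1
  fun_prop

lemma norm_le_l1 {n : ℕ} (x : EE n) : ‖x‖ ≤ l1 x := by
  have h0 : 0 ≤ l1 x := Finset.sum_nonneg fun i _ => abs_nonneg _
  rw [← abs_of_nonneg (norm_nonneg x), ← abs_of_nonneg h0]
  apply sq_le_sq.1
  rw [EuclideanSpace.real_norm_sq_eq]
  have : ∀ i, x i ^ 2 ≤ |x i| * l1 x := by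
    intro i
    rw [← sq_abs, pow_two]
    exact mul_le_mul_of_nonneg_left
      (Finset.single_le_sum (f := fun i => |x i|) (fun i _ => abs_nonneg _) (Finset.mem_univ i))
      (abs_nonneg _)
  calc ∑ i, x i ^ 2 ≤ ∑ i, |x i| * l1 x := Finset.sum_le_sum fun i _ => this i
    _ = l1 x ^ 2 := by rw [← Finset.sum_mul, pow_two]; rfl

/-- first-order upper expansion of the smooth pieces -/
lemma smooth_expand {m n : ℕ} (A : Matrix (Fin m) (Fin n) ℝ) (b : EE m) (γ : ℝ) (σ x : EE n)
    (hx : x ≠ 0) (ε : ℝ) (hε : 0 < ε) :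
    ∃ η > 0, ∀ x' : EE n, ‖x' - x‖ < η →
      |(γ * (inner ℝ σ x' / ‖x'‖) + lsq A b x') - (γ * (inner ℝ σ x / ‖x‖) + lsq A b x) -
        inner ℝ (γ • (‖x‖⁻¹ • σ - (inner ℝ σ x / ‖x‖ ^ 3) • x) + grd A b x) (x' - x)|
        ≤ ε * ‖x' - x‖ := by
  have hr : ‖x‖ ≠ 0 := norm_ne_zero_iff.2 hx
  have hN : HasFDerivAt (fun y : EE n => √(‖y‖ ^ 2)) ((1 / (2 * √(‖x‖ ^ 2))) •
      (2 • innerSL ℝ x)) x :=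
    HasFDerivAt.sqrt (hasStrictFDerivAt_norm_sq x).hasFDerivAt (by positivity)
  simp only [Real.sqrt_sq (norm_nonneg _)] at hN
  have hI : HasFDerivAt (fun y : EE n => inner ℝ σ y) (innerSL ℝ σ) x :=
    (innerSL ℝ σ).hasFDerivAt
  have hD := (hI.mul ((hasDerivAt_inv hr).comp_hasFDerivAt x hN)).const_mul γ
  have hQ : HasFDerivAt (lsq A b) (innerSL ℝ (grd A b x)) x := by
    rw [hasFDerivAt_iff_isLittleO_nhds_zero]
    have h1 : (fun d => lsq A b (x + d) - lsq A b x - innerSL ℝ (grd A b x) d) =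
        fun d => 1 / 2 * ‖mv A d‖ ^ 2 := by
      funext d
      rw [lsq_expand, innerSL_apply_apply]
      ring
    rw [h1]
    let T : EE n →L[ℝ] EE m := LinearMap.toContinuousLinearMap
      (IsLinearMap.mk' (mv A) ⟨mv_add A, mv_smul A⟩)
    have hT : ∀ d, mv A d = T d := fun d => rfl
    simp only [hT]
    apply Asymptotics.IsLittleO.const_mul_left
    have h2 : (fun d => ‖T d‖ ^ 2) =O[nhds 0] fun d : EE n => ‖d‖ ^ 2 :=
      ((T.isBigO_id _).norm_norm.pow 2)
    refine h2.trans_isLittleO ?_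
    have := Asymptotics.isLittleO_norm_pow_id (E' := EE n) (n := 2) (by norm_num)
    exact this
  have hS := hD.add hQ
  have := (hasFDerivAt_iff_isLittleO.1 hS).def hε
  obtain ⟨η, hη, h⟩ := Metric.eventually_nhds_iff.1 this
  refine ⟨η, hη, fun x' hx' => ?_⟩
  have h3 := h (by rwa [dist_eq_norm])
  rw [Real.norm_eq_abs] at h3
  refine le_trans (le_of_eq ?_) h3
  congr 1
  simp only [Pi.add_apply, Function.comp_apply, Pi.mul_apply, add_sub_add_comm, ContinuousLinearMap.add_apply, ContinuousLinearMap.smul_apply,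
    innerSL_apply_apply, inner_add_left, inner_smul_left, inner_sub_left, smul_eq_mul, conj_trivial,
    nsmul_eq_mul, div_eq_mul_inv]
  push_cast
  ring

/-- Feasible pairs: `s` is a subgradient of the `ℓ¹` norm at `x`, in an annulus. -/
def Feas {n : ℕ} (ρ C : ℝ) (x s : EE n) : Prop :=
  ρ ≤ ‖x‖ ∧ ‖x‖ ≤ C ∧ (∀ i, |s i| ≤ 1) ∧ ∀ i, s i * x i = |x i|

abbrev Ix (n : ℕ) := Fin n ⊕ Fin n ⊕ Fin 3

/-- the embedding of feasible pairs together with value and slope -/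
def Gm {m n : ℕ} (A : Matrix (Fin m) (Fin n) ℝ) (b : EE m) (γ Fs : ℝ) (x s : EE n) : Ix n → ℝ :=
  Sum.elim (fun i => x i) (Sum.elim (fun i => s i)
    ![‖x‖, obj A b γ x - Fs, ‖sgr A b γ x s‖ ^ 2])

def KS {m n : ℕ} (A : Matrix (Fin m) (Fin n) ℝ) (b : EE m) (γ Fs ρ C : ℝ) : Set (Ix n → ℝ) :=
  {w | ∃ x s, Feas ρ C x s ∧ w = Gm A b γ Fs x s}

lemma KS_compact {m n : ℕ} (A : Matrix (Fin m) (Fin n) ℝ) (b : EE m) (γ Fs ρ C : ℝ)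
    (hρ : 0 < ρ) : IsCompact (KS A b γ Fs ρ C) := by
  have himg : KS A b γ Fs ρ C =
      (fun p : EE n × EE n => Gm A b γ Fs p.1 p.2) '' {p | Feas ρ C p.1 p.2} := by
    ext w
    constructor
    · rintro ⟨x, s, h, rfl⟩; exact ⟨(x, s), h, rfl⟩
    · rintro ⟨⟨x, s⟩, h, rfl⟩; exact ⟨x, s, h, rfl⟩
  rw [himg]
  have hcl : IsClosed {p : EE n × EE n | Feas ρ C p.1 p.2} := by
    have h1 : IsClosed {p : EE n × EE n | ρ ≤ ‖p.1‖} :=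
      isClosed_le continuous_const continuous_fst.norm
    have h2 : IsClosed {p : EE n × EE n | ‖p.1‖ ≤ C} :=
      isClosed_le continuous_fst.norm continuous_const
    have h3 : IsClosed {p : EE n × EE n | ∀ i, |p.2 i| ≤ 1} := by
      rw [Set.setOf_forall]
      exact isClosed_iInter fun i => isClosed_le (by fun_prop) continuous_const
    have h4 : IsClosed {p : EE n × EE n | ∀ i, p.2 i * p.1 i = |p.1 i|} := by
      rw [Set.setOf_forall]
      exact isClosed_iInter fun i => isClosed_eq (by fun_prop) (by fun_prop)
    exact h1.inter (h2.inter (h3.inter h4))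
  apply IsCompact.image_of_continuousOn
  · refine ((isCompact_closedBall (0 : EE n) C).prod
      (isCompact_closedBall (0 : EE n) n)).of_isClosed_subset hcl ?_
    rintro ⟨x, s⟩ ⟨h1, h2, h3, h4⟩
    refine ⟨by simpa using h2, ?_⟩
    simp only [mem_closedBall_zero_iff]
    refine (norm_le_l1 s).trans ((Finset.sum_le_sum fun i _ => h3 i).trans ?_)
    simp
  · have hne : ∀ p ∈ {p : EE n × EE n | Feas ρ C p.1 p.2}, ‖p.1‖ ≠ 0 := by
      intro p hp
      exact (hρ.trans_le hp.1).ne'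
    have hn : ContinuousOn (fun p : EE n × EE n => ‖p.1‖) {p | Feas ρ C p.1 p.2} :=
      continuous_fst.norm.continuousOn
    have hl : ContinuousOn (fun p : EE n × EE n => l1 p.1) {p | Feas ρ C p.1 p.2} :=
      (l1_continuous.comp continuous_fst).continuousOn
    have hobj : ContinuousOn (fun p : EE n × EE n => obj A b γ p.1) {p | Feas ρ C p.1 p.2} := by
      unfold obj
      exact (continuousOn_const.mul (hl.div hn hne)).add
        ((lsq_continuous A b).comp continuous_fst).continuousOn
    have hsgr : ContinuousOn (fun p : EE n × EE n => sgr A b γ p.1 p.2)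
        {p | Feas ρ C p.1 p.2} := by
      unfold sgr
      refine ContinuousOn.add (ContinuousOn.const_smul (ContinuousOn.sub
        ((hn.inv₀ hne).smul continuous_snd.continuousOn)
        ((hl.div (hn.pow 3) fun p hp => pow_ne_zero 3 (hne p hp)).smul
          continuous_fst.continuousOn)) γ)
        ((grd_continuous A b).comp continuous_fst).continuousOn
    rw [continuousOn_pi]
    rintro (i | i | i)
    · exact (show Continuous fun p : EE n × EE n => p.1 i by fun_prop).continuousOn
    · exact (show Continuous fun p : EE n × EE n => p.2 i by fun_prop).continuousOn
    · fin_cases i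
      · exact hn
      · exact hobj.sub continuousOn_const
      · exact hsgr.norm.pow 2

lemma KS_iff {m n : ℕ} (A : Matrix (Fin m) (Fin n) ℝ) (b : EE m) (γ Fs ρ C : ℝ)
    (hρ : 0 < ρ) (w : Ix n → ℝ) : w ∈ KS A b γ Fs ρ C ↔
    (w (Sum.inr (Sum.inr 0)) ^ 2 = ∑ i, w (Sum.inl i) ^ 2) ∧
    ρ ≤ w (Sum.inr (Sum.inr 0)) ∧ w (Sum.inr (Sum.inr 0)) ≤ C ∧
    (∀ i, -1 ≤ w (Sum.inr (Sum.inl i))) ∧ (∀ i, w (Sum.inr (Sum.inl i)) ≤ 1) ∧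
    (∀ i, 0 ≤ w (Sum.inr (Sum.inl i)) * w (Sum.inl i)) ∧
    (∀ i, (w (Sum.inr (Sum.inl i)) * w (Sum.inl i)) ^ 2 = w (Sum.inl i) ^ 2) ∧
    (γ * (∑ i, w (Sum.inr (Sum.inl i)) * w (Sum.inl i)) + w (Sum.inr (Sum.inr 0)) *
      (1 / 2 * ∑ j, ((∑ i, A j i * w (Sum.inl i)) - b j) ^ 2) =
      w (Sum.inr (Sum.inr 0)) * (Fs + w (Sum.inr (Sum.inr 1)))) ∧
    (w (Sum.inr (Sum.inr 0)) ^ 6 * w (Sum.inr (Sum.inr 2)) =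
      ∑ i, (γ * (w (Sum.inr (Sum.inr 0)) ^ 2 * w (Sum.inr (Sum.inl i)) -
        (∑ i, w (Sum.inr (Sum.inl i)) * w (Sum.inl i)) * w (Sum.inl i)) +
        w (Sum.inr (Sum.inr 0)) ^ 3 * ∑ j, A j i * ((∑ l, A j l * w (Sum.inl l)) - b j)) ^ 2) := by
  have key : ∀ x s : EE n, 0 < ‖x‖ → (∀ i, s i * x i = |x i|) →
      (γ * (∑ i, s i * x i) + ‖x‖ * (1 / 2 * ∑ j, ((∑ i, A j i * x i) - b j) ^ 2) =
        ‖x‖ * obj A b γ x) ∧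
      ∑ i, (γ * (‖x‖ ^ 2 * s i - (∑ i, s i * x i) * x i) +
        ‖x‖ ^ 3 * ∑ j, A j i * ((∑ l, A j l * x l) - b j)) ^ 2 =
        ‖x‖ ^ 6 * ‖sgr A b γ x s‖ ^ 2 := by
    intro x s hx hs
    have hl : ∑ i, s i * x i = l1 x := Finset.sum_congr rfl fun i _ => hs i
    rw [hl]
    constructor
    · unfold obj lsq
      rw [EuclideanSpace.real_norm_sq_eq (mv A x - b)]
      simp only [PiLp.sub_apply, mv_apply]
      field_simp
    · rw [EuclideanSpace.real_norm_sq_eq (sgr A b γ x s), Finset.mul_sum]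
      refine Finset.sum_congr rfl fun i _ => ?_
      have : (sgr A b γ x s) i = γ * (‖x‖⁻¹ * s i - l1 x / ‖x‖ ^ 3 * x i) +
          ∑ j, A j i * ((∑ l, A j l * x l) - b j) := by
        simp [sgr, grd, mv_apply]
      rw [this]
      field_simp
  constructor
  · rintro ⟨x, s, ⟨h1, h2, h3, h4⟩, rfl⟩
    have hx : 0 < ‖x‖ := hρ.trans_le h1
    obtain ⟨k1, k2⟩ := key x s hx h4
    simp only [Gm, Sum.elim_inl, Sum.elim_inr, Matrix.cons_val_zero, Matrix.cons_val_one,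
      Matrix.cons_val]
    refine ⟨EuclideanSpace.real_norm_sq_eq x, h1, h2, fun i => (abs_le.1 (h3 i)).1,
      fun i => (abs_le.1 (h3 i)).2, fun i => by rw [h4]; exact abs_nonneg _,
      fun i => by rw [h4, sq_abs], ?_, k2.symm⟩
    rw [k1]; ring
  · rintro ⟨h1, h2, h3, h4, h5, h6, h7, h8, h9⟩
    let x : EE n := WithLp.toLp 2 fun i => w (Sum.inl i)
    let s : EE n := WithLp.toLp 2 fun i => w (Sum.inr (Sum.inl i))
    have hr0 : 0 < w (Sum.inr (Sum.inr 0)) := hρ.trans_le h2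
    have hr : w (Sum.inr (Sum.inr 0)) = ‖x‖ := by
      have h : w (Sum.inr (Sum.inr 0)) ^ 2 = ‖x‖ ^ 2 := by
        rw [EuclideanSpace.real_norm_sq_eq]; exact h1
      exact (pow_left_inj₀ hr0.le (norm_nonneg x) (by norm_num)).1 h
    have hs : ∀ i, s i * x i = |x i| := fun i => by
      have a := h6 i
      have c := h7 i
      rw [sq_eq_sq_iff_abs_eq_abs, abs_of_nonneg a] at c
      exact c
    have hx : 0 < ‖x‖ := hr ▸ hr0
    obtain ⟨k1, k2⟩ := key x s hx hs
    rw [hr] at h2 h3 h8 h9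
    refine ⟨x, s, ⟨h2, h3, fun i => abs_le.2 ⟨h4 i, h5 i⟩, hs⟩, ?_⟩
    have e1 : w (Sum.inr (Sum.inr 1)) = obj A b γ x - Fs := by
      have := h8.symm.trans k1
      have := mul_left_cancel₀ hx.ne' this
      linarith
    have e2 : w (Sum.inr (Sum.inr 2)) = ‖sgr A b γ x s‖ ^ 2 :=
      mul_left_cancel₀ (pow_pos hx 6).ne' (h9.trans k2)
    funext k
    rcases k with i | i | i
    · rfl
    · rfl
    · fin_cases i
      · exact hr
      · exact e1
      · exact e2

lemma KS_sa {m n : ℕ} (A : Matrix (Fin m) (Fin n) ℝ) (b : EE m) (γ Fs ρ C : ℝ)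
    (hρ : 0 < ρ) : SA (fun w => w ∈ KS A b γ Fs ρ C) := by
  refine SA.congr ?_ fun w => (KS_iff A b γ Fs ρ C hρ w).symm
  have vx : ∀ i, PF (fun w : Ix n → ℝ => w (Sum.inl i)) := fun i => PF.var _
  have vs : ∀ i, PF (fun w : Ix n → ℝ => w (Sum.inr (Sum.inl i))) := fun i => PF.var _
  have vt : ∀ i, PF (fun w : Ix n → ℝ => w (Sum.inr (Sum.inr i))) := fun i => PF.var _
  have va : PF (fun w : Ix n → ℝ => ∑ i, w (Sum.inr (Sum.inl i)) * w (Sum.inl i)) :=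
    PF.sum fun i => (vs i).mul (vx i)
  have vr : ∀ j, PF (fun w : Ix n → ℝ => (∑ i, A j i * w (Sum.inl i)) - b j) := fun j =>
    (PF.sum fun i => (PF.const (A j i)).mul (vx i)).sub (PF.const _)
  refine SA.and (((vt 0).pow 2).eq (PF.sum fun i => (vx i).pow 2))
    (SA.and ((PF.const _).le (vt 0)) (SA.and ((vt 0).le (PF.const _))
    (SA.and (SA.all_fin fun i => (PF.const _).le (vs i))
    (SA.and (SA.all_fin fun i => (vs i).le (PF.const _))
    (SA.and (SA.all_fin fun i => (PF.const _).le ((vs i).mul (vx i)))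
    (SA.and (SA.all_fin fun i => (((vs i).mul (vx i)).pow 2).eq ((vx i).pow 2))
    (SA.and ?_ ?_)))))))
  · exact (((PF.const γ).mul va).add ((vt 0).mul ((PF.const (1 / 2)).mul
      (PF.sum fun j => (vr j).pow 2)))).eq ((vt 0).mul ((PF.const Fs).add (vt 1)))
  · exact (((vt 0).pow 6).mul (vt 2)).eq (PF.sum fun i =>
      (((PF.const γ).mul ((((vt 0).pow 2).mul (vs i)).sub (va.mul (vx i)))).add
        (((vt 0).pow 3).mul (PF.sum fun j => (PF.const (A j i)).mul (vr j)))).pow 2)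

/-! ### The Kurdyka-Lojasiewicz inequality -/

lemma slope_global {φ : ℝ → ℝ} {a b κ : ℝ} (hab : a ≤ b) (hκ : 0 < κ)
    (hmono : MonotoneOn φ (Set.Icc a b))
    (h : ∀ t ∈ Set.Ico a b, ∃ η > 0, ∀ t', t < t' → t' < t + η → t' ≤ b →
      κ * (t' - t) ≤ φ t' - φ t) : κ * (b - a) ≤ φ b - φ a := by
  set T := {c | c ∈ Set.Icc a b ∧ κ * (c - a) ≤ φ c - φ a} with hT
  have haT : a ∈ T := ⟨⟨le_rfl, hab⟩, by simp⟩
  have hbd : BddAbove T := ⟨b, fun c hc => hc.1.2⟩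
  set c := sSup T with hc
  have hac : a ≤ c := le_csSup hbd haT
  have hcb : c ≤ b := csSup_le ⟨a, haT⟩ fun c hc => hc.1.2
  have hcT : κ * (c - a) ≤ φ c - φ a := by
    have : c ≤ (φ c - φ a) / κ + a := by
      apply csSup_le ⟨a, haT⟩
      intro c' hc'
      have h1 : φ c' ≤ φ c := hmono hc'.1 ⟨hac, hcb⟩ (le_csSup hbd hc')
      rw [← sub_le_iff_le_add, le_div_iff₀ hκ]
      linarith [hc'.2]
    rw [← sub_le_iff_le_add, le_div_iff₀ hκ] at this
    linarith
  rcases hcb.eq_or_lt with h1 | h1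
  · rwa [← h1]
  exfalso
  obtain ⟨η, hη, h2⟩ := h c ⟨hac, h1⟩
  set t' := min b (c + η / 2) with ht'
  have ht1 : c < t' := lt_min h1 (by linarith)
  have ht2 : t' ≤ b := min_le_left _ _
  have ht3 : t' < c + η := (min_le_right _ _).trans_lt (by linarith)
  have h3 := h2 t' ht1 ht3 ht2
  have : t' ∈ T := ⟨⟨hac.trans ht1.le, ht2⟩, by nlinarith⟩
  exact absurd (le_csSup hbd this) (not_le.2 ht1)

lemma signed_diff {e : ℝ → ℝ} {δ : ℝ}
    (h : MonotoneOn e (Set.Ioo 0 δ) ∨ AntitoneOn e (Set.Ioo 0 δ)) :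
    ∃ ε : ℝ, |ε| ≤ 1 ∧ ∀ t ∈ Set.Ioo 0 δ, ∀ t' ∈ Set.Ioo 0 δ, t ≤ t' →
      |e t' - e t| = ε * (e t' - e t) := by
  rcases h with h | h
  · exact ⟨1, by simp, fun t ht t' ht' htt => by
      rw [one_mul, abs_of_nonneg (sub_nonneg.2 (h ht ht' htt))]⟩
  · exact ⟨-1, by simp, fun t ht t' ht' htt => by
      rw [abs_of_nonpos (sub_nonpos.2 (h ht ht' htt))]; ring⟩

theorem KL_ineq {m n : ℕ} (A : Matrix (Fin m) (Fin n) ℝ) (b : EE m) (γ Fs ρ C : ℝ)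
    (hρ : 0 < ρ) :
    ∃ δ > 0, ∃ M φ : ℝ → ℝ, (∀ t ∈ Set.Ioo 0 δ, 0 < M t) ∧ MonotoneOn M (Set.Ioo 0 δ) ∧
      (∃ B, ∀ t ∈ Set.Ioo 0 δ, |φ t| ≤ B) ∧
      (∀ t t', 0 < t → t < t' → t' < δ → t' - t ≤ M t' * (φ t' - φ t)) ∧
      ∀ x s : EE n, Feas ρ C x s → 0 < obj A b γ x - Fs → obj A b γ x - Fs < δ →
        M (obj A b γ x - Fs) ≤ ‖sgr A b γ x s‖ := by
  rcases curve_lemma (KS_compact A b γ Fs ρ C hρ) (KS_sa A b γ Fs ρ C hρ)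
    (Sum.inr (Sum.inr 1)) (Sum.inr (Sum.inr 2)) with ⟨δ, hδ, h⟩ | ⟨δ, hδ, c, hc, hmon⟩
  · refine ⟨δ, hδ, fun _ => 1, fun t => t, fun _ _ => one_pos, fun _ _ _ _ _ => le_rfl,
      ⟨δ, fun t ht => by rw [abs_of_pos ht.1]; exact ht.2.le⟩, fun t t' _ _ _ => by simp, ?_⟩
    intro x s hf h1 h2
    exact absurd ⟨h1, h2⟩ (h _ ⟨x, s, hf, rfl⟩)
  -- the curve
  have hex : ∀ t, ∃ p : EE n × EE n, t ∈ Set.Ioo 0 δ →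
      Feas ρ C p.1 p.2 ∧ c t = Gm A b γ Fs p.1 p.2 := by
    intro t
    by_cases ht : t ∈ Set.Ioo 0 δ
    · obtain ⟨x, s, h1, h2⟩ := (hc t ht).1
      exact ⟨(x, s), fun _ => ⟨h1, h2⟩⟩
    · exact ⟨0, fun h => absurd h ht⟩
  choose p hp using hex
  have hobj : ∀ t ∈ Set.Ioo 0 δ, obj A b γ (p t).1 = Fs + t := by
    intro t ht
    have h1 := (hc t ht).2.1
    rw [(hp t ht).2] at h1
    simp only [Gm, Sum.elim_inr, Matrix.cons_val_one, Matrix.cons_val_zero] at h1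
    linarith
  have hcx : ∀ t ∈ Set.Ioo 0 δ, ∀ i, c t (Sum.inl i) = (p t).1 i := by
    intro t ht i; rw [(hp t ht).2]; rfl
  have hcm : ∀ t ∈ Set.Ioo 0 δ, c t (Sum.inr (Sum.inr 2)) =
      ‖sgr A b γ (p t).1 (p t).2‖ ^ 2 := by
    intro t ht; rw [(hp t ht).2]; rfl
  -- signs
  have hsig : ∀ i : Fin n, ∃ σ : SignType, ∀ t ∈ Set.Ioo 0 δ,
      SignType.sign ((p t).1 i) = σ := by
    intro i
    obtain ⟨σ, h⟩ := (hmon (Sum.inl i)).2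
    exact ⟨σ, fun t ht => by rw [← hcx t ht]; exact h t ht⟩
  choose sg hsg using hsig
  let σ : EE n := WithLp.toLp 2 fun i => ((sg i : SignType) : ℝ)
  have hσ : ∀ i, σ i = ((sg i : SignType) : ℝ) := fun i => rfl
  have hσabs : ∀ t ∈ Set.Ioo 0 δ, ∀ i, σ i * (p t).1 i = |(p t).1 i| := by
    intro t ht i
    rw [hσ, ← hsg i t ht, sign_mul_self]
  have hσl1 : ∀ t ∈ Set.Ioo 0 δ, inner ℝ σ (p t).1 = l1 (p t).1 := by
    intro t ht
    rw [PiLp.inner_apply]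
    exact Finset.sum_congr rfl fun i _ => by
      rw [← hσabs t ht i]; simp [mul_comm]
  -- signed monotone sum
  have hε : ∀ i : Fin n, ∃ ε : ℝ, |ε| ≤ 1 ∧ ∀ t ∈ Set.Ioo 0 δ, ∀ t' ∈ Set.Ioo 0 δ, t ≤ t' →
      |(p t').1 i - (p t).1 i| = ε * ((p t').1 i - (p t).1 i) := by
    intro i
    obtain ⟨ε, h1, h2⟩ := signed_diff (hmon (Sum.inl i)).1
    refine ⟨ε, h1, fun t ht t' ht' htt => ?_⟩
    have := h2 t ht t' ht' htt
    simpa only [hcx t ht, hcx t' ht'] using this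
  choose ε hε1 hε2 using hε
  let φ : ℝ → ℝ := fun t => ∑ i, ε i * (p t).1 i
  have hφ : ∀ t ∈ Set.Ioo 0 δ, ∀ t' ∈ Set.Ioo 0 δ, t ≤ t' →
      φ t' - φ t = l1 ((p t').1 - (p t).1) := by
    intro t ht t' ht' htt
    simp only [φ, l1]
    rw [← Finset.sum_sub_distrib]
    refine Finset.sum_congr rfl fun i _ => ?_
    rw [PiLp.sub_apply, hε2 i t ht t' ht' htt]; ring
  have hφge : ∀ t ∈ Set.Ioo 0 δ, ∀ t' ∈ Set.Ioo 0 δ, t ≤ t' →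
      ‖(p t').1 - (p t).1‖ ≤ φ t' - φ t := by
    intro t ht t' ht' htt
    rw [hφ t ht t' ht' htt]; exact norm_le_l1 _
  have hφmono : MonotoneOn φ (Set.Ioo 0 δ) := fun t ht t' ht' htt => by
    have := hφge t ht t' ht' htt
    linarith [norm_nonneg ((p t').1 - (p t).1)]
  have hφbd : ∀ t ∈ Set.Ioo 0 δ, |φ t| ≤ n * C := by
    intro t ht
    refine (Finset.abs_sum_le_sum_abs _ _).trans ?_
    have : ∀ i ∈ Finset.univ, |ε i * (p t).1 i| ≤ C := by
      intro i _
      rw [abs_mul]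
      have h1 : |(p t).1 i| ≤ ‖(p t).1‖ := by
        simpa using PiLp.norm_apply_le (p t).1 i
      calc |ε i| * |(p t).1 i| ≤ 1 * |(p t).1 i| :=
            mul_le_mul_of_nonneg_right (hε1 i) (abs_nonneg _)
        _ ≤ C := by rw [one_mul]; exact h1.trans (hp t ht).1.2.1
    refine (Finset.sum_le_sum this).trans ?_
    simp
  -- slope
  let N : ℝ → ℝ := fun t => ‖sgr A b γ (p t).1 (p t).2‖
  have hN0 : ∀ t, 0 ≤ N t := fun t => norm_nonneg _
  have hslope : ∀ κ > 0, ∀ t ∈ Set.Ioo 0 δ, κ * N t < 1 → ∃ η > 0, ∀ t', t < t' → t' < t + η →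
      t' < δ → κ * (t' - t) ≤ φ t' - φ t := by
    intro κ hκ t ht hlt
    have hx0 : (p t).1 ≠ 0 := by
      intro h0
      have := (hp t ht).1.1
      rw [h0, norm_zero] at this
      linarith
    obtain ⟨η, hη, hexp⟩ := smooth_expand A b γ σ (p t).1 hx0 ((1 - κ * N t) / κ)
      (div_pos (by linarith) hκ)
    refine ⟨η / κ, div_pos hη hκ, fun t' ht1 ht2 ht3 => ?_⟩
    have ht' : t' ∈ Set.Ioo 0 δ := ⟨ht.1.trans ht1, ht3⟩
    have hge := hφge t ht t' ht' ht1.le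
    by_cases hfar : η ≤ ‖(p t').1 - (p t).1‖
    · have : κ * (t' - t) ≤ η := by
        have : t' - t ≤ η / κ := by linarith
        rw [le_div_iff₀ hκ] at this
        linarith
      linarith
    · have h1 := hexp (p t').1 (not_le.1 hfar)
      rw [hσl1 t ht, hσl1 t' ht'] at h1
      have e1 := hobj t ht
      have e2 := hobj t' ht'
      unfold obj at e1 e2
      rw [e1, e2] at h1
      have hin : inner ℝ (γ • (‖(p t).1‖⁻¹ • σ - (l1 (p t).1 / ‖(p t).1‖ ^ 3) • (p t).1) +
          grd A b (p t).1) ((p t').1 - (p t).1) =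
          inner ℝ (sgr A b γ (p t).1 (p t).2) ((p t').1 - (p t).1) := by
        rw [PiLp.inner_apply, PiLp.inner_apply]
        refine Finset.sum_congr rfl fun i _ => ?_
        by_cases hz : (p t).1 i = 0
        · have hz' : (p t').1 i = 0 := by
            apply zero_of_sign_eq ((hsg i t ht).trans (hsg i t' ht').symm) hz
          simp [hz, hz']
        · have : σ i = (p t).2 i := by
            have a1 := hσabs t ht i
            have a2 := (hp t ht).1.2.2.2 i
            exact mul_right_cancel₀ hz (a1.trans a2.symm)
          simp [sgr, this]
      rw [hin] at h1
      have h2 : inner ℝ (sgr A b γ (p t).1 (p t).2) ((p t').1 - (p t).1) ≤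
          N t * ‖(p t').1 - (p t).1‖ := real_inner_le_norm _ _
      have h3 := (abs_le.1 h1).2
      have h4 : t' - t ≤ (N t + (1 - κ * N t) / κ) * ‖(p t').1 - (p t).1‖ := by linarith
      have h5 : N t + (1 - κ * N t) / κ = 1 / κ := by field_simp; ring
      rw [h5, div_mul_eq_mul_div, one_mul, le_div_iff₀ hκ] at h4
      linarith
  have hglob : ∀ κ > 0, ∀ t t', 0 < t → t ≤ t' → t' < δ →
      (∀ u, t ≤ u → u < t' → κ * N u < 1) → κ * (t' - t) ≤ φ t' - φ t := by
    intro κ hκ t t' h0 h1 h2 h3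
    refine slope_global h1 hκ (hφmono.mono fun u hu => ⟨h0.trans_le hu.1, hu.2.trans_lt h2⟩) ?_
    intro u hu
    obtain ⟨η, hη, h4⟩ := hslope κ hκ u ⟨h0.trans_le hu.1, hu.2.trans h2⟩ (h3 u hu.1 hu.2)
    exact ⟨η, hη, fun u' a1 a2 a3 => h4 u' a1 a2 (a3.trans_lt h2)⟩
  -- positivity of N
  have hNpos : ∀ t ∈ Set.Ioo 0 δ, 0 < N t := by
    obtain ⟨τ, hτ⟩ := (hmon (Sum.inr (Sum.inr 2))).2
    have hz : ∀ t ∈ Set.Ioo 0 δ, N t = 0 → ∀ u ∈ Set.Ioo 0 δ, N u = 0 := by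
      intro t ht h u hu
      have a1 := (hτ t ht).trans (hτ u hu).symm
      rw [hcm t ht, hcm u hu] at a1
      have a2 : N u ^ 2 = 0 := zero_of_sign_eq a1 (by change N t ^ 2 = 0; rw [h]; norm_num)
      exact pow_eq_zero_iff (by norm_num) |>.1 a2
    intro t ht
    rcases (hN0 t).lt_or_eq with h | h
    · exact h
    exfalso
    have hall := hz t ht h.symm
    have h1 := hglob ((φ (2 * δ / 3) - φ (δ / 3) + 1) / (δ / 3)) (by
      have := hφmono (a := δ / 3) (b := 2 * δ / 3) ⟨by linarith, by linarith⟩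
        ⟨by linarith, by linarith⟩ (by linarith)
      apply div_pos <;> linarith) (δ / 3) (2 * δ / 3) (by linarith) (by linarith) (by linarith)
      (fun u hu1 hu2 => by rw [hall u ⟨by linarith, by linarith⟩]; simp)
    rw [show 2 * δ / 3 - δ / 3 = δ / 3 by ring, div_mul_cancel₀ _ (by positivity)] at h1
    linarith
  have hmin : ∀ x s : EE n, Feas ρ C x s → 0 < obj A b γ x - Fs → obj A b γ x - Fs < δ →
      N (obj A b γ x - Fs) ≤ ‖sgr A b γ x s‖ := by
    intro x s hf h1 h2
    have h3 := (hc _ ⟨h1, h2⟩).2.2 _ ⟨x, s, hf, rfl⟩ rfl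
    rw [hcm _ ⟨h1, h2⟩] at h3
    exact (pow_le_pow_iff_left₀ (norm_nonneg _) (norm_nonneg _) (by norm_num)).1 h3
  rcases (hmon (Sum.inr (Sum.inr 2))).1 with hm | hm
  · have hNm : MonotoneOn N (Set.Ioo 0 δ) := by
      intro t ht t' ht' htt
      have := hm ht ht' htt
      simp only [hcm t ht, hcm t' ht'] at this
      exact (pow_le_pow_iff_left₀ (norm_nonneg _) (norm_nonneg _) (by norm_num)).1 this
    refine ⟨δ, hδ, N, φ, hNpos, hNm, ⟨_, hφbd⟩, ?_, hmin⟩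
    intro t t' h0 h1 h2
    have ht' : t' ∈ Set.Ioo 0 δ := ⟨h0.trans h1, h2⟩
    have hpos := hNpos t' ht'
    have hk : ∀ κ, κ < 1 / N t' → κ * (t' - t) ≤ φ t' - φ t := by
      intro κ hκ
      rcases le_or_gt κ 0 with hk0 | hk0
      · have := hφmono ⟨h0, h1.trans h2⟩ ht' h1.le
        nlinarith
      · refine hglob κ hk0 t t' h0 h1.le h2 fun u hu1 hu2 => ?_
        have := hNm ⟨h0.trans_le hu1, hu2.trans h2⟩ ht' hu2.le
        rw [lt_div_iff₀ hpos] at hκ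
        nlinarith
    have : 1 / N t' * (t' - t) ≤ φ t' - φ t := by
      have h6 : 1 / N t' ≤ (φ t' - φ t) / (t' - t) :=
        le_of_forall_lt fun κ hκ => by
          obtain ⟨κ', h7, h8⟩ := exists_between hκ
          exact h7.trans_le ((le_div_iff₀ (by linarith)).2 (hk κ' h8))
      exact (le_div_iff₀ (by linarith)).1 h6
    rw [div_mul_eq_mul_div, one_mul, div_le_iff₀ hpos] at this
    linarith
  · have hNm : AntitoneOn N (Set.Ioo 0 δ) := by
      intro t ht t' ht' htt
      have := hm ht ht' htt
      simp only [hcm t ht, hcm t' ht'] at this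
      exact (pow_le_pow_iff_left₀ (norm_nonneg _) (norm_nonneg _) (by norm_num)).1 this
    have hcpos := hNpos (δ / 2) ⟨by linarith, by linarith⟩
    refine ⟨δ / 2, by linarith, fun _ => N (δ / 2), fun t => t / N (δ / 2), fun _ _ => hcpos,
      fun _ _ _ _ _ => le_rfl, ⟨δ / N (δ / 2), fun t ht => ?_⟩, ?_, ?_⟩
    · rw [abs_of_nonneg (div_nonneg ht.1.le hcpos.le)]
      exact div_le_div_of_nonneg_right (by linarith [ht.2]) hcpos.le
    · intro t t' _ _ _
      rw [← sub_div, mul_div_cancel₀ _ hcpos.ne']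
    · intro x s hf h1 h2
      exact (hNm ⟨h1, by linarith⟩ ⟨by linarith, by linarith⟩ h2.le).trans
        (hmin x s hf h1 (by linarith))

/-! ### Real sequences -/

lemma summable_kl (d v : ℕ → ℝ) (β C1 δ : ℝ) (hβ : 0 < β) (hC1 : 0 < C1) (M φ : ℝ → ℝ)
    (hM : ∀ t ∈ Set.Ioo 0 δ, 0 < M t)
    (hB : ∃ B, ∀ t ∈ Set.Ioo 0 δ, |φ t| ≤ B)
    (hφ : ∀ t t', 0 < t → t < t' → t' < δ → t' - t ≤ M t' * (φ t' - φ t))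
    (hd : ∀ k, 0 ≤ d k) (hv : ∀ k, 0 < v k) (hvδ : ∀ k, v k < δ)
    (hdec : ∀ k, β / 4 * d k ^ 2 ≤ v k - v (k + 1))
    (hkl : ∀ k, M (v (k + 1) / 2) ≤ C1 * d k ∨ √(v (k + 1)) ≤ C1 * d k) : Summable d := by
  obtain ⟨B, hB⟩ := hB
  let P : ℝ → ℝ := fun t => 2 * φ (t / 2) + 2 * √t
  have hanti : ∀ k, v (k + 1) ≤ v k := fun k => by
    have := hdec k
    nlinarith [mul_nonneg (show 0 ≤ β / 4 by positivity) (sq_nonneg (d k))]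
  have hstep : ∀ k, d (k + 1) ≤ (d k + 4 * C1 / β * P (v (k + 1))) -
      (d (k + 1) + 4 * C1 / β * P (v (k + 2))) := by
    intro k
    have hv1 := hv (k + 1)
    have hv2 := hv (k + 2)
    have h12 := hanti (k + 1)
    have hmem : v (k + 1) / 2 ∈ Set.Ioo 0 δ := ⟨by linarith, by linarith [hvδ (k + 1)]⟩
    have hMpos := hM _ hmem
    have h1 : v (k + 1) / 2 - v (k + 2) / 2 ≤ M (v (k + 1) / 2) *
        (φ (v (k + 1) / 2) - φ (v (k + 2) / 2)) := by
      rcases h12.eq_or_lt with h | h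
      · rw [show v (k + 2) = v (k + 1) from h]; simp
      · exact hφ _ _ (by linarith) (by linarith [show v (k + 2) < v (k + 1) from h]) hmem.2
    have h1' : 0 ≤ φ (v (k + 1) / 2) - φ (v (k + 2) / 2) := by
      by_contra hneg
      have : 0 ≤ v (k + 1) / 2 - v (k + 2) / 2 := by linarith [show v (k + 2) ≤ v (k + 1) from h12]
      nlinarith
    have hs : √(v (k + 2)) ≤ √(v (k + 1)) := Real.sqrt_le_sqrt h12
    have hs1 := Real.sq_sqrt hv1.le
    have hs2 := Real.sq_sqrt hv2.le
    have hn1 := Real.sqrt_nonneg (v (k + 1))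
    have hn2 := Real.sqrt_nonneg (v (k + 2))
    set Δ := P (v (k + 1)) - P (v (k + 2)) with hΔ
    have hΔe : Δ = 2 * (φ (v (k + 1) / 2) - φ (v (k + 2) / 2)) +
        2 * (√(v (k + 1)) - √(v (k + 2))) := by simp only [hΔ, P]; ring
    have hΔ0 : 0 ≤ Δ := by rw [hΔe]; linarith
    have hmain : v (k + 1) - v (k + 2) ≤ C1 * d k * Δ := by
      rcases hkl k with h | h
      · have : v (k + 1) - v (k + 2) ≤ M (v (k + 1) / 2) * Δ := by
          rw [hΔe]
          nlinarith
        exact this.trans (mul_le_mul_of_nonneg_right h hΔ0)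
      · have : v (k + 1) - v (k + 2) ≤ √(v (k + 1)) * Δ := by
          rw [hΔe]
          nlinarith [mul_nonneg hn1 h1']
        exact this.trans (mul_le_mul_of_nonneg_right h hΔ0)
    have h2 := (hdec (k + 1)).trans hmain
    have h3 : d (k + 1) ^ 2 ≤ d k * (4 * C1 / β * Δ) := by
      have : d k * (4 * C1 / β * Δ) = C1 * d k * Δ / (β / 4) := by field_simp
      rw [this, le_div_iff₀ (by positivity)]
      linarith
    have h4 : 0 ≤ 4 * C1 / β * Δ := by positivity
    have h5 : 2 * d (k + 1) ≤ d k + 4 * C1 / β * Δ := by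
      nlinarith [sq_nonneg (d k - 4 * C1 / β * Δ), hd (k + 1), hd k]
    have : 4 * C1 / β * Δ = 4 * C1 / β * P (v (k + 1)) - 4 * C1 / β * P (v (k + 2)) := by
      rw [hΔ]; ring
    linarith
  have hbd : ∀ k, -(2 * B) ≤ P (v k) := by
    intro k
    have := (abs_le.1 (hB (v k / 2) ⟨by linarith [hv k], by linarith [hvδ k, hv k]⟩)).1
    have := Real.sqrt_nonneg (v k)
    simp only [P]
    linarith
  rw [← summable_nat_add_iff 1]
  refine summable_of_sum_range_le (c := (d 0 + 4 * C1 / β * P (v 1)) + 4 * C1 / β * (2 * B))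
    (fun k => hd _) fun N => ?_
  have hsum : ∀ N, ∑ k ∈ Finset.range N, d (k + 1) ≤ (d 0 + 4 * C1 / β * P (v 1)) -
      (d N + 4 * C1 / β * P (v (N + 1))) := by
    intro N
    induction N with
    | zero => simp
    | succ N ih =>
      rw [Finset.sum_range_succ]
      have := hstep N
      linarith
  have h6 : 4 * C1 / β * -(2 * B) ≤ 4 * C1 / β * P (v (N + 1)) :=
    mul_le_mul_of_nonneg_left (hbd _) (by positivity)
  linarith [hsum N, hd N]

/-! ### Optimality conditions -/

lemma quad_stat {n : ℕ} (v : EE n) (K : ℝ) (hK : 0 < K)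
    (h : ∀ d : EE n, 0 ≤ inner ℝ v d + K * ‖d‖ ^ 2) : v = 0 := by
  have := h (-(1 / (2 * K)) • v)
  rw [inner_smul_right, real_inner_self_eq_norm_sq, norm_smul, mul_pow, Real.norm_eq_abs,
    sq_abs] at this
  have e : -(1 / (2 * K)) * ‖v‖ ^ 2 + K * ((-(1 / (2 * K))) ^ 2 * ‖v‖ ^ 2) =
      -(‖v‖ ^ 2 / (4 * K)) := by field_simp; ring
  rw [e] at this
  have h2 : ‖v‖ ^ 2 / (4 * K) ≤ 0 := by linarith
  rw [div_le_iff₀ (by positivity), zero_mul] at h2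
  have : ‖v‖ ^ 2 = 0 := le_antisymm h2 (sq_nonneg _)
  simpa using this

lemma ratio_of_ne {n : ℕ} {x : EE n} (hx : x ≠ 0) : ratio x = l1 x / ‖x‖ := if_neg hx

lemma one_le_ratio {n : ℕ} (x : EE n) : 1 ≤ ratio x := by
  by_cases hx : x = 0
  · simp [ratio, hx]
  · rw [ratio_of_ne hx, le_div_iff₀ (norm_pos_iff.2 hx), one_mul]
    exact norm_le_l1 x

lemma x_dir {n : ℕ} (γ β : ℝ) (x w σ : EE n) (hx : x ≠ 0)
    (hopt : ∀ u : EE n, γ * ratio x + β / 2 * ‖x - w‖ ^ 2 ≤ γ * ratio u + β / 2 * ‖u - w‖ ^ 2)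
    (hσ : inner ℝ σ x = l1 x) (e : EE n) (he : ‖e‖ = 1)
    (hev : ∀ᶠ t in nhdsWithin (0 : ℝ) (Set.Ioi 0), l1 (x + t • e) = inner ℝ σ (x + t • e)) :
    0 ≤ inner ℝ (γ • (‖x‖⁻¹ • σ - (l1 x / ‖x‖ ^ 3) • x) + β • (x - w)) e := by
  set q := inner ℝ (γ • (‖x‖⁻¹ • σ - (l1 x / ‖x‖ ^ 3) • x) + β • (x - w)) e with hq
  have key : ∀ ε > 0, 0 ≤ q + ε := by
    intro ε hε
    obtain ⟨η, hη, hexp⟩ := smooth_expand (0 : Matrix (Fin 0) (Fin n) ℝ) 0 γ σ x hx (ε / 2)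
      (by linarith)
    have hr : 0 < ‖x‖ := norm_pos_iff.2 hx
    have h1 : ∀ᶠ t in nhdsWithin (0 : ℝ) (Set.Ioi 0), t < min (min η ‖x‖) (ε / (|β| + 1)) :=
      nhdsWithin_le_nhds (Iio_mem_nhds (by positivity))
    obtain ⟨t, ht1, ht2, ht0⟩ := (hev.and (h1.and self_mem_nhdsWithin)).exists
    have ht0 : 0 < t := ht0
    have hn : ‖t • e‖ = t := by rw [norm_smul, he, mul_one, Real.norm_eq_abs, abs_of_pos ht0]
    have hta : t < η := ht2.trans_le ((min_le_left _ _).trans (min_le_left _ _))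
    have htb : t < ‖x‖ := ht2.trans_le ((min_le_left _ _).trans (min_le_right _ _))
    have htc : t < ε / (|β| + 1) := ht2.trans_le (min_le_right _ _)
    have hne : x + t • e ≠ 0 := by
      intro h0
      have : x = -(t • e) := eq_neg_of_add_eq_zero_left h0
      rw [this, norm_neg, hn] at htb
      exact lt_irrefl _ htb
    have h2 := hexp (x + t • e) (by rw [add_sub_cancel_left, hn]; exact hta)
    rw [add_sub_cancel_left, hn, hσ, ← ht1] at h2
    have h3 := hopt (x + t • e)
    rw [ratio_of_ne hne, ratio_of_ne hx, show x + t • e - w = (x - w) + t • e by abel,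
      norm_add_sq_real, hn, inner_smul_right] at h3
    have hz : ∀ y : EE n, lsq (0 : Matrix (Fin 0) (Fin n) ℝ) 0 y = 0 := by
      intro y
      have : mv (0 : Matrix (Fin 0) (Fin n) ℝ) y - 0 = 0 := Subsingleton.elim _ _
      simp only [lsq, this]; simp
    have hz2 : grd (0 : Matrix (Fin 0) (Fin n) ℝ) 0 x = 0 := by
      ext i; simp [grd, mv_apply]
    rw [hz, hz, hz2, add_zero, add_zero, add_zero, inner_smul_right] at h2
    have h4 := (abs_le.1 h2).2
    have hq2 : q = inner ℝ (γ • (‖x‖⁻¹ • σ - (l1 x / ‖x‖ ^ 3) • x)) e + β * inner ℝ (x - w) e := by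
      rw [hq, inner_add_left, inner_smul_left _ _ β]; rfl
    have h5 : β * t ≤ ε := by
      have : t * (|β| + 1) < ε := (lt_div_iff₀ (by positivity)).1 htc
      nlinarith [le_abs_self β]
    have h6 : 0 ≤ t * (q + ε) := by
      rw [hq2]
      nlinarith
    exact nonneg_of_mul_nonneg_right h6 ht0
  exact le_of_forall_pos_le_add fun ε hε => by simpa using key ε hε

lemma l1_single {n : ℕ} (x : EE n) (i : Fin n) (t : ℝ) :
    l1 (x + t • EuclideanSpace.single i 1) = l1 x + (|x i + t| - |x i|) := by
  unfold l1
  rw [← Finset.add_sum_erase Finset.univ (fun j => |(x + t • EuclideanSpace.single i (1 : ℝ)) j|)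
      (Finset.mem_univ i), ← Finset.add_sum_erase Finset.univ (fun j => |x j|) (Finset.mem_univ i)]
  have : ∀ j ∈ Finset.univ.erase i, |(x + t • EuclideanSpace.single i (1 : ℝ)) j| = |x j| := by
    intro j hj
    have : j ≠ i := Finset.ne_of_mem_erase hj
    simp [this]
  rw [Finset.sum_congr rfl this]
  simp
  ring

lemma x_opt {n : ℕ} (γ β : ℝ) (hγ : 0 < γ) (x w : EE n) (hx : x ≠ 0)
    (hopt : ∀ u : EE n, γ * ratio x + β / 2 * ‖x - w‖ ^ 2 ≤ γ * ratio u + β / 2 * ‖u - w‖ ^ 2) :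
    ∃ s : EE n, (∀ i, |s i| ≤ 1) ∧ (∀ i, s i * x i = |x i|) ∧
      γ • (‖x‖⁻¹ • s - (l1 x / ‖x‖ ^ 3) • x) + β • (x - w) = 0 := by
  have hr : 0 < ‖x‖ := norm_pos_iff.2 hx
  -- the directional inequality in coordinates
  have hdir : ∀ (i : Fin n) (c θ : ℝ), c * x i = |x i| → |θ| = 1 →
      (∀ᶠ t in nhdsWithin (0 : ℝ) (Set.Ioi 0), |x i + t * θ| = c * (x i + t * θ)) →
      0 ≤ θ * (γ * (‖x‖⁻¹ * c - l1 x / ‖x‖ ^ 3 * x i) + β * (x i - w i)) := by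
    intro i c θ hc hθ hev
    let σ : EE n := WithLp.toLp 2 fun j => if j = i then c else ((SignType.sign (x j) : SignType) : ℝ)
    have hσ1 : ∀ j, σ j * x j = |x j| := by
      intro j
      by_cases hj : j = i
      · subst hj; simpa [σ] using hc
      · simp [σ, hj, sign_mul_self]
    have hσi : σ i = c := by simp [σ]
    have hσx : inner ℝ σ x = l1 x := by
      rw [PiLp.inner_apply]
      exact Finset.sum_congr rfl fun i _ => by rw [← hσ1 i]; simp [mul_comm]
    have := x_dir γ β x w σ hx hopt hσx (θ • EuclideanSpace.single i 1)
      (by rw [norm_smul, Real.norm_eq_abs, hθ]; simp) (by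
        filter_upwards [hev] with t ht
        rw [smul_smul, l1_single, inner_add_right, hσx, inner_smul_right, ht, ← hc,
          EuclideanSpace.inner_single_right, hσi]
        simp
        ring)
    rw [inner_smul_right, EuclideanSpace.inner_single_right] at this
    simpa [hσi] using this
  let s : EE n := (‖x‖ / γ) • (β • (w - x) + (γ * (l1 x / ‖x‖ ^ 3)) • x)
  have hs : ∀ i, s i = ‖x‖ / γ * (β * (w i - x i) + γ * (l1 x / ‖x‖ ^ 3) * x i) := by
    intro i; simp [s]; ring
  have hnz : ∀ i, x i ≠ 0 → ∀ c : ℝ, c = ((SignType.sign (x i) : SignType) : ℝ) → s i = c := by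
    intro i hi c hc
    have hcx : c * x i = |x i| := by rw [hc, sign_mul_self]
    have hev : ∀ θ : ℝ, ∀ᶠ t in nhdsWithin (0 : ℝ) (Set.Ioi 0),
        |x i + t * θ| = c * (x i + t * θ) := by
      intro θ
      have hct : Filter.Tendsto (fun t : ℝ => x i + t * θ) (nhdsWithin (0 : ℝ) (Set.Ioi 0))
          (nhds (x i)) := by
        have : Continuous fun t : ℝ => x i + t * θ := by fun_prop
        have := this.tendsto 0
        simp only [zero_mul, add_zero] at this
        exact this.mono_left nhdsWithin_le_nhds
      rcases lt_or_gt_of_ne hi with h | h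
      · filter_upwards [hct.eventually (Iio_mem_nhds h)] with t ht
        have ht : x i + t * θ < 0 := ht
        rw [hc, sign_neg h, abs_of_neg ht]; simp
      · filter_upwards [hct.eventually (Ioi_mem_nhds h)] with t ht
        have ht : 0 < x i + t * θ := ht
        rw [hc, sign_pos h, abs_of_pos ht]; simp
    have h1 := hdir i c 1 hcx (by simp) (hev 1)
    have h2 := hdir i c (-1) hcx (by simp) (hev (-1))
    have h3 : γ * (‖x‖⁻¹ * c - l1 x / ‖x‖ ^ 3 * x i) + β * (x i - w i) = 0 := by linarith
    rw [hs]
    have h4 : β * (w i - x i) + γ * (l1 x / ‖x‖ ^ 3) * x i = γ * (‖x‖⁻¹ * c) := by linarith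
    rw [h4]
    field_simp
  refine ⟨s, fun i => ?_, fun i => ?_, ?_⟩
  · by_cases hi : x i = 0
    · have h1 := hdir i 1 1 (by simp [hi]) (by simp) (by
        filter_upwards [self_mem_nhdsWithin] with t ht
        have ht : 0 < t := ht
        rw [hi, zero_add, mul_one, one_mul, abs_of_pos ht])
      have h2 := hdir i (-1) (-1) (by simp [hi]) (by simp) (by
        filter_upwards [self_mem_nhdsWithin] with t ht
        have ht : 0 < t := ht
        rw [hi, zero_add, mul_neg_one, abs_neg, abs_of_pos ht]; ring)
      rw [hs, hi]
      rw [hi] at h1 h2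
      have e : ‖x‖ / γ * (β * (w i - 0) + γ * (l1 x / ‖x‖ ^ 3) * 0) = (β * w i) / (γ * ‖x‖⁻¹) := by
        field_simp; ring
      rw [e, abs_div, div_le_one (by positivity), abs_of_pos (show 0 < γ * ‖x‖⁻¹ by positivity),
        abs_le]
      constructor <;> linarith
    · rw [hnz i hi _ rfl]
      rcases lt_or_gt_of_ne hi with h | h
      · rw [sign_neg h]; simp
      · rw [sign_pos h]; simp
  · by_cases hi : x i = 0
    · simp [hi]
    · rw [hnz i hi _ rfl, sign_mul_self]
  · ext i
    simp only [PiLp.add_apply, PiLp.smul_apply, PiLp.sub_apply, smul_eq_mul, hs, PiLp.zero_apply]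
    field_simp
    ring

/-! ### ADMM steps -/

lemma grd_sub {m n : ℕ} (A : Matrix (Fin m) (Fin n) ℝ) (b : EE m) (x y : EE n) :
    grd A b x - grd A b y = mv A.transpose (mv A (x - y)) := by
  unfold grd
  rw [← mv_sub, mv_sub A]
  congr 1
  abel

lemma mv_sq_le {m n : ℕ} (A : Matrix (Fin m) (Fin n) ℝ) (b : EE m) (L : ℝ)
    (hL : ∀ x y, ‖grd A b x - grd A b y‖ ≤ L * ‖x - y‖) (d : EE n) :
    ‖mv A d‖ ^ 2 ≤ L * ‖d‖ ^ 2 := by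
  have h1 : ‖mv A d‖ ^ 2 = inner ℝ d (grd A b d - grd A b 0) := by
    rw [← real_inner_self_eq_norm_sq, mv_inner, grd_sub, sub_zero]
  have h2 := real_inner_le_norm d (grd A b d - grd A b 0)
  have h3 := hL d 0
  rw [sub_zero] at h3
  rw [h1]
  calc _ ≤ _ := h2
    _ ≤ ‖d‖ * (L * ‖d‖) := mul_le_mul_of_nonneg_left h3 (norm_nonneg _)
    _ = _ := by ring

/-- merit function (augmented Lagrangian with the multiplier eliminated) -/
def psi {m n : ℕ} (A : Matrix (Fin m) (Fin n) ℝ) (b : EE m) (γ β : ℝ) (x y : EE n) : ℝ :=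
  γ * ratio x + lsq A b y + inner ℝ (grd A b y) (x - y) + β / 2 * ‖x - y‖ ^ 2

lemma prox_expand {n : ℕ} (β : ℝ) (hβ : 0 < β) (u y g : EE n) :
    β / 2 * ‖u - (y - β⁻¹ • g)‖ ^ 2 =
      β / 2 * ‖u - y‖ ^ 2 + inner ℝ g (u - y) + β / 2 * ‖β⁻¹ • g‖ ^ 2 := by
  rw [show u - (y - β⁻¹ • g) = (u - y) + β⁻¹ • g by abel, norm_add_sq_real, inner_smul_right,
    real_inner_comm]
  field_simp

lemma half_step {m n : ℕ} (A : Matrix (Fin m) (Fin n) ℝ) (b : EE m) (L β : ℝ)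
    (hL : ∀ x y, ‖grd A b x - grd A b y‖ ≤ L * ‖x - y‖) (hβ : 2 * L < β) (hβ0 : 0 < β)
    (x' y y' : EE n) (hz : grd A b y' = grd A b y + β • (x' - y')) :
    ‖x' - y'‖ ≤ ‖y' - y‖ / 2 := by
  have h1 : β • (x' - y') = grd A b y' - grd A b y := by rw [hz]; abel
  have h2 : β * ‖x' - y'‖ ≤ L * ‖y' - y‖ := by
    have := hL y' y
    rw [← h1, norm_smul, Real.norm_of_nonneg hβ0.le] at this
    exact this
  have h3 : L * ‖y' - y‖ ≤ β / 2 * ‖y' - y‖ :=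
    mul_le_mul_of_nonneg_right (by linarith) (norm_nonneg _)
  refine le_of_mul_le_mul_left ?_ hβ0
  linarith

lemma psi_descent {m n : ℕ} (A : Matrix (Fin m) (Fin n) ℝ) (b : EE m) (L γ β : ℝ)
    (hL : ∀ x y, ‖grd A b x - grd A b y‖ ≤ L * ‖x - y‖) (hβ : 2 * L < β) (hβ0 : 0 < β)
    (x x' y y' : EE n)
    (hopt : γ * ratio x' + β / 2 * ‖x' - (y - β⁻¹ • grd A b y)‖ ^ 2 ≤
      γ * ratio x + β / 2 * ‖x - (y - β⁻¹ • grd A b y)‖ ^ 2)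
    (hz : grd A b y' = grd A b y + β • (x' - y')) :
    β / 4 * ‖y' - y‖ ^ 2 ≤ psi A b γ β x y - psi A b γ β x' y' := by
  have hu := half_step A b L β hL hβ hβ0 x' y y' hz
  rw [prox_expand β hβ0, prox_expand β hβ0] at hopt
  have h1 : β • (x' - y') = grd A b y' - grd A b y := by rw [hz]; abel
  have h2 : β * inner ℝ (x' - y') (y' - y) = ‖mv A (y' - y)‖ ^ 2 := by
    have : β * inner ℝ (x' - y') (y' - y) = inner ℝ (β • (x' - y')) (y' - y) := by
      rw [inner_smul_left]; rfl
    rw [this, h1, grd_sub, real_inner_comm, ← mv_inner, real_inner_self_eq_norm_sq]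
  have h3 := lsq_expand A b y (y' - y)
  rw [add_sub_cancel] at h3
  have h4 : inner ℝ (grd A b y) (x' - y) =
      inner ℝ (grd A b y) (x' - y') + inner ℝ (grd A b y) (y' - y) := by
    rw [← inner_add_right]; congr 1; abel
  have h5 : ‖x' - y‖ ^ 2 = ‖x' - y'‖ ^ 2 + 2 * inner ℝ (x' - y') (y' - y) + ‖y' - y‖ ^ 2 := by
    rw [← norm_add_sq_real]; congr 2; abel
  have h6 : inner ℝ (grd A b y') (x' - y') =
      inner ℝ (grd A b y) (x' - y') + β * ‖x' - y'‖ ^ 2 := by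
    rw [hz, inner_add_left, inner_smul_left, real_inner_self_eq_norm_sq]; rfl
  have h7 : ‖x' - y'‖ ^ 2 ≤ ‖y' - y‖ ^ 2 / 4 := by
    nlinarith [norm_nonneg (x' - y')]
  unfold psi
  rw [h3, h6]
  rw [h4, h5] at hopt
  nlinarith [sq_nonneg ‖mv A (y' - y)‖]

lemma psi_bounds {m n : ℕ} (A : Matrix (Fin m) (Fin n) ℝ) (b : EE m) (L γ β : ℝ)
    (hL : ∀ x y, ‖grd A b x - grd A b y‖ ≤ L * ‖x - y‖) (hβ : 2 * L < β) (hβ0 : 0 < β)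
    (x y : EE n) :
    γ * ratio x + lsq A b x ≤ psi A b γ β x y ∧
      psi A b γ β x y ≤ γ * ratio x + lsq A b x + β / 2 * ‖x - y‖ ^ 2 := by
  have h3 := lsq_expand A b y (x - y)
  rw [add_sub_cancel] at h3
  have h4 := mv_sq_le A b L hL (x - y)
  have h5 : L * ‖x - y‖ ^ 2 ≤ β * ‖x - y‖ ^ 2 :=
    mul_le_mul_of_nonneg_right (by nlinarith) (sq_nonneg _)
  unfold psi
  constructor <;> nlinarith [sq_nonneg ‖mv A (x - y)‖]

lemma x_lower {m n : ℕ} (A : Matrix (Fin m) (Fin n) ℝ) (b : EE m) (L γ β : ℝ) (hγ : 0 < γ)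
    (hL : ∀ x y, ‖grd A b x - grd A b y‖ ≤ L * ‖x - y‖) (hβ : 2 * L < β) (hβ0 : 0 < β)
    (hAb : grd A b 0 ≠ 0) :
    ∃ G > 0, ∀ x' y : EE n,
      (∀ u, γ * ratio x' + β / 2 * ‖x' - (y - β⁻¹ • grd A b y)‖ ^ 2 ≤
        γ * ratio u + β / 2 * ‖u - (y - β⁻¹ • grd A b y)‖ ^ 2) →
      G ≤ 4 * ‖x'‖ + 3 * ‖x' - y‖ := by
  set wb : EE n := -(β⁻¹ • grd A b 0) with hwb
  have hwb0 : wb ≠ 0 := by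
    rw [hwb]; exact neg_ne_zero.2 (smul_ne_zero (by positivity) hAb)
  obtain ⟨i, hi⟩ : ∃ i, wb i ≠ 0 := by
    by_contra h
    push Not at h
    exact hwb0 (by ext i; simpa using h i)
  set u : EE n := wb i • EuclideanSpace.single i 1 with hu
  have hun : ‖u‖ = |wb i| := by rw [hu, norm_smul]; simp
  have hu0 : u ≠ 0 := by
    rw [← norm_pos_iff, hun]; exact abs_pos.2 hi
  have hru : ratio u = 1 := by
    have : l1 u = |wb i| := by
      have := l1_single (0 : EE n) i (wb i)
      rw [zero_add] at this
      rw [hu, this]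
      simp [l1]
    rw [ratio_of_ne hu0, this, hun, div_self (abs_pos.2 hi).ne']
  have hin : inner ℝ u wb = wb i ^ 2 := by
    rw [hu, inner_smul_left, EuclideanSpace.inner_single_left]; simp [sq]
  have hlt : ‖u - wb‖ < ‖wb‖ := by
    have : ‖u - wb‖ ^ 2 = ‖wb‖ ^ 2 - wb i ^ 2 := by
      rw [norm_sub_sq_real, hin, hun, sq_abs]; ring
    have h2 : 0 < wb i ^ 2 := by positivity
    exact lt_of_pow_lt_pow_left₀ 2 (norm_nonneg _) (by linarith)
  refine ⟨‖wb‖ - ‖u - wb‖, by linarith, fun x' y hopt => ?_⟩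
  set w : EE n := y - β⁻¹ • grd A b y with hw
  have h1 : ‖x' - w‖ ≤ ‖u - w‖ := by
    have := hopt u
    rw [hru] at this
    have h2 := mul_le_mul_of_nonneg_left (one_le_ratio x') hγ.le
    have h3 : β / 2 * ‖x' - w‖ ^ 2 ≤ β / 2 * ‖u - w‖ ^ 2 := by linarith
    exact le_of_sq_le_sq (le_of_mul_le_mul_left h3 (by positivity)) (norm_nonneg _)
  have h2 : ‖w - wb‖ ≤ 3 / 2 * ‖y‖ := by
    have e : w - wb = y - β⁻¹ • (grd A b y - grd A b 0) := by
      rw [hw, hwb, smul_sub]; abel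
    have h3 := hL y 0
    rw [sub_zero] at h3
    have h4 : ‖β⁻¹ • (grd A b y - grd A b 0)‖ ≤ 1 / 2 * ‖y‖ := by
      rw [norm_smul, Real.norm_of_nonneg (by positivity), inv_mul_le_iff₀ hβ0]
      nlinarith [norm_nonneg y]
    rw [e]
    linarith [norm_sub_le y (β⁻¹ • (grd A b y - grd A b 0))]
  have h5 : ‖wb‖ ≤ ‖x'‖ + ‖x' - w‖ + ‖w - wb‖ := by
    have e : wb = x' - (x' - w) - (w - wb) := by abel
    calc ‖wb‖ = ‖x' - (x' - w) - (w - wb)‖ := by rw [← e]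
      _ ≤ ‖x' - (x' - w)‖ + ‖w - wb‖ := norm_sub_le _ _
      _ ≤ _ := by gcongr; exact norm_sub_le _ _
  have h6 : ‖u - w‖ ≤ ‖u - wb‖ + ‖w - wb‖ := by
    have e : u - w = (u - wb) - (w - wb) := by abel
    rw [e]; exact norm_sub_le _ _
  have h7 : ‖y‖ ≤ ‖x'‖ + ‖x' - y‖ := by
    have e : y = x' - (x' - y) := by abel
    calc ‖y‖ = ‖x' - (x' - y)‖ := by rw [← e]
      _ ≤ _ := norm_sub_le _ _
  linarith

lemma sgr_bound {m n : ℕ} (A : Matrix (Fin m) (Fin n) ℝ) (b : EE m) (L γ β : ℝ) (hγ : 0 < γ)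
    (hL : ∀ x y, ‖grd A b x - grd A b y‖ ≤ L * ‖x - y‖) (hβ : 2 * L < β) (hβ0 : 0 < β)
    (x' y y' : EE n) (hx' : x' ≠ 0)
    (hopt : ∀ u, γ * ratio x' + β / 2 * ‖x' - (y - β⁻¹ • grd A b y)‖ ^ 2 ≤
        γ * ratio u + β / 2 * ‖u - (y - β⁻¹ • grd A b y)‖ ^ 2)
    (hz : grd A b y' = grd A b y + β • (x' - y')) :
    ∃ s : EE n, (∀ i, |s i| ≤ 1) ∧ (∀ i, s i * x' i = |x' i|) ∧
      ‖sgr A b γ x' s‖ ≤ 3 * β * ‖y' - y‖ := by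
  obtain ⟨s, h1, h2, h3⟩ := x_opt γ β hγ x' _ hx' hopt
  refine ⟨s, h1, h2, ?_⟩
  have e : sgr A b γ x' s = (grd A b x' - grd A b y) - β • (x' - y) := by
    unfold sgr
    have h4 : β • (x' - (y - β⁻¹ • grd A b y)) = β • (x' - y) + grd A b y := by
      rw [show x' - (y - β⁻¹ • grd A b y) = (x' - y) + β⁻¹ • grd A b y by abel, smul_add,
        smul_inv_smul₀ hβ0.ne']
    rw [h4] at h3
    rw [eq_neg_of_add_eq_zero_left h3]
    abel
  have h5 : ‖x' - y‖ ≤ 3 / 2 * ‖y' - y‖ := by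
    have := half_step A b L β hL hβ hβ0 x' y y' hz
    have e2 : x' - y = (x' - y') + (y' - y) := by abel
    rw [e2]
    linarith [norm_add_le (x' - y') (y' - y)]
  rw [e]
  have h6 := norm_sub_le (grd A b x' - grd A b y) (β • (x' - y))
  rw [norm_smul, Real.norm_of_nonneg hβ0.le] at h6
  have h7 := hL x' y
  have h8 : L * ‖x' - y‖ ≤ β / 2 * ‖x' - y‖ :=
    mul_le_mul_of_nonneg_right (by linarith) (norm_nonneg _)
  have h9 : β * ‖x' - y‖ ≤ β * (3 / 2 * ‖y' - y‖) := mul_le_mul_of_nonneg_left h5 hβ0.le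
  have h10 : 0 ≤ β * ‖y' - y‖ := by positivity
  linarith

lemma y_opt {m n : ℕ} (A : Matrix (Fin m) (Fin n) ℝ) (b : EE m) (L β : ℝ)
    (hL : ∀ x y, ‖grd A b x - grd A b y‖ ≤ L * ‖x - y‖) (hL0 : 0 ≤ L) (hβ0 : 0 < β)
    (x y z : EE n)
    (hopt : ∀ u, lsq A b y + β / 2 * ‖y - x - β⁻¹ • z‖ ^ 2 ≤
      lsq A b u + β / 2 * ‖u - x - β⁻¹ • z‖ ^ 2) :
    grd A b y = z + β • (x - y) := by
  have : grd A b y + β • (y - x - β⁻¹ • z) = 0 := by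
    refine quad_stat _ ((L + β) / 2) (by linarith) fun d => ?_
    have h1 := hopt (y + d)
    rw [lsq_expand, show y + d - x - β⁻¹ • z = (y - x - β⁻¹ • z) + d by abel,
      norm_add_sq_real (y - x - β⁻¹ • z) d] at h1
    have h2 := mv_sq_le A b L hL d
    have h3 : inner ℝ (grd A b y + β • (y - x - β⁻¹ • z)) d =
        inner ℝ (grd A b y) d + β * inner ℝ (y - x - β⁻¹ • z) d := by
      rw [inner_add_left, inner_smul_left]; rfl
    rw [h3]
    nlinarith
  have h4 : β • (y - x - β⁻¹ • z) = -(z + β • (x - y)) := by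
    rw [smul_sub, smul_inv_smul₀ hβ0.ne', smul_sub, smul_sub]; abel
  rw [h4] at this
  exact add_neg_eq_zero.1 this

/-! ### Convergence -/

lemma limit_stat {m n : ℕ} (A : Matrix (Fin m) (Fin n) ℝ) (b : EE m) (γ : ℝ) (hγ : 0 < γ)
    (x s : ℕ → EE n) (xinf : EE n) (hx0 : xinf ≠ 0)
    (hx : Filter.Tendsto x Filter.atTop (nhds xinf))
    (hs1 : ∀ k i, |s k i| ≤ 1) (hs2 : ∀ k i, s k i * x k i = |x k i|)
    (hxk : ∀ k, x k ≠ 0)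
    (hg : Filter.Tendsto (fun k => sgr A b γ (x k) (s k)) Filter.atTop (nhds 0)) :
    ∃ t : EE n, (∀ i, |t i| ≤ 1) ∧ (∀ i, t i * xinf i = |xinf i|) ∧ sgr A b γ xinf t = 0 := by
  have hr : ‖xinf‖ ≠ 0 := norm_ne_zero_iff.2 hx0
  have hrec : ∀ k, s k = ‖x k‖ • ((1 / γ) • (sgr A b γ (x k) (s k) - grd A b (x k)) +
      (l1 (x k) / ‖x k‖ ^ 3) • x k) := by
    intro k
    have : ‖x k‖ ≠ 0 := norm_ne_zero_iff.2 (hxk k)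
    unfold sgr
    rw [add_sub_cancel_right, smul_smul, one_div, inv_mul_cancel₀ hγ.ne', one_smul,
      sub_add_cancel, smul_smul, mul_inv_cancel₀ this, one_smul]
  have hn : Filter.Tendsto (fun k => ‖x k‖) Filter.atTop (nhds ‖xinf‖) := hx.norm
  have hl : Filter.Tendsto (fun k => l1 (x k)) Filter.atTop (nhds (l1 xinf)) :=
    (l1_continuous.tendsto xinf).comp hx
  have hgr : Filter.Tendsto (fun k => grd A b (x k)) Filter.atTop (nhds (grd A b xinf)) :=
    ((grd_continuous A b).tendsto xinf).comp hx
  set t : EE n := ‖xinf‖ • ((1 / γ) • (0 - grd A b xinf) + (l1 xinf / ‖xinf‖ ^ 3) • xinf) with ht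
  have hst : Filter.Tendsto s Filter.atTop (nhds t) := by
    have h1 : Filter.Tendsto (fun k => ‖x k‖ • ((1 / γ) • (sgr A b γ (x k) (s k) - grd A b (x k)) +
      (l1 (x k) / ‖x k‖ ^ 3) • x k)) Filter.atTop (nhds t) :=
      hn.smul (((hg.sub hgr).const_smul (1 / γ)).add
        ((hl.div (hn.pow 3) (pow_ne_zero 3 hr)).smul hx))
    exact h1.congr fun k => (hrec k).symm
  have hc : ∀ (f : ℕ → EE n) (a : EE n), Filter.Tendsto f Filter.atTop (nhds a) → ∀ i,
      Filter.Tendsto (fun k => f k i) Filter.atTop (nhds (a i)) := by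
    intro f a hf i
    have : Continuous fun v : EE n => v i := by fun_prop
    exact (this.tendsto a).comp hf
  refine ⟨t, fun i => ?_, fun i => ?_, ?_⟩
  · exact le_of_tendsto (hc _ _ hst i).abs (Filter.Eventually.of_forall fun k => hs1 k i)
  · refine tendsto_nhds_unique ((hc _ _ hst i).mul (hc _ _ hx i)) ?_
    exact (hc _ _ hx i).abs.congr fun k => (hs2 k i).symm
  · unfold sgr
    rw [ht, smul_smul, inv_mul_cancel₀ hr, one_smul, add_sub_cancel_right, smul_smul,
      mul_one_div_cancel hγ.ne', one_smul, zero_sub, neg_add_cancel]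

lemma admm_core {m n : ℕ} (A : Matrix (Fin m) (Fin n) ℝ) (b : EE m) (L γ β C : ℝ) (hγ : 0 < γ)
    (hL : ∀ x y, ‖grd A b x - grd A b y‖ ≤ L * ‖x - y‖) (hβ : 2 * L < β) (hβ0 : 0 < β)
    (hAb : grd A b 0 ≠ 0) (x y : ℕ → EE n)
    (hopt : ∀ k u, γ * ratio (x (k + 1)) + β / 2 * ‖x (k + 1) - (y k - β⁻¹ • grd A b (y k))‖ ^ 2 ≤
        γ * ratio u + β / 2 * ‖u - (y k - β⁻¹ • grd A b (y k))‖ ^ 2)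
    (hz : ∀ k, grd A b (y (k + 1)) = grd A b (y k) + β • (x (k + 1) - y (k + 1)))
    (hC : ∀ k, ‖x k‖ ≤ C) :
    ∃ xinf : EE n, Filter.Tendsto x Filter.atTop (nhds xinf) ∧ xinf ≠ 0 ∧
      ∃ t : EE n, (∀ i, |t i| ≤ 1) ∧ (∀ i, t i * xinf i = |xinf i|) ∧
        sgr A b γ xinf t = 0 := by
  set d : ℕ → ℝ := fun k => ‖y (k + 1) - y k‖ with hd
  set ψ : ℕ → ℝ := fun k => psi A b γ β (x k) (y k) with hψ
  have hd0 : ∀ k, 0 ≤ d k := fun k => norm_nonneg _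
  have hdec : ∀ k, β / 4 * d k ^ 2 ≤ ψ k - ψ (k + 1) := fun k =>
    psi_descent A b L γ β hL hβ hβ0 _ _ _ _ (hopt k (x k)) (hz k)
  have hhalf : ∀ k, ‖x (k + 1) - y (k + 1)‖ ≤ d k / 2 := fun k =>
    half_step A b L β hL hβ hβ0 _ _ _ (hz k)
  have hψ0 : ∀ k, 0 ≤ ψ k := by
    intro k
    have h1 := (psi_bounds A b L γ β hL hβ hβ0 (x k) (y k)).1
    have h2 := mul_le_mul_of_nonneg_left (one_le_ratio (x k)) hγ.le
    have h3 : 0 ≤ lsq A b (x k) := by unfold lsq; positivity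
    simp only [hψ]
    linarith
  have hanti : Antitone ψ := antitone_nat_of_succ_le fun k => by
    have := hdec k
    have : 0 ≤ β / 4 * d k ^ 2 := by positivity
    linarith
  have hbb : BddBelow (Set.range ψ) := ⟨0, by rintro _ ⟨k, rfl⟩; exact hψ0 k⟩
  have hlim := tendsto_atTop_ciInf hanti hbb
  set Fs := ⨅ k, ψ k with hFs
  have hge : ∀ k, Fs ≤ ψ k := fun k => ciInf_le hbb k
  have hd_lim : Filter.Tendsto d Filter.atTop (nhds 0) := by
    have h1 : Filter.Tendsto (fun k => 4 / β * (ψ k - ψ (k + 1))) Filter.atTop (nhds 0) := by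
      have := (hlim.sub ((Filter.tendsto_add_atTop_iff_nat 1).2 hlim)).const_mul (4 / β)
      simpa using this
    have h2 : Filter.Tendsto (fun k => d k ^ 2) Filter.atTop (nhds 0) := by
      refine squeeze_zero (fun k => sq_nonneg _) (fun k => ?_) h1
      rw [div_mul_eq_mul_div, le_div_iff₀ hβ0]
      linarith [hdec k]
    have h3 := h2.sqrt
    simpa [Real.sqrt_sq (hd0 _)] using h3
  obtain ⟨G, hG, hlow⟩ := x_lower A b L γ β hγ hL hβ hβ0 hAb
  have hxlow : ∀ᶠ k in Filter.atTop, G / 8 ≤ ‖x (k + 1)‖ := by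
    have : ∀ᶠ k in Filter.atTop, d k < G / 9 := hd_lim.eventually_lt_const (by positivity)
    filter_upwards [this] with k hk
    have h1 := hlow _ _ (hopt k)
    have h2 := hhalf k
    have h3 : ‖x (k + 1) - y k‖ ≤ 3 / 2 * d k := by
      have e2 : x (k + 1) - y k = (x (k + 1) - y (k + 1)) + (y (k + 1) - y k) := by abel
      rw [e2]
      linarith [norm_add_le (x (k + 1) - y (k + 1)) (y (k + 1) - y k), show
        ‖y (k + 1) - y k‖ = d k from rfl]
    linarith
  have hG8 : 0 < G / 8 := by positivity
  have hsum : Summable d := by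
    by_cases hex : ∃ k0, ψ k0 = Fs
    · obtain ⟨k0, hk0⟩ := hex
      rw [← summable_nat_add_iff k0]
      have : ∀ k, d (k + k0) = 0 := by
        intro k
        have h1 := hdec (k + k0)
        have h2 : ψ (k + k0) ≤ Fs := hk0 ▸ hanti (Nat.le_add_left k0 k)
        have h3 := hge (k + k0 + 1)
        have h4 : β / 4 * d (k + k0) ^ 2 ≤ 0 := by linarith
        have h5 : d (k + k0) ^ 2 ≤ 0 := nonpos_of_mul_nonpos_right h4 (by positivity)
        exact pow_eq_zero_iff (two_ne_zero) |>.1 (le_antisymm h5 (sq_nonneg _))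
      simp only [this]
      exact summable_zero
    · push Not at hex
      have hpos : ∀ k, 0 < ψ k - Fs := fun k => sub_pos.2 (lt_of_le_of_ne (hge k) (hex k).symm)
      obtain ⟨δ, hδ, M, φ, hM, hmono, hB, hφ, hKL⟩ := KL_ineq A b γ Fs (G / 8) C hG8
      have hev : ∀ᶠ k in Filter.atTop, ψ k < Fs + δ :=
        hlim.eventually_lt_const (by linarith)
      obtain ⟨K, hK⟩ := Filter.eventually_atTop.1 (hev.and hxlow)
      rw [← summable_nat_add_iff K]
      refine summable_kl (fun k => d (k + K)) (fun k => ψ (k + K) - Fs) β (3 * β + √β) δ hβ0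
        (by positivity) M φ hM hB hφ (fun k => hd0 _) (fun k => hpos _)
        (fun k => by linarith [(hK (k + K) (Nat.le_add_left K k)).1]) (fun k => ?_) (fun k => ?_)
      · have := hdec (k + K)
        rw [show k + 1 + K = k + K + 1 by ring]
        linarith
      · rw [show k + 1 + K = k + K + 1 by ring]
        set j := k + K with hj
        have hjK : K ≤ j := Nat.le_add_left K k
        have hxj := (hK j hjK).2
        have hvj := (hK (j + 1) (by omega)).1
        have hne : x (j + 1) ≠ 0 := norm_pos_iff.1 (by linarith)
        obtain ⟨s, hs1, hs2, hs3⟩ := sgr_bound A b L γ β hγ hL hβ hβ0 _ _ _ hne (hopt j) (hz j)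
        have hb := psi_bounds A b L γ β hL hβ hβ0 (x (j + 1)) (y (j + 1))
        have hobj : γ * ratio (x (j + 1)) + lsq A b (x (j + 1)) = obj A b γ (x (j + 1)) := by
          rw [ratio_of_ne hne]; rfl
        rw [hobj] at hb
        have hu2 : ‖x (j + 1) - y (j + 1)‖ ^ 2 ≤ d j ^ 2 / 4 := by
          nlinarith [hhalf j, norm_nonneg (x (j + 1) - y (j + 1))]
        have hlo : ψ (j + 1) - β / 8 * d j ^ 2 ≤ obj A b γ (x (j + 1)) := by
          have : β / 2 * ‖x (j + 1) - y (j + 1)‖ ^ 2 ≤ β / 2 * (d j ^ 2 / 4) :=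
            mul_le_mul_of_nonneg_left hu2 (by positivity)
          have h2 : ψ (j + 1) ≤ obj A b γ (x (j + 1)) +
            β / 2 * ‖x (j + 1) - y (j + 1)‖ ^ 2 := hb.2
          linarith
        have hhi : obj A b γ (x (j + 1)) ≤ ψ (j + 1) := hb.1
        have hvp := hpos (j + 1)
        have hsb : 0 ≤ √β * d j := mul_nonneg (Real.sqrt_nonneg _) (hd0 _)
        have hbd : 0 ≤ 3 * β * d j := mul_nonneg (by positivity) (hd0 _)
        by_cases hcase : (ψ (j + 1) - Fs) / 2 ≤ obj A b γ (x (j + 1)) - Fs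
        · left
          have h1 := hKL (x (j + 1)) s ⟨hxj, hC _, hs1, hs2⟩ (by linarith) (by linarith)
          have h2 : M ((ψ (j + 1) - Fs) / 2) ≤ M (obj A b γ (x (j + 1)) - Fs) :=
            hmono ⟨by linarith, by linarith⟩ ⟨by linarith, by linarith⟩ hcase
          have h3 : ‖sgr A b γ (x (j + 1)) s‖ ≤ 3 * β * d j := hs3
          calc _ ≤ 3 * β * d j := h2.trans (h1.trans h3)
            _ ≤ (3 * β + √β) * d j := by linarith
        · right
          push Not at hcase
          have h1 : ψ (j + 1) - Fs ≤ β / 4 * d j ^ 2 := by linarith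
          have h2 : √(ψ (j + 1) - Fs) ≤ √β * d j := by
            apply Real.sqrt_le_iff.2 ⟨hsb, ?_⟩
            rw [mul_pow, Real.sq_sqrt hβ0.le]
            nlinarith [mul_nonneg hβ0.le (sq_nonneg (d j))]
          calc _ ≤ √β * d j := h2
            _ ≤ (3 * β + √β) * d j := by linarith
  have hcau : CauchySeq y := cauchySeq_of_summable_dist (by
    refine hsum.congr fun k => ?_
    rw [dist_comm, dist_eq_norm])
  obtain ⟨xinf, hy⟩ := cauchySeq_tendsto_of_complete hcau
  have hx1 : Filter.Tendsto (fun k => x (k + 1)) Filter.atTop (nhds xinf) := by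
    have h1 : Filter.Tendsto (fun k => x (k + 1) - y (k + 1)) Filter.atTop (nhds 0) := by
      refine squeeze_zero_norm hhalf ?_
      simpa using hd_lim.div_const 2
    have h2 := h1.add ((Filter.tendsto_add_atTop_iff_nat 1).2 hy)
    simpa using h2
  have hx : Filter.Tendsto x Filter.atTop (nhds xinf) := (Filter.tendsto_add_atTop_iff_nat 1).1 hx1
  have hx0 : xinf ≠ 0 := by
    have := ge_of_tendsto hx1.norm hxlow
    exact norm_pos_iff.1 (by linarith)
  refine ⟨xinf, hx, hx0, ?_⟩
  obtain ⟨K, hK⟩ := Filter.eventually_atTop.1 hxlow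
  have hne : ∀ k, x (k + K + 1) ≠ 0 := fun k => norm_pos_iff.1 (by
    linarith [hK (k + K) (Nat.le_add_left K k)])
  choose s hs1 hs2 hs3 using fun k =>
    sgr_bound A b L γ β hγ hL hβ hβ0 _ _ _ (hne k) (hopt (k + K)) (hz (k + K))
  refine limit_stat A b γ hγ (fun k => x (k + K + 1)) s xinf hx0
    ((Filter.tendsto_add_atTop_iff_nat K).2 hx1) hs1 hs2 hne ?_
  refine squeeze_zero_norm hs3 ?_
  have := ((Filter.tendsto_add_atTop_iff_nat K).2 hd_lim).const_mul (3 * β)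
  simpa using this

theorem stmt14 {m n : ℕ} (A : Matrix (Fin m) (Fin n) ℝ) (b : EuclideanSpace ℝ (Fin m))
    (Φ : EuclideanSpace ℝ (Fin n) → ℝ)
    (hΦ : Φ = fun x => 1 / 2 * ‖mv A x - b‖ ^ 2)
    (L : ℝ)
    (hL : ∀ x y : EuclideanSpace ℝ (Fin n),
      ‖mv A.transpose (mv A x - b) - mv A.transpose (mv A y - b)‖ ≤ L * ‖x - y‖)
    (γ β : ℝ) (hγ : 0 < γ) (hβ : 2 * L < β)
    (hAb : mv A.transpose b ≠ 0)
    (x y z : ℕ → EuclideanSpace ℝ (Fin n))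
    (hADMM : ADMMpSeq β γ Set.univ Φ x y z)
    (hbdd : ∃ C : ℝ, ∀ k, ‖x k‖ ≤ C) :
    ∃ xinf : EuclideanSpace ℝ (Fin n),
      Filter.Tendsto x Filter.atTop (nhds xinf) ∧ xinf ≠ 0 ∧
      ∃ s : EuclideanSpace ℝ (Fin n),
        (∀ i, |s i| ≤ 1) ∧
        (∀ i, xinf i ≠ 0 → s i = if 0 < xinf i then 1 else -1) ∧
        γ • (‖xinf‖⁻¹ • s - (l1 xinf / ‖xinf‖ ^ 3) • xinf)
          + mv A.transpose (mv A xinf - b) = 0 := by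
  subst hΦ
  obtain ⟨C, hC⟩ := hbdd
  have hL' : ∀ u v : EE n, ‖grd A b u - grd A b v‖ ≤ L * ‖u - v‖ := hL
  have hL0 : 0 ≤ L := by
    have h1 := hL (mv A.transpose b) 0
    rw [sub_zero] at h1
    exact nonneg_of_mul_nonneg_left ((norm_nonneg _).trans h1) (norm_pos_iff.2 hAb)
  have hβ0 : 0 < β := by linarith
  have hg0 : grd A b 0 ≠ 0 := by
    have h1 : mv A (0 : EE n) = 0 := by ext j; simp [mv_apply]
    have h2 : grd A b 0 = -mv A.transpose b := by
      unfold grd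
      rw [h1, mv_sub]
      have h3 : mv A.transpose (0 : EE m) = 0 := by ext j; simp [mv_apply]
      rw [h3, zero_sub]
    rw [h2]
    exact neg_ne_zero.2 hAb
  have hzy : ∀ k, z (k + 1) = grd A b (y (k + 1)) := by
    intro k
    rw [(hADMM k).2.2]
    exact (y_opt A b L β hL' hL0 hβ0 _ _ _ (hADMM k).2.1).symm
  obtain ⟨xinf, hx, hx0, t, ht1, ht2, ht3⟩ := admm_core A b L γ β C hγ hL' hβ hβ0 hg0
    (fun k => x (k + 1)) (fun k => y (k + 1)) (by
      intro k u
      have h1 := ((hADMM (k + 1)).1).2 u (Set.mem_univ u)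
      rw [hzy k] at h1
      have h2 := mul_le_mul_of_nonneg_left h1 hγ.le
      have e : ∀ a q : ℝ, γ * (a + β / (2 * γ) * q) = γ * a + β / 2 * q := by
        intro a q; field_simp
      rw [e, e] at h2
      exact h2) (by
      intro k
      have h1 := (hADMM (k + 1)).2.2
      rw [hzy k, hzy (k + 1)] at h1
      exact h1) (fun k => hC _)
  refine ⟨xinf, (Filter.tendsto_add_atTop_iff_nat 1).1 hx, hx0, t, ht1, fun i hi => ?_, ht3⟩
  have h := ht2 i
  by_cases hp : 0 < xinf i
  · rw [if_pos hp]
    rw [abs_of_pos hp] at h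
    exact mul_right_cancel₀ hi (by rw [h, one_mul])
  · rw [if_neg hp]
    rw [abs_of_nonpos (not_lt.1 hp)] at h
    exact mul_right_cancel₀ hi (by rw [h]; ring)
end
end
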